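/- Let μₙ denote the Haar probability measure on the unitary group U(n). For U ∈ U(n), let Zₙ(U) be the minimum over pairs 1 ≤ j < k ≤ n of the circular distance min(|θⱼ(U) − θₖ(U)|, 2π − |θⱼ(U) − θₖ(U)|) between eigenvalue angles. Fix β > 0. Then as n → ∞, μₙ({U : Zₙ(U) · (n⁴/(72π))^(1/3) > β}) → exp(−β³). -/

import Mathlib

open MeasureTheory Filter Topology Real

/-- The matrix algebra carries the (Borel-generating) product measurable structure. -/
noncomputable instance matrixMeasurableSpace {m n α : Type*} [MeasurableSpace α] :
    MeasurableSpace (Matrix m n α) :=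
  inferInstanceAs (MeasurableSpace (m → n → α))



namespace CUE

instance matSC (n : ℕ) : SecondCountableTopology (Matrix (Fin n) (Fin n) ℂ) :=
  inferInstanceAs (SecondCountableTopology (Fin n → Fin n → ℂ))

instance matBorel (n : ℕ) : BorelSpace (Matrix (Fin n) (Fin n) ℂ) :=
  inferInstanceAs (BorelSpace (Fin n → Fin n → ℂ))

instance uSC (n : ℕ) : SecondCountableTopology (Matrix.unitaryGroup (Fin n) ℂ) :=
  TopologicalSpace.Subtype.secondCountableTopology
    {x : Matrix (Fin n) (Fin n) ℂ | x ∈ Matrix.unitaryGroup (Fin n) ℂ}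

instance uBorel (n : ℕ) : BorelSpace (Matrix.unitaryGroup (Fin n) ℂ) :=
  inferInstanceAs (BorelSpace
    {x : Matrix (Fin n) (Fin n) ℂ // x ∈ Matrix.unitaryGroup (Fin n) ℂ})

instance uCompact (n : ℕ) : CompactSpace (Matrix.unitaryGroup (Fin n) ℂ) := by
  have hcl : IsClosed {x : Matrix (Fin n) (Fin n) ℂ | x ∈ Matrix.unitaryGroup (Fin n) ℂ} := by
    simp only [Matrix.mem_unitaryGroup_iff]
    exact isClosed_eq (by fun_prop) continuous_const
  have hK : IsCompact (Set.pi Set.univ fun _ : Fin n => Set.pi Set.univ fun _ : Fin n =>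
      Metric.closedBall (0 : ℂ) 1) :=
    isCompact_univ_pi fun _ => isCompact_univ_pi fun _ => isCompact_closedBall _ _
  have : IsCompact {x : Matrix (Fin n) (Fin n) ℂ | x ∈ Matrix.unitaryGroup (Fin n) ℂ} := by
    refine IsCompact.of_isClosed_subset hK hcl ?_
    intro U hU
    refine fun i _ j _ => ?_
    rw [Metric.mem_closedBall, dist_zero_right]
    exact entry_norm_bound_of_unitary hU i j
  exact isCompact_iff_compactSpace.mp this

noncomputable instance circleMS : MeasurableSpace Circle := borel _
instance circleBorel : BorelSpace Circle := ⟨rfl⟩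

instance : Fact (0 < 2 * π) := ⟨by positivity⟩

/-- The Haar probability measure on the circle. -/
noncomputable def mC : Measure Circle :=
  (AddCircle.haarAddCircle (T := 2 * π)).map AddCircle.toCircle

instance : IsProbabilityMeasure mC :=
  Measure.isProbabilityMeasure_map AddCircle.continuous_toCircle.aemeasurable

theorem lintegral_mC (f : Circle → ENNReal) (hf : Measurable f) :
    ∫⁻ z, f z ∂mC = ENNReal.ofReal (1 / (2 * π)) * ∫⁻ t in Set.Ioc (-π) π, f (Circle.exp t) := by
  unfold mC
  rw [lintegral_map hf AddCircle.continuous_toCircle.measurable]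
  have h2 : (volume : Measure (AddCircle (2 * π))) =
      ENNReal.ofReal (2 * π) • AddCircle.haarAddCircle := AddCircle.volume_eq_smul_haarAddCircle
  have h3 : (AddCircle.haarAddCircle : Measure (AddCircle (2 * π))) =
      ENNReal.ofReal (1 / (2 * π)) • volume := by
    rw [h2, smul_smul, ← ENNReal.ofReal_mul (by positivity)]
    rw [one_div, inv_mul_cancel₀ (by positivity)]; simp
  rw [h3, lintegral_smul_measure, smul_eq_mul]
  congr 1
  have := AddCircle.lintegral_preimage (2 * π) (-π) (fun a => f (AddCircle.toCircle a))
  rw [← this]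
  have e : -π + 2 * π = π := by ring
  rw [e]
  refine lintegral_congr fun t => ?_
  congr 1
  rw [AddCircle.toCircle_apply_mk]
  congr 1
  field_simp

instance : mC.IsMulLeftInvariant := by
  refine ⟨fun g => ?_⟩
  obtain ⟨a, rfl⟩ := (AddCircle.homeomorphCircle (T := 2 * π) (by positivity)).surjective g
  rw [AddCircle.homeomorphCircle_apply]
  unfold mC
  have hm : Measurable (AddCircle.toCircle (T := 2 * π)) := AddCircle.continuous_toCircle.measurable
  rw [Measure.map_map (by fun_prop) hm]
  have : ((fun x => AddCircle.toCircle a * x) ∘ AddCircle.toCircle (T := 2 * π))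
      = AddCircle.toCircle ∘ (fun x => a + x) := by
    ext x; simp [AddCircle.toCircle_add]
  rw [this, ← Measure.map_map hm (by fun_prop), map_add_left_eq_self]

instance : mC.IsHaarMeasure := by
  refine Measure.isHaarMeasure_of_isCompact_nonempty_interior mC Set.univ isCompact_univ (by simp) ?_ ?_
  · simp
  · simp

/-- Infinitesimal invariance. -/
theorem integral_deriv_eq_zero {G : Type*} [Group G] [TopologicalSpace G] [IsTopologicalGroup G]
    [CompactSpace G] [MeasurableSpace G] [BorelSpace G]
    (μ : Measure G) [IsProbabilityMeasure μ] [μ.IsMulLeftInvariant]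
    (γ : ℝ → G) (hγ : γ 0 = 1) (F F' : G → ℂ) (hF : Continuous F) (hF' : Continuous F')
    (hd : ∀ g t, HasDerivAt (fun s => F (γ s * g)) (F' (γ t * g)) t) :
    ∫ g, F' g ∂μ = 0 := by
  obtain ⟨C, hC⟩ : ∃ C, ∀ g, ‖F' g‖ ≤ C := by
    obtain ⟨C, hC⟩ := isCompact_univ.exists_bound_of_continuousOn hF'.continuousOn
    exact ⟨C, fun g => hC g (Set.mem_univ _)⟩
  obtain ⟨C', hC'⟩ : ∃ C, ∀ g, ‖F g‖ ≤ C := by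
    obtain ⟨C, hC⟩ := isCompact_univ.exists_bound_of_continuousOn hF.continuousOn
    exact ⟨C, fun g => hC g (Set.mem_univ _)⟩
  have key := hasDerivAt_integral_of_dominated_loc_of_deriv_le (μ := μ) (𝕜 := ℝ) (x₀ := 0)
    (s := Set.univ) (F := fun t g => F (γ t * g)) (F' := fun t g => F' (γ t * g))
    (bound := fun _ => C) univ_mem
    (Eventually.of_forall fun t => ((hF.comp (continuous_const_mul _)).measurable.aestronglyMeasurable))
    (Integrable.of_bound (hF.comp (continuous_const_mul _)).measurable.aestronglyMeasurable C'
      (Eventually.of_forall fun g => hC' _))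
    (hF'.comp (continuous_const_mul _)).measurable.aestronglyMeasurable
    (Eventually.of_forall fun g t _ => hC _) (integrable_const _)
    (Eventually.of_forall fun g t _ => hd g t)
  have h1 := key.2
  have h2 : (fun t => ∫ g, F (γ t * g) ∂μ) = fun _ => ∫ g, F g ∂μ := by
    funext t; exact integral_mul_left_eq_self F (γ t)
  rw [h2] at h1
  have := h1.unique (hasDerivAt_const _ _)
  simpa [hγ] using this

end CUE



namespace CUE

/-- oriented sum from `0` to `m` -/
noncomputable def osum {E : Type*} [AddCommGroup E] (m : ℤ) (φ : ℤ → E) : E :=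
  ∑ j ∈ Finset.Ico 0 m, φ j - ∑ j ∈ Finset.Ico m 0, φ j

theorem osum_zero {E : Type*} [AddCommGroup E] (φ : ℤ → E) : osum 0 φ = 0 := by simp [osum]

theorem osum_add_one {E : Type*} [AddCommGroup E] (m : ℤ) (φ : ℤ → E) :
    osum (m + 1) φ = osum m φ + φ m := by
  unfold osum
  rcases le_or_gt 0 m with h | h
  · rw [Finset.Ico_eq_empty_of_le (a := m) (by omega), Finset.Ico_eq_empty_of_le (a := m + 1) (by omega)]
    have : Finset.Ico 0 (m + 1) = insert m (Finset.Ico 0 m) := by ext x; simp; omega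
    rw [this, Finset.sum_insert (by simp)]; simp [add_comm]
  · rw [Finset.Ico_eq_empty_of_le (b := m) (by omega), Finset.Ico_eq_empty_of_le (b := m + 1) (by omega)]
    have : Finset.Ico m 0 = insert m (Finset.Ico (m + 1) 0) := by ext x; simp; omega
    rw [this, Finset.sum_insert (by simp)]; simp [add_comm]

theorem osum_congr {E : Type*} [AddCommGroup E] (m : ℤ) {φ ψ : ℤ → E} (h : ∀ j, φ j = ψ j) :
    osum m φ = osum m ψ := by rw [funext h]

theorem osum_map {E E' : Type*} [AddCommGroup E] [AddCommGroup E'] (f : E →+ E') (m : ℤ)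
    (φ : ℤ → E) : f (osum m φ) = osum m (fun j => f (φ j)) := by
  simp [osum, map_sum]

theorem osum_finset_sum {E ι : Type*} [AddCommGroup E] (s : Finset ι) (m : ℤ) (φ : ι → ℤ → E) :
    ∑ i ∈ s, osum m (φ i) = osum m (fun j => ∑ i ∈ s, φ i j) := by
  unfold osum
  rw [Finset.sum_sub_distrib, Finset.sum_comm]
  congr 1
  rw [Finset.sum_comm]

theorem osum_telescope {E : Type*} [AddCommGroup E] (m : ℤ) (φ : ℤ → E) :
    osum m (fun j => φ (j + 1) - φ j) = φ m - φ 0 := by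
  induction m using Int.induction_on with
  | zero => simp [osum_zero]
  | succ k ih => rw [osum_add_one, ih]; abel
  | pred k ih =>
    have := osum_add_one (-(k : ℤ) - 1) (fun j => φ (j + 1) - φ j)
    simp only [sub_add_cancel] at this
    rw [this] at ih
    rw [← sub_eq_zero] at ih ⊢
    rw [← ih]; abel

theorem osum_const (m : ℤ) (c : ℂ) : osum m (fun _ => c) = m * c := by
  have := osum_telescope m (fun j => (j : ℂ) * c)
  simp only [Int.cast_add, Int.cast_one] at this
  rw [← osum_congr m (φ := fun j => ((j : ℂ) + 1) * c - j * c) (fun j => by ring), this]; simp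

abbrev R := MvPolynomial ℤ ℂ

/-- Schwinger--Dyson source term -/
noncomputable def Sm (m : ℤ) : R := osum m (fun j => MvPolynomial.X j * MvPolynomial.X (m - j))

/-- Schwinger--Dyson derivation -/
noncomputable def Dm (m : ℤ) : Derivation ℂ R R :=
  MvPolynomial.mkDerivation ℂ (fun l => (l : ℂ) • MvPolynomial.X (m + l))

/-- directional derivative of a polynomial -/
noncomputable def dF (c c' : ℤ → ℂ) (F : R) : ℂ :=
  (MvPolynomial.aeval (fun l => (TrivSqZeroExt.inl (c l) + TrivSqZeroExt.inr (c' l) :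
    TrivSqZeroExt ℂ ℂ)) F).snd

theorem dF_fst (c c' : ℤ → ℂ) (F : R) :
    (MvPolynomial.aeval (fun l => (TrivSqZeroExt.inl (c l) + TrivSqZeroExt.inr (c' l) :
    TrivSqZeroExt ℂ ℂ)) F).fst = MvPolynomial.eval c F := by
  induction F using MvPolynomial.induction_on with
  | C a => simp [TrivSqZeroExt.algebraMap_eq_inl]
  | add p q hp hq => simp only [map_add, TrivSqZeroExt.fst_add, hp, hq]
  | mul_X p i hp => simp only [map_mul, TrivSqZeroExt.fst_mul, hp, MvPolynomial.aeval_X,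
      TrivSqZeroExt.fst_add, TrivSqZeroExt.fst_inl, TrivSqZeroExt.fst_inr, add_zero,
      MvPolynomial.eval_X]

@[simp] theorem dF_C (c c' : ℤ → ℂ) (a : ℂ) : dF c c' (MvPolynomial.C a) = 0 := by
  simp [dF, TrivSqZeroExt.algebraMap_eq_inl]

@[simp] theorem dF_X (c c' : ℤ → ℂ) (l : ℤ) : dF c c' (MvPolynomial.X l) = c' l := by simp [dF]

@[simp] theorem dF_add (c c' : ℤ → ℂ) (F G : R) : dF c c' (F + G) = dF c c' F + dF c c' G := by
  simp [dF]

@[simp] theorem dF_mul (c c' : ℤ → ℂ) (F G : R) : dF c c' (F * G) =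
    MvPolynomial.eval c F * dF c c' G + MvPolynomial.eval c G * dF c c' F := by
  simp only [dF, map_mul, TrivSqZeroExt.snd_mul, dF_fst, smul_eq_mul]
  simp [mul_comm]

theorem dF_lin {ι : Type*} (s : Finset ι) (c : ℤ → ℂ) (a : ι → ℂ) (c' : ι → ℤ → ℂ) (F : R) :
    ∑ i ∈ s, a i * dF c (c' i) F = dF c (fun l => ∑ i ∈ s, a i * c' i l) F := by
  induction F using MvPolynomial.induction_on with
  | C a => simp
  | add p q hp hq => simp [← hp, ← hq, mul_add, Finset.sum_add_distrib]
  | mul_X p i hp =>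
    simp only [dF_mul, dF_X, ← hp, Finset.mul_sum, ← Finset.sum_add_distrib]
    exact Finset.sum_congr rfl fun i _ => by ring

theorem dF_Dm (c : ℤ → ℂ) (m : ℤ) (F : R) :
    dF c (fun l => l * c (m + l)) F = MvPolynomial.eval c (Dm m F) := by
  induction F using MvPolynomial.induction_on with
  | C a => simp [Dm]
  | add p q hp hq => simp [hp, hq]
  | mul_X p i hp =>
    simp only [dF_mul, dF_X, Derivation.leibniz, hp, map_add, smul_eq_mul, map_mul]
    congr 1
    simp [Dm, MvPolynomial.mkDerivation_X]

theorem hasDerivAt_aeval (c : ℤ → ℝ → ℂ) (c' : ℤ → ℂ) (t : ℝ)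
    (h : ∀ l, HasDerivAt (c l) (c' l) t) (F : R) :
    HasDerivAt (fun s => MvPolynomial.eval (fun l => c l s) F) (dF (fun l => c l t) c' F) t := by
  induction F using MvPolynomial.induction_on with
  | C a => simpa using hasDerivAt_const t a
  | add p q hp hq => simp only [map_add, dF_add]; exact hp.add hq
  | mul_X p i hp =>
    simp only [map_mul, MvPolynomial.eval_X, dF_mul, dF_X]
    refine (hp.mul (h i)).congr_deriv ?_
    ring

/-- power traces -/
noncomputable def pU {n : ℕ} (U : Matrix.unitaryGroup (Fin n) ℂ) (l : ℤ) : ℂ :=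
  Matrix.trace ((U ^ l : Matrix.unitaryGroup (Fin n) ℂ) : Matrix (Fin n) (Fin n) ℂ)

/-- power sums -/
noncomputable def pT {n : ℕ} (z : Fin n → Circle) (l : ℤ) : ℂ := ∑ j, (z j : ℂ) ^ l

theorem continuous_zpowU {n : ℕ} (l : ℤ) : Continuous (fun U : Matrix.unitaryGroup (Fin n) ℂ =>
    ((U ^ l : Matrix.unitaryGroup (Fin n) ℂ) : Matrix (Fin n) (Fin n) ℂ)) :=
  continuous_subtype_val.comp (continuous_zpow l)

theorem continuous_pU {n : ℕ} (l : ℤ) : Continuous (fun U : Matrix.unitaryGroup (Fin n) ℂ => pU U l) :=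
  (continuous_zpowU l).matrix_trace

theorem continuous_pT {n : ℕ} (l : ℤ) : Continuous (fun z : Fin n → Circle => pT z l) := by
  unfold pT
  refine continuous_finsetSum _ fun j _ => ?_
  refine Continuous.zpow₀ (by fun_prop) l fun z => Or.inl (Circle.coe_ne_zero _)

theorem continuous_aeval {X : Type*} [TopologicalSpace X] (c : X → ℤ → ℂ)
    (hc : ∀ l, Continuous fun x => c x l) (F : R) :
    Continuous fun x => MvPolynomial.eval (c x) F := by
  induction F using MvPolynomial.induction_on with
  | C a => simpa using continuous_const
  | add p q hp hq => simp only [map_add, dF_add]; exact hp.add hq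
  | mul_X p i hp => simp only [map_mul, MvPolynomial.eval_X]; exact hp.mul (hc i)

theorem continuous_dF {X : Type*} [TopologicalSpace X] (c c' : X → ℤ → ℂ)
    (hc : ∀ l, Continuous fun x => c x l) (hc' : ∀ l, Continuous fun x => c' x l) (F : R) :
    Continuous fun x => dF (c x) (c' x) F := by
  induction F using MvPolynomial.induction_on with
  | C a => simpa using continuous_const
  | add p q hp hq => simp only [map_add, dF_add]; exact hp.add hq
  | mul_X p i hp =>
    simp only [dF_mul, dF_X, MvPolynomial.eval_X]
    exact ((continuous_aeval c hc p).mul (hc' i)).add ((hc i).mul hp)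

end CUE



namespace CUE

/-- entrywise derivative of a matrix valued curve -/
def HD {n : ℕ} (M : ℝ → Matrix (Fin n) (Fin n) ℂ) (M' : Matrix (Fin n) (Fin n) ℂ) (t : ℝ) : Prop :=
  ∀ a b, HasDerivAt (fun s => M s a b) (M' a b) t

theorem HD.mul {n : ℕ} {M N : ℝ → Matrix (Fin n) (Fin n) ℂ} {M' N' : Matrix (Fin n) (Fin n) ℂ}
    {t : ℝ} (hM : HD M M' t) (hN : HD N N' t) :
    HD (fun s => M s * N s) (M' * N t + M t * N') t := by
  intro a b
  simp only [Matrix.mul_apply, Matrix.add_apply]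
  rw [← Finset.sum_add_distrib]
  exact HasDerivAt.fun_sum fun k _ => (hM a k).mul (hN k b)

theorem HD.star {n : ℕ} {M : ℝ → Matrix (Fin n) (Fin n) ℂ} {M' : Matrix (Fin n) (Fin n) ℂ}
    {t : ℝ} (hM : HD M M' t) : HD (fun s => star (M s)) (star M') t := by
  intro a b
  exact (hM b a).star

theorem HD_const {n : ℕ} (M : Matrix (Fin n) (Fin n) ℂ) (t : ℝ) : HD (fun _ => M) 0 t :=
  fun _ _ => hasDerivAt_const _ _

section
open scoped Matrix.Norms.Operator

theorem HD_exp {n : ℕ} (X : Matrix (Fin n) (Fin n) ℂ) (t : ℝ) :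
    HD (fun s => NormedSpace.exp (s • X)) (X * NormedSpace.exp (t • X)) t := by
  intro a b
  have h := hasDerivAt_exp_smul_const' (𝕂 := ℝ) X t
  exact (hasDerivAt_pi.1 ((hasDerivAt_pi.1 h) a)) b

end

theorem exp_mem {n : ℕ} (X : Matrix (Fin n) (Fin n) ℂ) (hX : star X = -X) (t : ℝ) :
    NormedSpace.exp (t • X) ∈ Matrix.unitaryGroup (Fin n) ℂ := by
  rw [Matrix.mem_unitaryGroup_iff, Matrix.star_eq_conjTranspose, ← Matrix.exp_conjTranspose]
  have : (t • X).conjTranspose = -(t • X) := by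
    rw [Matrix.conjTranspose_smul, ← Matrix.star_eq_conjTranspose, hX]; simp
  rw [this, Matrix.exp_neg]
  exact Matrix.mul_nonsing_inv _ ((Matrix.isUnit_iff_isUnit_det _).1 (Matrix.isUnit_exp _))

/-- unitary one-parameter group -/
noncomputable def gam {n : ℕ} (X : Matrix (Fin n) (Fin n) ℂ) (hX : star X = -X) (t : ℝ) :
    Matrix.unitaryGroup (Fin n) ℂ := ⟨NormedSpace.exp (t • X), exp_mem X hX t⟩

theorem gam_zero {n : ℕ} (X : Matrix (Fin n) (Fin n) ℂ) (hX : star X = -X) : gam X hX 0 = 1 := by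
  ext a b; simp [gam]

theorem HD_gam {n : ℕ} (X : Matrix (Fin n) (Fin n) ℂ) (hX : star X = -X) 
    (g : Matrix.unitaryGroup (Fin n) ℂ) (t : ℝ) :
    HD (fun s => ((gam X hX s * g : Matrix.unitaryGroup (Fin n) ℂ) : Matrix (Fin n) (Fin n) ℂ))
      (X * ((gam X hX t * g : Matrix.unitaryGroup (Fin n) ℂ) : Matrix (Fin n) (Fin n) ℂ)) t := by
  have := (HD_exp X t).mul (HD_const (g : Matrix (Fin n) (Fin n) ℂ) t)
  simp only [mul_zero, add_zero, mul_assoc] at this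
  exact this

/-- formal derivative of a matrix power in direction `X` -/
noncomputable def dpow {n : ℕ} (V : Matrix.unitaryGroup (Fin n) ℂ) (X : Matrix (Fin n) (Fin n) ℂ)
    (m : ℤ) : Matrix (Fin n) (Fin n) ℂ :=
  osum m (fun j => ((V ^ j : Matrix.unitaryGroup (Fin n) ℂ) : Matrix (Fin n) (Fin n) ℂ) * X *
    ((V ^ (m - j) : Matrix.unitaryGroup (Fin n) ℂ) : Matrix (Fin n) (Fin n) ℂ))

theorem coe_zpow_add {n : ℕ} (V : Matrix.unitaryGroup (Fin n) ℂ) (i j : ℤ) :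
    ((V ^ (i + j) : Matrix.unitaryGroup (Fin n) ℂ) : Matrix (Fin n) (Fin n) ℂ) =
    ((V ^ i : Matrix.unitaryGroup (Fin n) ℂ) : Matrix (Fin n) (Fin n) ℂ) *
    ((V ^ j : Matrix.unitaryGroup (Fin n) ℂ) : Matrix (Fin n) (Fin n) ℂ) := by
  rw [zpow_add]; rfl

theorem osum_mul_right {n : ℕ} (m : ℤ) (φ : ℤ → Matrix (Fin n) (Fin n) ℂ)
    (A : Matrix (Fin n) (Fin n) ℂ) : osum m φ * A = osum m (fun j => φ j * A) :=
  osum_map (AddMonoidHom.mulRight A) m φ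

theorem dpow_succ {n : ℕ} (V : Matrix.unitaryGroup (Fin n) ℂ) (X : Matrix (Fin n) (Fin n) ℂ)
    (m : ℤ) : dpow V X (m + 1) = dpow V X m * V +
      ((V ^ m : Matrix.unitaryGroup (Fin n) ℂ) : Matrix (Fin n) (Fin n) ℂ) * (X * V) := by
  unfold dpow
  rw [osum_add_one, osum_mul_right]
  congr 1
  · refine osum_congr _ fun j => ?_
    have : m + 1 - j = (m - j) + 1 := by ring
    rw [this, coe_zpow_add, zpow_one]; simp only [mul_assoc]
  · have : m + 1 - m = 1 := by ring
    rw [this, zpow_one, mul_assoc]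

theorem HD_zpow {n : ℕ} (X : Matrix (Fin n) (Fin n) ℂ) (hX : star X = -X) 
    (g : Matrix.unitaryGroup (Fin n) ℂ) (t : ℝ) (m : ℤ) :
    HD (fun s => (((gam X hX s * g) ^ m : Matrix.unitaryGroup (Fin n) ℂ) : Matrix (Fin n) (Fin n) ℂ))
      (dpow (gam X hX t * g) X m) t := by
  induction m using Int.induction_on with
  | zero => 
    simp only [zpow_zero, dpow, osum_zero]
    exact HD_const _ _
  | succ k ih =>
    have := ih.mul (HD_gam X hX g t)
    rw [dpow_succ]
    simpa only [coe_zpow_add, zpow_one] using this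
  | pred k ih =>
    have h := ih.mul (HD_gam X hX g t).star
    have e : ∀ s, (((gam X hX s * g) ^ (-(k : ℤ)) : Matrix.unitaryGroup (Fin n) ℂ) : Matrix (Fin n) (Fin n) ℂ)
      * star ((gam X hX s * g : Matrix.unitaryGroup (Fin n) ℂ) : Matrix (Fin n) (Fin n) ℂ) =
      (((gam X hX s * g) ^ (-(k : ℤ) - 1) : Matrix.unitaryGroup (Fin n) ℂ) : Matrix (Fin n) (Fin n) ℂ) := by
      intro s
      rw [sub_eq_add_neg, coe_zpow_add, zpow_neg_one]
      rfl
    simp only [e] at h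
    convert h using 1
    set V := gam X hX t * g with hV
    have h1 := dpow_succ V X (-(k : ℤ) - 1)
    rw [sub_add_cancel] at h1
    rw [h1, add_mul]
    have hVV : (V : Matrix (Fin n) (Fin n) ℂ) * star (V : Matrix (Fin n) (Fin n) ℂ) = 1 :=
      Matrix.mem_unitaryGroup_iff.1 V.2
    have hs : ((V ^ (-(k : ℤ)) : Matrix.unitaryGroup (Fin n) ℂ) : Matrix (Fin n) (Fin n) ℂ) * 
      star (V : Matrix (Fin n) (Fin n) ℂ) = 
      ((V ^ (-(k : ℤ) - 1) : Matrix.unitaryGroup (Fin n) ℂ) : Matrix (Fin n) (Fin n) ℂ) := e t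
    rw [star_mul, hX, ← mul_assoc (((V ^ (-(k : ℤ)) : Matrix.unitaryGroup (Fin n) ℂ) : Matrix (Fin n) (Fin n) ℂ)), hs]
    simp only [mul_assoc, hVV, mul_one, mul_neg]
    abel

theorem trace_dpow {n : ℕ} (V : Matrix.unitaryGroup (Fin n) ℂ) (X : Matrix (Fin n) (Fin n) ℂ)
    (l : ℤ) : (dpow V X l).trace =
      l * (X * ((V ^ l : Matrix.unitaryGroup (Fin n) ℂ) : Matrix (Fin n) (Fin n) ℂ)).trace := by
  have := osum_map (Matrix.traceAddMonoidHom (Fin n) ℂ) l (fun j => ((V ^ j : Matrix.unitaryGroup (Fin n) ℂ) : Matrix (Fin n) (Fin n) ℂ) * X *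
    ((V ^ (l - j) : Matrix.unitaryGroup (Fin n) ℂ) : Matrix (Fin n) (Fin n) ℂ))
  simp only [Matrix.traceAddMonoidHom_apply] at this
  rw [dpow, this, ← osum_const]
  refine osum_congr _ fun j => ?_
  rw [Matrix.trace_mul_comm, ← mul_assoc, ← coe_zpow_add, Matrix.trace_mul_comm]
  simp

theorem hasDerivAt_pU {n : ℕ} (X : Matrix (Fin n) (Fin n) ℂ) (hX : star X = -X) 
    (g : Matrix.unitaryGroup (Fin n) ℂ) (t : ℝ) (l : ℤ) :
    HasDerivAt (fun s => pU (gam X hX s * g) l) (l * (X * (((gam X hX t * g) ^ l :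
      Matrix.unitaryGroup (Fin n) ℂ) : Matrix (Fin n) (Fin n) ℂ)).trace) t := by
  rw [← trace_dpow]
  have h := HasDerivAt.fun_sum (u := (Finset.univ : Finset (Fin n)))
    fun a _ => HD_zpow X hX g t l a a
  exact h

/-- the integrand in the Schwinger--Dyson equation -/
noncomputable def sdI {n : ℕ} (X : Matrix (Fin n) (Fin n) ℂ) (m : ℤ) (a b : Fin n) (F : R)
    (V : Matrix.unitaryGroup (Fin n) ℂ) : ℂ :=
  dpow V X m a b * MvPolynomial.eval (pU V) F +
    ((V ^ m : Matrix.unitaryGroup (Fin n) ℂ) : Matrix (Fin n) (Fin n) ℂ) a b *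
    dF (pU V) (fun l => l * (X * ((V ^ l : Matrix.unitaryGroup (Fin n) ℂ) :
      Matrix (Fin n) (Fin n) ℂ)).trace) F

theorem continuous_dpow {n : ℕ} (X : Matrix (Fin n) (Fin n) ℂ) (m : ℤ) :
    Continuous fun V : Matrix.unitaryGroup (Fin n) ℂ => dpow V X m := by
  unfold dpow osum
  refine Continuous.sub ?_ ?_ <;>
  exact continuous_finsetSum _ fun j _ => 
    ((continuous_zpowU j).mul continuous_const).mul (continuous_zpowU _)

theorem continuous_sdI {n : ℕ} (X : Matrix (Fin n) (Fin n) ℂ) (m : ℤ) (a b : Fin n) (F : R) :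
    Continuous (sdI X m a b F) := by
  unfold sdI
  refine Continuous.add (Continuous.mul ((continuous_dpow X m).matrix_elem a b) ?_) (Continuous.mul 
    ((continuous_zpowU m).matrix_elem a b) ?_)
  · exact continuous_aeval _ continuous_pU F
  · refine continuous_dF _ _ continuous_pU (fun l => ?_) F
    exact continuous_const.mul (continuous_const.mul (continuous_zpowU l)).matrix_trace

theorem sd_skew {n : ℕ} (μ : Measure (Matrix.unitaryGroup (Fin n) ℂ)) [IsProbabilityMeasure μ]
    [μ.IsMulLeftInvariant] (X : Matrix (Fin n) (Fin n) ℂ) (hX : star X = -X) (m : ℤ)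
    (a b : Fin n) (F : R) : ∫ V, sdI X m a b F V ∂μ = 0 := by
  refine integral_deriv_eq_zero μ (gam X hX) (gam_zero X hX) 
    (fun V => ((V ^ m : Matrix.unitaryGroup (Fin n) ℂ) : Matrix (Fin n) (Fin n) ℂ) a b *
      MvPolynomial.eval (pU V) F) _ 
    (((continuous_zpowU m).matrix_elem a b).mul (continuous_aeval _ continuous_pU F))
    (continuous_sdI X m a b F) ?_
  intro g t
  exact (HD_zpow X hX g t m a b).mul (hasDerivAt_aeval (fun l s => pU (gam X hX s * g) l) _ t
    (fun l => hasDerivAt_pU X hX g t l) F)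

theorem integrable_cont {X : Type*} [TopologicalSpace X] [CompactSpace X] [MeasurableSpace X]
    [BorelSpace X] (μ : Measure X) [IsFiniteMeasure μ] (f : X → ℂ) (hf : Continuous f) :
    Integrable f μ := by
  obtain ⟨C, hC⟩ := isCompact_univ.exists_bound_of_continuousOn hf.continuousOn
  exact Integrable.of_bound hf.measurable.aestronglyMeasurable C
      (Eventually.of_forall fun g => hC _ (Set.mem_univ _))

theorem dF_comb (c c1 c2 : ℤ → ℂ) (x y : ℂ) (F : R) :
    dF c (fun l => x * c1 l + y * c2 l) F = x * dF c c1 F + y * dF c c2 F := by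
  induction F using MvPolynomial.induction_on with
  | C a => simp
  | add p q hp hq => simp [hp, hq]; ring
  | mul_X p i hp =>
    simp only [dF_mul, dF_X, hp]
    ring

theorem sdI_comb {n : ℕ} (X Y : Matrix (Fin n) (Fin n) ℂ) (x y : ℂ) (m : ℤ) (a b : Fin n) (F : R)
    (V : Matrix.unitaryGroup (Fin n) ℂ) :
    sdI (x • X + y • Y) m a b F V = x * sdI X m a b F V + y * sdI Y m a b F V := by
  unfold sdI
  have h1 : dpow V (x • X + y • Y) m = x • dpow V X m + y • dpow V Y m := by
    simp only [dpow, osum, Matrix.mul_add, Matrix.add_mul, Finset.sum_add_distrib, Matrix.mul_smul,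
      Matrix.smul_mul, ← Finset.smul_sum, smul_sub]
    abel
  have h2 : (fun l : ℤ => (l : ℂ) * ((x • X + y • Y) * ((V ^ l : Matrix.unitaryGroup (Fin n) ℂ) :
      Matrix (Fin n) (Fin n) ℂ)).trace) = fun l : ℤ => x * ((l : ℂ) * (X * ((V ^ l : Matrix.unitaryGroup (Fin n) ℂ) :
      Matrix (Fin n) (Fin n) ℂ)).trace) + y * ((l : ℂ) * (Y * ((V ^ l : Matrix.unitaryGroup (Fin n) ℂ) :
      Matrix (Fin n) (Fin n) ℂ)).trace) := by
    funext l
    simp only [add_mul, Matrix.smul_mul, Matrix.trace_add, Matrix.trace_smul, smul_eq_mul]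
    ring
  rw [h1, h2, dF_comb]
  simp only [Matrix.add_apply, Matrix.smul_apply, smul_eq_mul]
  ring

theorem sd_all {n : ℕ} (μ : Measure (Matrix.unitaryGroup (Fin n) ℂ)) [IsProbabilityMeasure μ]
    [μ.IsMulLeftInvariant] (X : Matrix (Fin n) (Fin n) ℂ) (m : ℤ)
    (a b : Fin n) (F : R) : ∫ V, sdI X m a b F V ∂μ = 0 := by
  have hX : X = (1/2 : ℂ) • (X - star X) + (-(Complex.I / 2)) • (Complex.I • (X + star X)) := by
    rw [smul_smul]
    have : -(Complex.I / 2) * Complex.I = 1 / 2 := by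
      linear_combination (-1/2 : ℂ) * Complex.I_mul_I
    rw [this, ← smul_add, sub_add_add_cancel, ← two_smul ℂ X, smul_smul]; norm_num
  rw [hX]
  simp only [sdI_comb]
  rw [integral_add, integral_const_mul, integral_const_mul, sd_skew, sd_skew]
  · simp
  · rw [star_smul, star_add, star_star]; simp [add_comm]
  · simp
  · exact integrable_cont μ _ (continuous_const.mul (continuous_sdI _ m a b F))
  · exact integrable_cont μ _ (continuous_const.mul (continuous_sdI _ m a b F))

theorem sd_sum {n : ℕ} (m : ℤ) (F : R) (V : Matrix.unitaryGroup (Fin n) ℂ) :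
    ∑ a, ∑ b, sdI (Matrix.single a b 1) m a b F V = MvPolynomial.eval (pU V) (Sm m * F + Dm m F) := by
  unfold sdI
  simp only [Finset.sum_add_distrib, map_add, map_mul, ← Finset.sum_mul]
  congr 1
  · congr 1
    have h : ∀ a b, dpow V (Matrix.single a b 1) m a b = osum m fun j => 
      ((V ^ j : Matrix.unitaryGroup (Fin n) ℂ) : Matrix (Fin n) (Fin n) ℂ) a a * 
      ((V ^ (m - j) : Matrix.unitaryGroup (Fin n) ℂ) : Matrix (Fin n) (Fin n) ℂ) b b := by
      intro a b
      rw [dpow]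
      have := osum_map ((Matrix.entryAddMonoidHom ℂ a b)) m (fun j => ((V ^ j : Matrix.unitaryGroup (Fin n) ℂ) : Matrix (Fin n) (Fin n) ℂ) * Matrix.single a b 1 *
    ((V ^ (m - j) : Matrix.unitaryGroup (Fin n) ℂ) : Matrix (Fin n) (Fin n) ℂ))
      simp only [Matrix.entryAddMonoidHom_apply] at this
      rw [this]
      refine osum_congr _ fun j => ?_
      rw [mul_assoc, Matrix.mul_apply, Finset.sum_eq_single a]
      · simp
      · intro c _ hc; simp [hc]
      · simp
    simp only [h, osum_finset_sum]
    rw [Sm]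
    have := osum_map (MvPolynomial.eval (pU V) : R →+* ℂ).toAddMonoidHom m (fun j => MvPolynomial.X j * MvPolynomial.X (m - j))
    simp only [RingHom.toAddMonoidHom_eq_coe, AddMonoidHom.coe_coe] at this
    rw [this]
    refine osum_congr _ fun j => ?_
    rw [map_mul, MvPolynomial.eval_X, MvPolynomial.eval_X, pU, pU, Matrix.trace, Matrix.trace,
      Finset.sum_mul_sum]
    rfl
  · rw [← dF_Dm]
    have h := dF_lin (Finset.univ : Finset (Fin n × Fin n)) (pU V) (fun x : Fin n × Fin n =>
      ((V ^ m : Matrix.unitaryGroup (Fin n) ℂ) : Matrix (Fin n) (Fin n) ℂ) x.1 x.2)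
      (fun (x : Fin n × Fin n) (l : ℤ) => (l : ℂ) * (Matrix.single x.1 x.2 (1 : ℂ) *
        ((V ^ l : Matrix.unitaryGroup (Fin n) ℂ) : Matrix (Fin n) (Fin n) ℂ)).trace) F
    simp only [Fintype.sum_prod_type] at h
    rw [h]
    congr 1
    funext l
    rw [pU, coe_zpow_add, Matrix.trace, Finset.mul_sum]
    refine Finset.sum_congr rfl fun a _ => ?_
    rw [Matrix.diag_apply, Matrix.mul_apply, Finset.mul_sum]
    refine Finset.sum_congr rfl fun b _ => ?_
    simp only [Matrix.trace_single_mul]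
    simp
    ring

/-- Schwinger--Dyson equation for Haar measure on the unitary group. -/
theorem sd_U {n : ℕ} (μ : Measure (Matrix.unitaryGroup (Fin n) ℂ)) [IsProbabilityMeasure μ]
    [μ.IsMulLeftInvariant] (m : ℤ) (F : R) :
    ∫ V, MvPolynomial.eval (pU V) (Sm m * F + Dm m F) ∂μ = 0 := by
  simp only [← sd_sum]
  rw [integral_finsetSum]
  · refine Finset.sum_eq_zero fun a _ => ?_
    rw [integral_finsetSum]
    · exact Finset.sum_eq_zero fun b _ => sd_all μ _ m a b F
    · exact fun b _ => integrable_cont μ _ (continuous_sdI _ m a b F)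
  · exact fun a _ => integrable_cont μ _ (continuous_finsetSum _ fun b _ => continuous_sdI _ m a b F)

end CUE



namespace CUE

/-- Haar probability measure on a torus -/
noncomputable def mT (ι : Type*) [Fintype ι] : Measure (ι → Circle) := Measure.pi fun _ => mC

instance {ι : Type*} [Fintype ι] : IsProbabilityMeasure (mT ι) := by unfold mT; infer_instance
instance {ι : Type*} [Fintype ι] : (mT ι).IsHaarMeasure := by unfold mT; infer_instance

/-- squared modulus of the Vandermonde determinant -/
noncomputable def W {n : ℕ} (z : Fin n → Circle) : ℂ :=
  ∏ p ∈ (Finset.univ : Finset (Fin n)).offDiag, (1 - (z p.1 : ℂ) / (z p.2 : ℂ))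

/-- coordinate curve -/
noncomputable def gT {n : ℕ} (j : Fin n) (t : ℝ) : Fin n → Circle := Pi.mulSingle j (Circle.exp t)

/-- Kronecker delta -/
def EE {n : ℕ} (j a : Fin n) : ℂ := if a = j then 1 else 0

theorem gT_apply {n : ℕ} (j : Fin n) (t : ℝ) (g : Fin n → Circle) (a : Fin n) (l : ℤ) :
    (((gT j t * g) a : Circle) : ℂ) ^ l = Complex.exp ((t : ℂ) * (EE j a * l * Complex.I)) * (g a : ℂ) ^ l := by
  unfold gT EE
  by_cases h : a = j
  · subst h
    simp only [Pi.mul_apply, Pi.mulSingle_eq_same, Circle.coe_mul, Circle.coe_exp, mul_zpow, if_true]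
    rw [← Complex.exp_int_mul]
    congr 2; ring
  · simp [h]

theorem hd_zpow {n : ℕ} (j : Fin n) (t : ℝ) (g : Fin n → Circle) (a : Fin n) (l : ℤ) :
    HasDerivAt (fun s => (((gT j s * g) a : Circle) : ℂ) ^ l)
      (Complex.I * (EE j a * l * (((gT j t * g) a : Circle) : ℂ) ^ l)) t := by
  simp only [gT_apply]
  have h1 : HasDerivAt (fun s : ℝ => (s : ℂ) * (EE j a * l * Complex.I)) (EE j a * l * Complex.I) t := by
    simpa using (Complex.ofRealCLM.hasDerivAt (x := t)).mul_const (EE j a * l * Complex.I)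
  refine (h1.cexp.mul_const ((g a : ℂ) ^ l)).congr_deriv ?_
  ring

theorem hd_pT {n : ℕ} (j : Fin n) (t : ℝ) (g : Fin n → Circle) (l : ℤ) :
    HasDerivAt (fun s => pT (gT j s * g) l)
      (Complex.I * (l * (((gT j t * g) j : Circle) : ℂ) ^ l)) t := by
  unfold pT
  have := HasDerivAt.fun_sum (u := Finset.univ) fun a _ => hd_zpow j t g a l
  refine this.congr_deriv ?_
  rw [Finset.sum_eq_single j]
  · simp [EE]
  · intro b _ hb; simp [EE, hb]
  · simp

theorem hd_fac {n : ℕ} (j : Fin n) (t : ℝ) (g : Fin n → Circle) (a b : Fin n) :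
    HasDerivAt (fun s => 1 - (((gT j s * g) a : Circle) : ℂ) / (((gT j s * g) b : Circle) : ℂ))
      (Complex.I * ((EE j b - EE j a) * ((((gT j t * g) a : Circle) : ℂ) / (((gT j t * g) b : Circle) : ℂ)))) t := by
  have h1 := hd_zpow j t g a 1
  have h2 := hd_zpow j t g b (-1)
  have := (h1.mul h2).const_sub 1
  simp only [zpow_one, zpow_neg_one, ← div_eq_mul_inv, Int.cast_one, Int.cast_neg, mul_one] at this
  refine (this.congr_deriv ?_)
  ring

/-- derivative of `W` over `i` -/
noncomputable def dW {n : ℕ} (j : Fin n) (z : Fin n → Circle) : ℂ :=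
  ∑ p ∈ (Finset.univ : Finset (Fin n)).offDiag,
    (∏ q ∈ (Finset.univ : Finset (Fin n)).offDiag.erase p, (1 - (z q.1 : ℂ) / (z q.2 : ℂ))) *
      ((EE j p.2 - EE j p.1) * ((z p.1 : ℂ) / (z p.2 : ℂ)))

theorem hd_W {n : ℕ} (j : Fin n) (t : ℝ) (g : Fin n → Circle) :
    HasDerivAt (fun s => W (gT j s * g)) (Complex.I * dW j (gT j t * g)) t := by
  unfold W dW
  have := HasDerivAt.fun_finsetProd (u := (Finset.univ : Finset (Fin n)).offDiag)
    fun p _ => hd_fac j t g p.1 p.2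
  refine this.congr_deriv ?_
  rw [Finset.mul_sum]
  refine Finset.sum_congr rfl fun p _ => ?_
  rw [smul_eq_mul]
  ring

theorem cont_coe {n : ℕ} (a : Fin n) : Continuous fun z : Fin n → Circle => (z a : ℂ) := by fun_prop

theorem cont_div {n : ℕ} (a b : Fin n) :
    Continuous fun z : Fin n → Circle => (z a : ℂ) / (z b : ℂ) :=
  (cont_coe a).div (cont_coe b) fun _ => Circle.coe_ne_zero _

theorem cont_zpow {n : ℕ} (a : Fin n) (l : ℤ) : Continuous fun z : Fin n → Circle => (z a : ℂ) ^ l :=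
  (cont_coe a).zpow₀ l fun _ => Or.inl (Circle.coe_ne_zero _)

theorem continuous_W {n : ℕ} : Continuous (W (n := n)) := by
  unfold W
  exact continuous_finsetProd _ fun p _ => continuous_const.sub (cont_div _ _)

theorem continuous_dW {n : ℕ} (j : Fin n) : Continuous (dW j) := by
  unfold dW
  exact continuous_finsetSum _ fun p _ => (continuous_finsetProd _ fun p _ =>
    continuous_const.sub (cont_div _ _)).mul (continuous_const.mul (cont_div _ _))

/-- torus Schwinger--Dyson integrand -/
noncomputable def sdT {n : ℕ} (m : ℤ) (F : R) (j : Fin n) (z : Fin n → Circle) : ℂ :=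
  (m * (z j : ℂ) ^ m * MvPolynomial.eval (pT z) F +
    (z j : ℂ) ^ m * dF (pT z) (fun l => l * (z j : ℂ) ^ l) F) * W z +
    (z j : ℂ) ^ m * MvPolynomial.eval (pT z) F * dW j z

theorem continuous_sdT {n : ℕ} (m : ℤ) (F : R) (j : Fin n) : Continuous (sdT m F j) := by
  unfold sdT
  have h1 := continuous_aeval _ (continuous_pT (n := n)) F
  have h2 := cont_zpow j m
  have h3 : Continuous fun z : Fin n → Circle => dF (pT z) (fun l => l * (z j : ℂ) ^ l) F :=
    continuous_dF _ _ continuous_pT (fun l => continuous_const.mul (cont_zpow j l)) F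
  exact ((((continuous_const.mul h2).mul h1).add (h2.mul h3)).mul continuous_W).add
    ((h2.mul h1).mul (continuous_dW j))

theorem dF_smul (c c' : ℤ → ℂ) (x : ℂ) (F : R) :
    dF c (fun l => x * c' l) F = x * dF c c' F := by
  have := dF_comb c c' c' x 0 F
  simpa using this

theorem sdT_int {n : ℕ} (m : ℤ) (F : R) (j : Fin n) : ∫ z, sdT m F j z ∂(mT (Fin n)) = 0 := by
  have h1 := continuous_aeval _ (continuous_pT (n := n)) F
  have := integral_deriv_eq_zero (mT (Fin n)) (gT j) (by simp [gT])
    (fun z => (z j : ℂ) ^ m * MvPolynomial.eval (pT z) F * W z)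
    (fun z => Complex.I * sdT m F j z) (((cont_zpow j m).mul h1).mul continuous_W)
    (continuous_const.mul (continuous_sdT m F j)) ?_
  · rw [integral_const_mul] at this
    simpa using this
  · intro g t
    have h := ((hd_zpow j t g j m).mul (hasDerivAt_aeval (fun l s => pT (gT j s * g) l) _ t
      (fun l => hd_pT j t g l) F)).mul (hd_W j t g)
    refine h.congr_deriv ?_
    rw [dF_smul]
    unfold sdT
    simp only [EE, if_true, Pi.mul_apply]
    ring

theorem osum_mul_left (m : ℤ) (φ : ℤ → ℂ) (A : ℂ) : A * osum m φ = osum m (fun j => A * φ j) :=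
  osum_map (AddMonoidHom.mulLeft A) m φ

theorem osum_geom (x y : ℂ) (hx : x ≠ 0) (hy : y ≠ 0) (m : ℤ) :
    (osum m (fun j => x ^ j * y ^ (m - j)) + (x ^ m - y ^ m)) * (1 - x / y) =
      (y ^ m - x ^ m) * (x / y) := by
  have h := osum_telescope m (fun j => x ^ j * y ^ (m - j))
  simp only [sub_self, zpow_zero, mul_one, one_mul, sub_zero] at h
  have h2 : osum m (fun j => x ^ j * y ^ (m - j)) * (1 - x / y) = - (x ^ m - y ^ m) := by
    rw [← h, mul_comm, osum_mul_left, ← neg_one_mul, osum_mul_left]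
    refine osum_congr _ fun j => ?_
    have : m - (j + 1) = m - j - 1 := by ring
    rw [this, zpow_add_one₀ hx, zpow_sub_one₀ hy]
    field_simp
    ring
  rw [add_mul, h2]; ring

theorem sum_dW {n : ℕ} (m : ℤ) (z : Fin n → Circle) :
    ∑ j, (z j : ℂ) ^ m * dW j z = (osum m (fun j => pT z j * pT z (m - j)) - m * pT z m) * W z := by
  have h1 : ∑ j, (z j : ℂ) ^ m * dW j z = ∑ p ∈ (Finset.univ : Finset (Fin n)).offDiag,
      (osum m (fun j => (z p.1 : ℂ) ^ j * (z p.2 : ℂ) ^ (m - j)) +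
        ((z p.1 : ℂ) ^ m - (z p.2 : ℂ) ^ m)) * W z := by
    simp only [dW, Finset.mul_sum]
    rw [Finset.sum_comm]
    refine Finset.sum_congr rfl fun p hp => ?_
    have hW : W z = (1 - (z p.1 : ℂ) / (z p.2 : ℂ)) *
      ∏ q ∈ (Finset.univ : Finset (Fin n)).offDiag.erase p, (1 - (z q.1 : ℂ) / (z q.2 : ℂ)) :=
      (Finset.mul_prod_erase _ _ hp).symm
    rw [hW, ← mul_assoc, osum_geom _ _ (Circle.coe_ne_zero _) (Circle.coe_ne_zero _)]
    have : ∑ j, (z j : ℂ) ^ m * (EE j p.2 - EE j p.1) = (z p.2 : ℂ) ^ m - (z p.1 : ℂ) ^ m := by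
      simp [EE, mul_sub, Finset.sum_sub_distrib]
    rw [← this, Finset.sum_mul, Finset.sum_mul]
    refine Finset.sum_congr rfl fun j _ => ?_
    ring
  rw [h1, ← Finset.sum_mul]
  congr 1
  have h3 : ∀ f : Fin n × Fin n → ℂ, ∑ p ∈ (Finset.univ : Finset (Fin n)).offDiag, f p =
      ∑ a, ∑ b, f (a, b) - ∑ a, f (a, a) := by
    intro f
    rw [eq_sub_iff_add_eq, ← Finset.sum_product', ← Finset.sum_diag, add_comm,
      ← Finset.sum_union (Finset.disjoint_diag_offDiag _), Finset.diag_union_offDiag]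
  rw [h3]
  simp only [Finset.sum_add_distrib, Finset.sum_sub_distrib, sub_self, add_zero]
  congr 1
  · have : ∑ a : Fin n, ∑ b : Fin n, (z a : ℂ) ^ m - ∑ a : Fin n, ∑ b : Fin n, (z b : ℂ) ^ m = 0 := by
      rw [Finset.sum_comm, sub_self]
    rw [this, add_zero]
    simp only [osum_finset_sum]
    refine osum_congr _ fun j => ?_
    rw [pT, pT, Finset.sum_mul_sum]
  · rw [pT, Finset.mul_sum]
    refine Finset.sum_congr rfl fun a _ => ?_
    rw [← osum_const]
    refine osum_congr _ fun j => ?_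
    rw [← zpow_add₀ (Circle.coe_ne_zero _)]; simp

theorem sdT_sum {n : ℕ} (m : ℤ) (F : R) (z : Fin n → Circle) :
    ∑ j, sdT m F j z = MvPolynomial.eval (pT z) (Sm m * F + Dm m F) * W z := by
  have h1 : ∑ j, sdT m F j z = m * pT z m * MvPolynomial.eval (pT z) F * W z +
      MvPolynomial.eval (pT z) (Dm m F) * W z +
      (∑ j, (z j : ℂ) ^ m * dW j z) * MvPolynomial.eval (pT z) F := by
    have hl := dF_lin (Finset.univ : Finset (Fin n)) (pT z) (fun j => (z j : ℂ) ^ m)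
      (fun j l => l * (z j : ℂ) ^ l) F
    rw [← dF_Dm]
    have e : (fun l : ℤ => (l : ℂ) * pT z (m + l)) = fun l : ℤ =>
        ∑ j : Fin n, (z j : ℂ) ^ m * (l * (z j : ℂ) ^ l) := by
      funext l
      rw [pT, Finset.mul_sum]
      refine Finset.sum_congr rfl fun j _ => ?_
      rw [zpow_add₀ (Circle.coe_ne_zero _)]; ring
    rw [e, ← hl, pT, Finset.mul_sum]
    simp only [Finset.sum_mul, ← Finset.sum_add_distrib]
    refine Finset.sum_congr rfl fun j _ => ?_
    rw [sdT]; ring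
  have := osum_map (MvPolynomial.eval (pT z) : R →+* ℂ).toAddMonoidHom m
    (fun j => MvPolynomial.X j * MvPolynomial.X (m - j))
  simp only [RingHom.toAddMonoidHom_eq_coe, AddMonoidHom.coe_coe, map_mul, MvPolynomial.eval_X] at this
  rw [h1, sum_dW, map_add, map_mul, Sm, this]
  ring

/-- Schwinger--Dyson equation for the circular ensemble on the torus. -/
theorem sd_T {n : ℕ} (m : ℤ) (F : R) :
    ∫ z, MvPolynomial.eval (pT z) (Sm m * F + Dm m F) * W z ∂(mT (Fin n)) = 0 := by
  simp only [← sdT_sum]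
  rw [integral_finsetSum]
  · exact Finset.sum_eq_zero fun a _ => sdT_int m F a
  · exact fun a _ => integrable_cont _ _ (continuous_sdT m F a)

end CUE



namespace CUE

theorem det_aeval {n : ℕ} (M : Matrix (Fin n) (Fin n) ℂ) (p : Polynomial ℂ) (hp : p.Monic) :
    (Polynomial.aeval M p).det = (M.charpoly.roots.map fun l => p.eval l).prod := by
  have hs := (IsAlgClosed.splits p).eq_prod_roots
  rw [hp.leadingCoeff, Polynomial.C_1, one_mul] at hs
  have h1 : ∀ a : ℂ, (M - algebraMap ℂ _ a).det = (M.charpoly.roots.map fun l => l - a).prod := by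
    intro a
    have h2 : M.charpoly.eval a = (M.charpoly.roots.map fun l => a - l).prod := by
      conv_lhs => rw [(IsAlgClosed.splits M.charpoly).eq_prod_roots, M.charpoly_monic.leadingCoeff]
      rw [Polynomial.C_1, one_mul, Polynomial.eval_multiset_prod, Multiset.map_map]
      simp
    rw [Matrix.eval_charpoly] at h2
    have hc : Multiset.card M.charpoly.roots = n := by
      rw [Polynomial.splits_iff_card_roots.1 (IsAlgClosed.splits M.charpoly)]; simp
    have h3 : M - algebraMap ℂ _ a = (-1 : ℂ) • (Matrix.scalar (Fin n) a - M) := by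
      simp [Matrix.algebraMap_eq_diagonal, Matrix.scalar, Pi.algebraMap_def]
    rw [h3, Matrix.det_smul, h2]
    have h4 : (fun l => l - a) = fun l : ℂ => (-1) * (a - l) := by funext l; ring
    rw [h4, Multiset.prod_map_mul]
    simp [hc]
  have h5 : ∀ s : Multiset ℂ, (Polynomial.aeval M (Multiset.map (fun x => Polynomial.X - Polynomial.C x) s).prod).det =
      (M.charpoly.roots.map fun l => (Multiset.map (fun x => Polynomial.X - Polynomial.C x) s).prod.eval l).prod := by
    intro s
    induction s using Multiset.induction_on with
    | empty => simp
    | cons a s ih =>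
      rw [Multiset.map_cons, Multiset.prod_cons, map_mul, Matrix.det_mul, ih]
      simp only [Polynomial.eval_mul, Multiset.prod_map_mul]
      congr 1
      simp [← h1]
  rw [hs]
  exact h5 _

theorem trace_pow_roots {n : ℕ} (M : Matrix (Fin n) (Fin n) ℂ) (k : ℕ) :
    (M ^ k).trace = (M.charpoly.roots.map fun l => l ^ k).sum := by
  rcases Nat.eq_zero_or_pos k with rfl | hk
  · have hc : Multiset.card M.charpoly.roots = n := by
      rw [Polynomial.splits_iff_card_roots.1 (IsAlgClosed.splits M.charpoly)]; simp
    simp [hc]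
  have h : (M ^ k).charpoly = (M.charpoly.roots.map fun l => Polynomial.X - Polynomial.C (l ^ k)).prod := by
    refine Polynomial.funext fun t => ?_
    rw [Matrix.eval_charpoly, Polynomial.eval_multiset_prod, Multiset.map_map]
    have h1 := det_aeval M (Polynomial.X ^ k - Polynomial.C t) (Polynomial.monic_X_pow_sub_C t hk.ne')
    have hc : Multiset.card M.charpoly.roots = n := by
      rw [Polynomial.splits_iff_card_roots.1 (IsAlgClosed.splits M.charpoly)]; simp
    have h3 : Matrix.scalar (Fin n) t - M ^ k = (-1 : ℂ) • (Polynomial.aeval M (Polynomial.X ^ k - Polynomial.C t)) := by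
      simp [Matrix.algebraMap_eq_diagonal, Matrix.scalar, Pi.algebraMap_def]
    rw [h3, Matrix.det_smul, h1]
    have h4 : ((Polynomial.eval t) ∘ fun l => Polynomial.X - Polynomial.C (l ^ k)) = fun l : ℂ => (-1) * (l ^ k - t) := by
      funext l; simp
    rw [h4, Multiset.prod_map_mul]
    simp [hc]
  have h6 := Polynomial.roots_multiset_prod_X_sub_C (M.charpoly.roots.map fun l => l ^ k)
  rw [Multiset.map_map] at h6
  rw [Matrix.trace_eq_sum_roots_charpoly, h]
  exact congrArg Multiset.sum h6

theorem pU_eq_pT {n : ℕ} (U : Matrix.unitaryGroup (Fin n) ℂ) (z : Fin n → Circle)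
    (h : (Matrix.charpoly (U : Matrix (Fin n) (Fin n) ℂ)).roots =
      Multiset.map (fun j => (z j : ℂ)) (Finset.univ : Finset (Fin n)).val) : pU U = pT z := by
  have h1 : ∀ k : ℕ, pU U k = pT z k := by
    intro k
    rw [pU, pT, zpow_natCast]
    have := trace_pow_roots (U : Matrix (Fin n) (Fin n) ℂ) k
    rw [h, Multiset.map_map] at this
    simpa [Finset.sum] using this
  funext l
  obtain ⟨k, rfl | rfl⟩ := l.eq_nat_or_neg
  · exact h1 k
  · have h2 := congrArg star (h1 k)
    rw [pU, pT] at h2 ⊢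
    have e : ((U ^ (-(k : ℤ)) : Matrix.unitaryGroup (Fin n) ℂ) : Matrix (Fin n) (Fin n) ℂ) =
      star ((U ^ (k : ℤ) : Matrix.unitaryGroup (Fin n) ℂ) : Matrix (Fin n) (Fin n) ℂ) := by
      rw [zpow_neg]; rfl
    rw [e, Matrix.star_eq_conjTranspose, Matrix.trace_conjTranspose, h2, star_sum]
    refine Finset.sum_congr rfl fun j _ => ?_
    rw [zpow_neg, zpow_natCast, star_pow, ← inv_pow, ← Circle.coe_inv, Circle.coe_inv_eq_conj]
    rfl

/-- every point of the torus is the spectrum of a unitary matrix -/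
theorem exists_pU {n : ℕ} (z : Fin n → Circle) : ∃ U : Matrix.unitaryGroup (Fin n) ℂ, pU U = pT z := by
  have hm : Matrix.diagonal (fun j => (z j : ℂ)) ∈ Matrix.unitaryGroup (Fin n) ℂ := by
    rw [Matrix.mem_unitaryGroup_iff, Matrix.star_eq_conjTranspose, Matrix.diagonal_conjTranspose,
      Matrix.diagonal_mul_diagonal, ← Matrix.diagonal_one]
    congr 1
    funext j
    have := Circle.normSq_coe (z j)
    simp only [Pi.star_apply]
    rw [RCLike.star_def, Complex.mul_conj, this]; simp
  refine ⟨⟨_, hm⟩, pU_eq_pT _ z ?_⟩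
  rw [Matrix.charpoly_diagonal]
  rw [show (∏ i, (Polynomial.X - Polynomial.C (z i : ℂ))) = (Multiset.map (fun x => Polynomial.X - Polynomial.C x) 
    (Multiset.map (fun j => (z j : ℂ)) (Finset.univ : Finset (Fin n)).val)).prod by
      rw [Multiset.map_map]; rfl]
  rw [Polynomial.roots_multiset_prod_X_sub_C]

end CUE



namespace CUE

/-- weight of an exponent -/
def wt (s : ℤ →₀ ℕ) : ℕ := s.sum fun i k => k * i.natAbs

theorem wt_add (s t : ℤ →₀ ℕ) : wt (s + t) = wt s + wt t := by
  unfold wt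
  rw [Finsupp.sum_add_index'] <;> intros <;> ring

theorem wt_single (i : ℤ) (k : ℕ) : wt (Finsupp.single i k) = k * i.natAbs := by
  unfold wt
  rw [Finsupp.sum_single_index]; ring

theorem wt_sub (s : ℤ →₀ ℕ) (i : ℤ) (h : s i ≠ 0) : wt s = wt (s - Finsupp.single i 1) + i.natAbs := by
  have : s - Finsupp.single i 1 + Finsupp.single i 1 = s := by
    ext j
    by_cases hj : i = j
    · subst hj; simp; omega
    · simp [Finsupp.single_apply, hj]
  conv_lhs => rw [← this]
  rw [wt_add, wt_single, one_mul]

theorem le_wt (s : ℤ →₀ ℕ) (i : ℤ) : s i * i.natAbs ≤ wt s := by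
  by_cases h : s i = 0
  · simp [h]
  · exact Finset.single_le_sum (f := fun i => s i * i.natAbs) (fun _ _ => Nat.zero_le _)
      (Finsupp.mem_support_iff.2 h)

/-- polynomials of weight at most `d` -/
noncomputable def P (d : ℕ) : Submodule ℂ R :=
  Submodule.span ℂ {F | ∃ s : ℤ →₀ ℕ, wt s ≤ d ∧ F = MvPolynomial.monomial s 1}

theorem monomial_mem (s : ℤ →₀ ℕ) (a : ℂ) (d : ℕ) (h : wt s ≤ d) : MvPolynomial.monomial s a ∈ P d := by
  have : (MvPolynomial.monomial s a : R) = a • MvPolynomial.monomial s 1 := by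
    rw [MvPolynomial.smul_monomial, smul_eq_mul, mul_one]
  rw [this]
  exact Submodule.smul_mem _ _ (Submodule.subset_span ⟨s, h, rfl⟩)

theorem P_mono {d e : ℕ} (h : d ≤ e) : P d ≤ P e :=
  Submodule.span_mono fun _ ⟨s, hs, hF⟩ => ⟨s, hs.trans h, hF⟩

theorem P_ind {d : ℕ} (S : Submodule ℂ R) (L : R →ₗ[ℂ] R) (h : ∀ s, wt s ≤ d → L (MvPolynomial.monomial s 1) ∈ S)
    {F : R} (hF : F ∈ P d) : L F ∈ S := by
  have : P d ≤ S.comap L := by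
    refine Submodule.span_le.2 ?_
    rintro _ ⟨s, hs, rfl⟩
    exact h s hs
  exact this hF

theorem X_mem (i : ℤ) : (MvPolynomial.X i : R) ∈ P i.natAbs :=
  monomial_mem _ _ _ (by rw [wt_single, one_mul])

theorem mul_memP {d e : ℕ} {F G : R} (hF : F ∈ P d) (hG : G ∈ P e) : F * G ∈ P (d + e) := by
  refine P_ind (P (d + e)) (LinearMap.mulRight ℂ G) (fun s hs => ?_) hF
  rw [LinearMap.mulRight_apply]
  refine P_ind (P (d + e)) (LinearMap.mulLeft ℂ (MvPolynomial.monomial s 1)) (fun t ht => ?_) hG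
  rw [LinearMap.mulLeft_apply, MvPolynomial.monomial_mul]
  exact monomial_mem _ _ _ (by rw [wt_add]; omega)

theorem Dm_mem (m : ℤ) {d : ℕ} {F : R} (hF : F ∈ P d) : Dm m F ∈ P (d + m.natAbs) := by
  refine P_ind (P (d + m.natAbs)) (Dm m).toLinearMap (fun s hs => ?_) hF
  change Dm m _ ∈ _
  rw [Dm, MvPolynomial.mkDerivation_monomial]
  refine Submodule.smul_mem _ _ (Submodule.sum_mem _ fun i hi => ?_)
  beta_reduce
  rw [smul_eq_mul]
  have h1 := wt_sub s i (Finsupp.mem_support_iff.1 hi)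
  refine P_mono ?_ (mul_memP (monomial_mem _ _ _ le_rfl) (Submodule.smul_mem _ _ (X_mem (m + i))))
  have := Int.natAbs_add_le m i
  omega

theorem Sm_mem (m : ℤ) : Sm m ∈ P m.natAbs := by
  unfold Sm osum
  refine Submodule.sub_mem _ (Submodule.sum_mem _ fun j hj => ?_) (Submodule.sum_mem _ fun j hj => ?_)
  all_goals
    refine P_mono ?_ (mul_memP (X_mem _) (X_mem _))
    simp at hj
    omega

theorem pderiv_mul_mem (l : ℤ) {d : ℕ} {F H : R} (hF : F ∈ P d) (hH : H ∈ P l.natAbs) :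
    MvPolynomial.pderiv l F * H ∈ P d := by
  refine P_ind (P d) ((LinearMap.mulRight ℂ H).comp (MvPolynomial.pderiv l).toLinearMap) (fun s hs => ?_) hF
  change MvPolynomial.pderiv l _ * H ∈ _
  rw [MvPolynomial.pderiv_monomial]
  by_cases h : s l = 0
  · simp [h]
  · have h1 := wt_sub s l h
    exact P_mono (by omega) (mul_memP (monomial_mem _ _ _ le_rfl) hH)

theorem Dm_pderiv_mem (l : ℤ) {d : ℕ} {F : R} (hF : F ∈ P d) :
    Dm l (MvPolynomial.pderiv l F) ∈ P d := by
  refine P_ind (P d) ((Dm l).toLinearMap.comp (MvPolynomial.pderiv l).toLinearMap) (fun s hs => ?_) hF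
  change Dm l (MvPolynomial.pderiv l _) ∈ _
  rw [MvPolynomial.pderiv_monomial]
  by_cases h : s l = 0
  · simp [h]
  · have h1 := wt_sub s l h
    exact P_mono (by omega) (Dm_mem l (monomial_mem _ _ _ le_rfl))

theorem exists_memP (F : R) : ∃ d, F ∈ P d := by
  induction F using MvPolynomial.induction_on with
  | C a => exact ⟨0, monomial_mem _ _ _ (by simp [wt])⟩
  | add p q hp hq =>
    obtain ⟨d, hd⟩ := hp
    obtain ⟨e, he⟩ := hq
    exact ⟨max d e, Submodule.add_mem _ (P_mono (le_max_left _ _) hd) (P_mono (le_max_right _ _) he)⟩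
  | mul_X p i hp =>
    obtain ⟨d, hd⟩ := hp
    exact ⟨_, mul_memP hd (X_mem i)⟩

/-- conjugation -/
noncomputable def cj : R →+* R :=
  MvPolynomial.eval₂Hom (MvPolynomial.C.comp (starRingEnd ℂ)) (fun i => MvPolynomial.X (-i))

@[simp] theorem cj_C (a : ℂ) : cj (MvPolynomial.C a) = MvPolynomial.C (starRingEnd ℂ a) := by simp [cj]
@[simp] theorem cj_X (i : ℤ) : cj (MvPolynomial.X i) = MvPolynomial.X (-i) := by simp [cj]

theorem cj_mono (s : ℤ →₀ ℕ) : cj (MvPolynomial.monomial s 1) ∈ P (wt s) := by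
  induction s using Finsupp.induction_linear with
  | zero => 
    change cj 1 ∈ _
    rw [map_one]; exact monomial_mem 0 1 _ (by simp [wt])
  | add f g hf hg =>
    rw [← one_mul (1 : ℂ), ← MvPolynomial.monomial_mul, map_mul, wt_add]
    exact mul_memP hf hg
  | single i k =>
    rw [← MvPolynomial.X_pow_eq_monomial, map_pow, cj_X, MvPolynomial.X_pow_eq_monomial]
    exact monomial_mem _ _ _ (by simp [wt_single])

theorem cj_mem {d : ℕ} {F : R} (hF : F ∈ P d) : cj F ∈ P d := by
  unfold P at hF
  induction hF using Submodule.span_induction with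
  | mem x h =>
    obtain ⟨s, hs, rfl⟩ := h
    exact P_mono hs (cj_mono s)
  | zero => simp
  | add x y _ _ hx hy => rw [map_add]; exact Submodule.add_mem _ hx hy
  | smul a x _ hx =>
    rw [MvPolynomial.smul_eq_C_mul, map_mul, cj_C, ← MvPolynomial.smul_eq_C_mul]
    exact Submodule.smul_mem _ _ hx

theorem conj_zpow (u : Circle) (l : ℤ) : starRingEnd ℂ ((u : ℂ) ^ l) = (u : ℂ) ^ (-l) := by
  rw [map_zpow₀, zpow_neg, ← inv_zpow, ← Circle.coe_inv, Circle.coe_inv_eq_conj]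

theorem conj_pT {n : ℕ} (z : Fin n → Circle) (l : ℤ) : starRingEnd ℂ (pT z l) = pT z (-l) := by
  simp only [pT, map_sum, conj_zpow]

theorem eval_cj {n : ℕ} (z : Fin n → Circle) (F : R) :
    MvPolynomial.eval (pT z) (cj F) = starRingEnd ℂ (MvPolynomial.eval (pT z) F) := by
  induction F using MvPolynomial.induction_on with
  | C a => simp
  | add p q hp hq => simp only [map_add, hp, hq]
  | mul_X p i hp => simp only [map_mul, hp, cj_X, MvPolynomial.eval_X, conj_pT]

/-- `D_j` -/
noncomputable def dj {n : ℕ} (z : Fin n → Circle) (j : Fin n) (F : R) : ℂ :=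
  dF (pT z) (fun l => l * (z j : ℂ) ^ l) F

theorem dj_cj {n : ℕ} (z : Fin n → Circle) (j : Fin n) (F : R) :
    dj z j (cj F) = - starRingEnd ℂ (dj z j F) := by
  unfold dj
  induction F using MvPolynomial.induction_on with
  | C a => simp
  | add p q hp hq => simp only [map_add, dF_add, hp, hq]; ring
  | mul_X p i hp =>
    simp only [map_mul, dF_mul, hp, cj_X, MvPolynomial.eval_X, eval_cj, dF_X, map_add, conj_pT, conj_zpow]
    simp
    ring

theorem eval_Dm {n : ℕ} (z : Fin n → Circle) (m : ℤ) (F : R) :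
    MvPolynomial.eval (pT z) (Dm m F) = ∑ j, (z j : ℂ) ^ m * dj z j F := by
  have hl := dF_lin (Finset.univ : Finset (Fin n)) (pT z) (fun j => (z j : ℂ) ^ m)
      (fun j l => l * (z j : ℂ) ^ l) F
  unfold dj
  rw [hl, ← dF_Dm]
  congr 1
  funext l
  rw [pT, Finset.mul_sum]
  refine Finset.sum_congr rfl fun j _ => ?_
  rw [zpow_add₀ (Circle.coe_ne_zero _)]; ring

theorem dF_pderiv (F : R) : ∃ L : Finset ℤ, ∀ c c' : ℤ → ℂ, ∀ L', L ⊆ L' →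
    dF c c' F = ∑ l ∈ L', c' l * MvPolynomial.eval c (MvPolynomial.pderiv l F) := by
  induction F using MvPolynomial.induction_on with
  | C a => exact ⟨∅, by simp⟩
  | add p q hp hq =>
    obtain ⟨L1, h1⟩ := hp
    obtain ⟨L2, h2⟩ := hq
    refine ⟨L1 ∪ L2, fun c c' L' hL => ?_⟩
    rw [dF_add, h1 c c' L' (Finset.union_subset_left hL), h2 c c' L' (Finset.union_subset_right hL),
      ← Finset.sum_add_distrib]
    simp [mul_add]
  | mul_X p i hp =>
    obtain ⟨L1, h1⟩ := hp
    refine ⟨insert i L1, fun c c' L' hL => ?_⟩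
    rw [dF_mul, h1 c c' L' ((Finset.subset_insert _ _).trans hL), dF_X]
    simp only [Derivation.leibniz, smul_eq_mul, map_add, map_mul, mul_add, Finset.sum_add_distrib,
      MvPolynomial.eval_X, MvPolynomial.pderiv_X]
    congr 1
    · rw [Finset.sum_eq_single i]
      · simp; ring
      · intro b _ hb; simp [Pi.single_apply, hb.symm]
      · intro h; exact absurd (hL (Finset.mem_insert_self _ _)) h
    · rw [Finset.mul_sum]; exact Finset.sum_congr rfl fun l _ => by ring

/-- second order operator -/
noncomputable def LL (L : Finset ℤ) (F : R) : R :=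
  ∑ l ∈ L, (l : ℂ) • (Sm l * MvPolynomial.pderiv l F + Dm l (MvPolynomial.pderiv l F))

theorem LL_mem (L : Finset ℤ) {d : ℕ} {F : R} (hF : F ∈ P d) : LL L F ∈ P d := by
  refine Submodule.sum_mem _ fun l _ => Submodule.smul_mem _ _ (Submodule.add_mem _ ?_ (Dm_pderiv_mem l hF))
  rw [mul_comm]
  exact pderiv_mul_mem l hF (Sm_mem l)

/-- carre du champ -/
noncomputable def GG (L : Finset ℤ) (F G : R) : R :=
  ∑ l ∈ L, (l : ℂ) • (MvPolynomial.pderiv l F * Dm l G)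

theorem LL_ibp (ℓ : R →ₗ[ℂ] ℂ) (hℓ : ∀ m F, ℓ (Sm m * F + Dm m F) = 0) (L : Finset ℤ) (F G : R) :
    ℓ (G * LL L F) = - ℓ (GG L F G) := by
  unfold LL GG
  rw [Finset.mul_sum, map_sum, map_sum, ← Finset.sum_neg_distrib]
  refine Finset.sum_congr rfl fun l _ => ?_
  rw [mul_smul_comm, map_smul, map_smul, ← smul_neg]
  congr 1
  have := hℓ l (G * MvPolynomial.pderiv l F)
  rw [Derivation.leibniz, smul_eq_mul, smul_eq_mul, ← add_assoc, map_add] at this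
  rw [← eq_neg_iff_add_eq_zero.2 this]
  congr 1
  ring

theorem LL_zero (ℓ : R →ₗ[ℂ] ℂ) (hℓ : ∀ m F, ℓ (Sm m * F + Dm m F) = 0) (L : Finset ℤ) (F : R) :
    ℓ (LL L F) = 0 := by
  unfold LL
  rw [map_sum]
  exact Finset.sum_eq_zero fun l _ => by rw [map_smul, hℓ, smul_zero]

theorem eval_GG {n : ℕ} (L : Finset ℤ) (F G : R) (z : Fin n → Circle)
    (hL : ∀ c c' : ℤ → ℂ, dF c c' F = ∑ l ∈ L, c' l * MvPolynomial.eval c (MvPolynomial.pderiv l F)) :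
    MvPolynomial.eval (pT z) (GG L F G) = ∑ j, dj z j F * dj z j G := by
  unfold GG
  rw [map_sum]
  simp only [MvPolynomial.smul_eval, map_mul, eval_Dm]
  simp only [Finset.mul_sum]
  rw [Finset.sum_comm]
  refine Finset.sum_congr rfl fun j _ => ?_
  conv_rhs => rw [dj, hL, Finset.sum_mul]
  exact Finset.sum_congr rfl fun l _ => by ring

theorem const_of_dj {n : ℕ} (F : R) (h : ∀ (z : Fin n → Circle) j, dj z j F = 0) (z : Fin n → Circle) :
    MvPolynomial.eval (pT z) F = MvPolynomial.eval (pT (1 : Fin n → Circle)) F := by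
  let p : ℝ → Fin n → Circle := fun s j => Circle.exp (s * Complex.arg (z j))
  have hp1 : p 1 = z := by
    funext j; simp [p, Circle.exp_arg]
  have hp0 : p 0 = 1 := by funext j; simp [p]
  have hz : ∀ (t : ℝ) (l : ℤ) (j : Fin n), HasDerivAt (fun s => ((p s j : Circle) : ℂ) ^ l)
      ((Complex.I * Complex.arg (z j)) * (l * (p t j : ℂ) ^ l)) t := by
    intro t l j
    have e : ∀ s, ((p s j : Circle) : ℂ) ^ l = Complex.exp ((s : ℂ) * (Complex.arg (z j) * l * Complex.I)) := by
      intro s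
      simp only [p, Circle.coe_exp, ← Complex.exp_int_mul]
      congr 1; push_cast; ring
    simp only [e]
    have h1 : HasDerivAt (fun s : ℝ => (s : ℂ) * (Complex.arg (z j) * l * Complex.I)) (Complex.arg (z j) * l * Complex.I) t := by
      simpa using (Complex.ofRealCLM.hasDerivAt (x := t)).mul_const (Complex.arg (z j) * l * Complex.I)
    refine h1.cexp.congr_deriv ?_
    ring
  have hd : ∀ t, HasDerivAt (fun s => MvPolynomial.eval (fun l => pT (p s) l) F) 0 t := by
    intro t
    refine (hasDerivAt_aeval (fun l s => pT (p s) l) _ t (fun l => HasDerivAt.fun_sum (u := Finset.univ) fun j _ => hz t l j) F).congr_deriv ?_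
    refine (dF_lin (Finset.univ : Finset (Fin n)) (pT (p t)) (fun j => Complex.I * Complex.arg (z j))
      (fun j l => l * (p t j : ℂ) ^ l) F).symm.trans ?_
    exact Finset.sum_eq_zero fun j _ => by
      have := h (p t) j
      rw [dj] at this
      rw [this, mul_zero]
  have := is_const_of_deriv_eq_zero (f := fun s => MvPolynomial.eval (fun l => pT (p s) l) F)
    (fun t => (hd t).differentiableAt) (fun t => (hd t).deriv) 1 0
  simp only [hp1, hp0] at this
  exact this

end CUE



namespace CUE

/-- evaluation on the torus -/
noncomputable def evT (n : ℕ) : R →ₗ[ℂ] ((Fin n → Circle) → ℂ) where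
  toFun F z := MvPolynomial.eval (pT z) F
  map_add' F G := by funext z; simp
  map_smul' a F := by funext z; simp [MvPolynomial.smul_eval]

theorem evT_apply (n : ℕ) (F : R) (z : Fin n → Circle) : evT n F z = MvPolynomial.eval (pT z) F := rfl

/-- expectation under Haar measure of a polynomial in power traces -/
noncomputable def ell1 {n : ℕ} (μ : Measure (Matrix.unitaryGroup (Fin n) ℂ)) [IsProbabilityMeasure μ] :
    R →ₗ[ℂ] ℂ where
  toFun F := ∫ V, MvPolynomial.eval (pU V) F ∂μ
  map_add' F G := by
    simp only [map_add]
    exact integral_add (integrable_cont μ _ (continuous_aeval _ continuous_pU F))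
      (integrable_cont μ _ (continuous_aeval _ continuous_pU G))
  map_smul' a F := by
    simp only [MvPolynomial.smul_eval, RingHom.id_apply, smul_eq_mul]
    exact integral_const_mul _ _

/-- expectation under the torus density -/
noncomputable def ell2 (n : ℕ) : R →ₗ[ℂ] ℂ where
  toFun F := ∫ z, MvPolynomial.eval (pT z) F * W z ∂(mT (Fin n))
  map_add' F G := by
    simp only [map_add, add_mul]
    exact integral_add (integrable_cont _ _ ((continuous_aeval _ continuous_pT F).mul continuous_W))
      (integrable_cont _ _ ((continuous_aeval _ continuous_pT G).mul continuous_W))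
  map_smul' a F := by
    simp only [MvPolynomial.smul_eval, RingHom.id_apply, smul_eq_mul, mul_assoc]
    exact integral_const_mul _ _

theorem finite_image (n d : ℕ) : FiniteDimensional ℂ ((P d).map (evT n)) := by
  have hfin : Set.Finite {s : ℤ →₀ ℕ | s 0 = 0 ∧ wt s ≤ d} := by
    refine (Set.finite_Iic (∑ i ∈ Finset.Icc (-(d : ℤ)) d, Finsupp.single i d)).subset ?_
    rintro s ⟨h0, hs⟩ i
    have h1 := le_wt s i
    by_cases hi : s i = 0
    · simp [hi]
    · have hi0 : i ≠ 0 := by rintro rfl; exact hi h0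
      have h2 : 1 ≤ i.natAbs := by omega
      have h3 : s i ≤ d := by nlinarith
      have h4 : i.natAbs ≤ d := by
        have : 1 ≤ s i := by omega
        nlinarith
      have h5 : i ∈ Finset.Icc (-(d : ℤ)) d := by simp; omega
      rw [Finsupp.finsetSum_apply, Finset.sum_eq_single i]
      · simpa using h3
      · intro b _ hb; simp [hb]
      · intro h; exact absurd h5 h
  have hfd := FiniteDimensional.span_of_finite ℂ (hfin.image fun s => evT n (MvPolynomial.monomial s 1))
  refine Submodule.finiteDimensional_of_le (S₂ := Submodule.span ℂ ((fun s => evT n (MvPolynomial.monomial s 1)) ''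
    {s : ℤ →₀ ℕ | s 0 = 0 ∧ wt s ≤ d})) ?_
  rw [P, Submodule.map_span, Submodule.span_le]
  rintro _ ⟨_, ⟨s, hs, rfl⟩, rfl⟩
  have hs' : s.erase 0 + Finsupp.single 0 (s 0) = s := by
    rw [add_comm]; exact Finsupp.single_add_erase 0 s
  have h6 : evT n (MvPolynomial.monomial s 1) = ((n : ℂ) ^ (s 0)) • evT n (MvPolynomial.monomial (s.erase 0) 1) := by
    conv_lhs => rw [← hs', ← one_mul (1 : ℂ), ← MvPolynomial.monomial_mul, ← MvPolynomial.X_pow_eq_monomial]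
    funext z
    rw [evT_apply, map_mul, map_pow, MvPolynomial.eval_X, Pi.smul_apply, evT_apply, smul_eq_mul, mul_comm]
    simp [pT]
  change evT n (MvPolynomial.monomial s 1) ∈ Submodule.span ℂ _
  rw [h6]
  refine Submodule.smul_mem _ _ (Submodule.subset_span ⟨s.erase 0, ⟨by simp, ?_⟩, rfl⟩)
  have := wt_add (s.erase 0) (Finsupp.single 0 (s 0))
  rw [hs'] at this
  omega

theorem pos_zero {n : ℕ} (μ : Measure (Matrix.unitaryGroup (Fin n) ℂ)) [IsProbabilityMeasure μ]
    [μ.IsHaarMeasure] (e : Matrix.unitaryGroup (Fin n) ℂ → Fin n → Circle) (he : ∀ U, pU U = pT (e U))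
    (H : R) (r : (Fin n → Circle) → ℝ) (hr0 : ∀ z, 0 ≤ r z) (hr : ∀ z, MvPolynomial.eval (pT z) H = r z)
    (h0 : ell1 μ H = 0) (z : Fin n → Circle) : r z = 0 := by
  have h1 : ∀ U, MvPolynomial.eval (pU U) H = r (e U) := fun U => by rw [he, hr]
  have hc : Continuous fun U => r (e U) := by
    have := Complex.continuous_re.comp (continuous_aeval _ (continuous_pU (n := n)) H)
    refine this.congr fun U => ?_
    simp [h1]
  have h2 : ∫ U, r (e U) ∂μ = 0 := by
    have : ell1 μ H = ∫ U, ((r (e U) : ℝ) : ℂ) ∂μ := integral_congr_ae (Eventually.of_forall h1)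
    rw [h0, integral_complex_ofReal] at this
    exact_mod_cast this.symm
  have hint : Integrable (fun U => r (e U)) μ := by
    have := (integrable_cont μ _ (continuous_aeval _ (continuous_pU (n := n)) H)).re
    refine this.congr (Eventually.of_forall fun U => ?_)
    simp [h1]
  rw [integral_eq_zero_iff_of_nonneg (fun U => hr0 _) hint] at h2
  have h3 := Continuous.ae_eq_iff_eq μ hc continuous_const |>.1 h2
  obtain ⟨U, hU⟩ := exists_pU z
  have h4 := congrFun h3 U
  have h5 : (r (e U) : ℂ) = r z := by rw [← hr, ← hr, ← he, hU]
  have h6 : r (e U) = r z := by exact_mod_cast h5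
  rw [← h6]; exact h4

/-- Uniqueness of solutions of the Schwinger--Dyson equations. -/
theorem ell_unique {n : ℕ} (μ : Measure (Matrix.unitaryGroup (Fin n) ℂ)) [IsProbabilityMeasure μ]
    [μ.IsHaarMeasure] (e : Matrix.unitaryGroup (Fin n) ℂ → Fin n → Circle) (he : ∀ U, pU U = pT (e U))
    (φ : R →ₗ[ℂ] ℂ) (hφ : ∀ m F, φ (Sm m * F + Dm m F) = 0) (hφ1 : φ 1 = 0)
    (hφk : ∀ F, evT n F = 0 → φ F = 0) (F : R) : φ F = 0 := by
  obtain ⟨d, hF⟩ := exists_memP F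
  let A := (P d).map (evT n)
  have : FiniteDimensional ℂ A := finite_image n d
  let q : P d →ₗ[ℂ] A := (evT n).submoduleMap (P d)
  have hq : Function.Surjective q := (evT n).submoduleMap_surjective (P d)
  obtain ⟨r, hr⟩ := q.exists_rightInverse_of_surjective (LinearMap.range_eq_top.2 hq)
  have hr' : ∀ a : A, evT n (r a : R) = a := fun a => by
    have := LinearMap.congr_fun hr a
    exact congrArg Subtype.val this
  have hk1 : ∀ F, evT n F = 0 → ell1 μ F = 0 := by
    intro F hF
    refine integral_eq_zero_of_ae (Eventually.of_forall fun U => ?_)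
    have := congrFun hF (e U)
    simp only [evT_apply] at this
    simp only [he, this]
    rfl
  let B : A →ₗ[ℂ] Module.Dual ℂ A := LinearMap.mk₂ ℂ (fun a b => ell1 μ ((r a : R) * (r b : R)))
    (by intros; simp [add_mul]) (by intros; simp) (by intros; simp [mul_add]) (by intros; simp)
  have hB : Function.Injective B := by
    rw [injective_iff_map_eq_zero]
    intro a ha
    have hc : evT n (cj (r a : R)) ∈ A := Submodule.mem_map_of_mem (cj_mem (r a).2)
    have h1 : ell1 μ ((r a : R) * (r ⟨_, hc⟩ : R)) = 0 := LinearMap.congr_fun ha ⟨_, hc⟩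
    have h2 := pos_zero μ e he _ (fun z => Complex.normSq (MvPolynomial.eval (pT z) (r a : R)))
      (fun z => Complex.normSq_nonneg _) (fun z => by
        rw [map_mul]
        have := congrFun (hr' ⟨_, hc⟩) z
        rw [evT_apply] at this
        rw [this]
        simp only [evT_apply, eval_cj]
        rw [Complex.mul_conj]) h1
    apply Subtype.ext
    rw [← hr' a]
    funext z
    exact Complex.normSq_eq_zero.1 (h2 z)
  have hBs : Function.Surjective B :=
    (LinearMap.injective_iff_surjective_of_finrank_eq_finrank (Subspace.dual_finrank_eq).symm).1 hB
  obtain ⟨a, ha⟩ := hBs (φ.comp ((P d).subtype.comp r))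
  -- `φ F = ell1 (G * F)` on `P d`
  have key : ∀ F ∈ P d, φ F = ell1 μ ((r a : R) * F) := by
    intro F hF
    have hm : evT n F ∈ A := Submodule.mem_map_of_mem hF
    have h1 := LinearMap.congr_fun ha ⟨_, hm⟩
    have h2 : φ F = φ (r ⟨_, hm⟩ : R) := by
      rw [← sub_eq_zero, ← map_sub]
      refine hφk _ ?_
      rw [map_sub, hr', sub_self]
    have h3 : ell1 μ ((r a : R) * F) = ell1 μ ((r a : R) * (r ⟨_, hm⟩ : R)) := by
      rw [← sub_eq_zero, ← map_sub]
      refine hk1 _ ?_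
      rw [← mul_sub]
      funext z
      have := congrFun (hr' ⟨_, hm⟩) z
      rw [evT_apply] at this
      rw [evT_apply, map_mul, map_sub, this]
      change _ * (_ - MvPolynomial.eval (pT z) F) = 0
      rw [sub_self, mul_zero]
    rw [h2, h3]
    exact h1.symm
  set G : R := (r a : R) with hG
  have hGm : G ∈ P d := (r a).2
  obtain ⟨L, hL⟩ := dF_pderiv (cj G)
  have hsd : ∀ m F, ell1 μ (Sm m * F + Dm m F) = 0 := fun m F => sd_U μ m F
  have h1 : ell1 μ (GG L (cj G) G) = 0 := by
    have := LL_ibp (ell1 μ) hsd L (cj G) G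
    rw [← key _ (LL_mem L (cj_mem hGm)), LL_zero φ hφ] at this
    exact neg_eq_zero.1 this.symm
  have h2 := pos_zero μ e he (- GG L (cj G) G) (fun z => ∑ j, Complex.normSq (dj z j G))
    (fun z => Finset.sum_nonneg fun j _ => Complex.normSq_nonneg _) (fun z => by
      rw [map_neg, eval_GG L _ _ z fun c c' => hL c c' L subset_rfl, ← Finset.sum_neg_distrib]
      push_cast
      refine Finset.sum_congr rfl fun j _ => ?_
      rw [dj_cj, ← Complex.mul_conj]; ring) (by rw [map_neg, h1, neg_zero])
  have h3 : ∀ (z : Fin n → Circle) j, dj z j G = 0 := fun z j => by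
    have := (Finset.sum_eq_zero_iff_of_nonneg fun j _ => Complex.normSq_nonneg (dj z j G)).1 (h2 z) j
      (Finset.mem_univ _)
    exact Complex.normSq_eq_zero.1 this
  have h4 := const_of_dj G h3
  set c := MvPolynomial.eval (pT (1 : Fin n → Circle)) G with hc
  have h5 : ∀ F ∈ P d, φ F = c * ell1 μ F := by
    intro F hF
    rw [key F hF]
    have : ell1 μ (G * F) = ∫ V, c * MvPolynomial.eval (pU V) F ∂μ := by
      refine integral_congr_ae (Eventually.of_forall fun U => ?_)
      simp only [map_mul, he, h4]
    rw [this, integral_const_mul]; rfl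
  have h6 : c = 0 := by
    have := h5 1 (monomial_mem 0 1 d (by simp [wt]))
    rw [hφ1] at this
    have h1 : ell1 μ (1 : R) = 1 := by simp [ell1]
    rw [h1] at this
    simpa using this.symm
  rw [h5 F hF, h6, zero_mul]

theorem ell_eq {n : ℕ} (μ : Measure (Matrix.unitaryGroup (Fin n) ℂ)) [IsProbabilityMeasure μ]
    [μ.IsHaarMeasure] (e : Matrix.unitaryGroup (Fin n) ℂ → Fin n → Circle) (he : ∀ U, pU U = pT (e U))
    (F : R) : ell2 n F = ell2 n 1 * ell1 μ F := by
  have := ell_unique μ e he (ell2 n - (ell2 n 1) • ell1 μ) ?_ ?_ ?_ F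
  · rw [LinearMap.sub_apply, LinearMap.smul_apply, smul_eq_mul, sub_eq_zero] at this
    exact this
  · intro m F
    rw [LinearMap.sub_apply, LinearMap.smul_apply]
    have h1 : ell2 n (Sm m * F + Dm m F) = 0 := sd_T m F
    have h2 : ell1 μ (Sm m * F + Dm m F) = 0 := sd_U μ m F
    rw [h1, h2]; simp
  · have h1 : ell1 μ (1 : R) = 1 := by simp [ell1]
    simp [h1]
  · intro F hF
    have h1 : ell2 n F = 0 := by
      refine integral_eq_zero_of_ae (Eventually.of_forall fun z => ?_)
      have := congrFun hF z
      simp only [evT_apply] at this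
      simp [this]
    have h2 : ell1 μ F = 0 := by
      refine integral_eq_zero_of_ae (Eventually.of_forall fun U => ?_)
      have := congrFun hF (e U)
      simp only [evT_apply] at this
      simp [he, this]
    simp [h1, h2]

end CUE



namespace CUE

/-- the reproducing kernel -/
noncomputable def K (n : ℕ) (x y : Circle) : ℂ := ∑ k : Fin n, ((x : ℂ) / (y : ℂ)) ^ (k : ℕ)

theorem conj_coe (u : Circle) : starRingEnd ℂ (u : ℂ) = (u : ℂ)⁻¹ := by
  rw [← Circle.coe_inv_eq_conj, Circle.coe_inv]

theorem W_eq_det_mul {n : ℕ} (z : Fin n → Circle) :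
    W z = (Matrix.vandermonde (fun j => (z j : ℂ))).det *
      starRingEnd ℂ (Matrix.vandermonde (fun j => (z j : ℂ))).det := by
  rw [Matrix.det_vandermonde, map_prod, ← Finset.prod_mul_distrib]
  simp_rw [map_prod, ← Finset.prod_mul_distrib]
  have h1 : ∀ i j : Fin n, ((z j : ℂ) - z i) * starRingEnd ℂ ((z j : ℂ) - z i) =
      (1 - (z i : ℂ) / z j) * (1 - (z j : ℂ) / z i) := by
    intro i j
    have hi := (z i).coe_ne_zero
    have hj := (z j).coe_ne_zero
    rw [map_sub, conj_coe, conj_coe]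
    field_simp
  simp_rw [h1]
  have h2 := Finset.prod_prod_Ioi_mul_eq_prod_prod_off_diag (fun i j : Fin n => (1 - (z j : ℂ) / z i))
  have hoff : (Finset.univ : Finset (Fin n)).offDiag =
      (Finset.univ ×ˢ Finset.univ).filter fun p => p.1 ≠ p.2 := by ext p; simp
  rw [h2, W, hoff, Finset.prod_filter, Finset.prod_product]
  refine Finset.prod_congr rfl fun i _ => ?_
  rw [← Finset.prod_filter]
  refine Finset.prod_congr ?_ fun j _ => rfl
  ext j; simp [eq_comm]

theorem W_eq_det {n : ℕ} (z : Fin n → Circle) :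
    W z = (Matrix.of fun i j => K n (z i) (z j)).det := by
  rw [W_eq_det_mul]
  have h : starRingEnd ℂ (Matrix.vandermonde (fun j => (z j : ℂ))).det =
    (Matrix.conjTranspose (Matrix.vandermonde (fun j => (z j : ℂ)))).det := by
    rw [Matrix.det_conjTranspose]; rfl
  rw [h, ← Matrix.det_mul]
  congr 1
  ext i j
  simp only [Matrix.mul_apply, Matrix.conjTranspose_apply, Matrix.vandermonde_apply, Matrix.of_apply, K]
  refine Finset.sum_congr rfl fun k _ => ?_
  rw [star_pow, ← starRingEnd_apply, conj_coe, div_eq_mul_inv, mul_pow]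

/-- real density -/
noncomputable def Wr {n : ℕ} (z : Fin n → Circle) : ℝ :=
  Complex.normSq (Matrix.vandermonde (fun j => (z j : ℂ))).det

theorem W_eq {n : ℕ} (z : Fin n → Circle) : W z = (Wr z : ℂ) := by
  rw [W_eq_det_mul, Complex.mul_conj]; rfl

theorem Wr_nonneg {n : ℕ} (z : Fin n → Circle) : 0 ≤ Wr z := Complex.normSq_nonneg _

theorem continuous_Wr {n : ℕ} : Continuous (Wr (n := n)) := by
  have := Complex.continuous_re.comp (continuous_W (n := n))
  refine this.congr fun z => ?_
  simp [W_eq]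

theorem norm_pT_le {n : ℕ} (z : Fin n → Circle) (l : ℤ) : pT z l ∈ Metric.closedBall (0 : ℂ) n := by
  rw [mem_closedBall_zero_iff]
  refine (norm_sum_le _ _).trans ?_
  simp only [norm_zpow, Circle.norm_coe, one_zpow]; simp

theorem count_eq {n : ℕ} (z w : Fin n → Circle) (h : pT z = pT w) (c : ℂ) :
    (Finset.univ.filter fun j => (z j : ℂ) = c).card = (Finset.univ.filter fun j => (w j : ℂ) = c).card := by
  classical
  set S : Finset ℂ := insert c (Finset.univ.image (fun j => (z j : ℂ)) ∪ Finset.univ.image (fun j => (w j : ℂ))) with hS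
  set p := Lagrange.basis S id c with hp
  have hc : c ∈ S := by simp [hS]
  have h1 : ∀ x ∈ S, p.eval x = if x = c then 1 else 0 := by
    intro x hx
    split_ifs with hxc
    · subst hxc
      exact Lagrange.eval_basis_self (v := id) (fun _ _ _ _ h => h) hc
    · exact Lagrange.eval_basis_of_ne (v := id) (Ne.symm hxc) hx
  have h2 : ∀ v : Fin n → Circle, ∑ j, p.eval (v j : ℂ) = ∑ k ∈ Finset.range (p.natDegree + 1), p.coeff k * pT v k := by
    intro v
    simp_rw [Polynomial.eval_eq_sum_range, pT, Finset.mul_sum]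
    rw [Finset.sum_comm]
    simp
  have h3 : ∀ v : Fin n → Circle, (∀ j, (v j : ℂ) ∈ S) → ∑ j, p.eval (v j : ℂ) = ((Finset.univ.filter fun j => (v j : ℂ) = c).card : ℂ) := by
    intro v hv
    rw [Finset.sum_congr rfl fun j _ => h1 _ (hv j)]
    simp
  have h4 := h2 z
  rw [h, ← h2 w, h3 z (fun j => by simp [hS]), h3 w (fun j => by simp [hS])] at h4
  exact_mod_cast h4

/-- configurations with two points within distance `r` -/
def Cl (n : ℕ) (r : ℝ) : Set (Fin n → Circle) := {z | ∃ i j, i ≠ j ∧ ‖(z i : ℂ) - z j‖ ≤ r}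

theorem isClosed_Cl (n : ℕ) (r : ℝ) : IsClosed (Cl n r) := by
  have : Cl n r = ⋃ i, ⋃ j, ⋃ _ : i ≠ j, {z : Fin n → Circle | ‖(z i : ℂ) - z j‖ ≤ r} := by
    ext z; simp [Cl]
  rw [this]
  refine isClosed_iUnion_of_finite fun i => isClosed_iUnion_of_finite fun j => isClosed_iUnion_of_finite fun _ => ?_
  refine isClosed_le ?_ continuous_const
  fun_prop

theorem Cl_inv {n : ℕ} {r : ℝ} {z w : Fin n → Circle} (h : pT z = pT w) (hz : z ∈ Cl n r) : w ∈ Cl n r := by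
  classical
  obtain ⟨i, j, hij, hd⟩ := hz
  have hc := count_eq z w h
  by_cases he : (z i : ℂ) = z j
  · have h1 : 1 < (Finset.univ.filter fun k => (w k : ℂ) = z i).card := by
      rw [← hc, Finset.one_lt_card]
      exact ⟨i, by simp, j, by simp [he], hij⟩
    obtain ⟨a, ha, b, hb, hab⟩ := Finset.one_lt_card.1 h1
    simp only [Finset.mem_filter, Finset.mem_univ, true_and] at ha hb
    refine ⟨a, b, hab, ?_⟩
    rw [ha, hb, sub_self, norm_zero]
    exact (norm_nonneg _).trans hd
  · have ex : ∀ k, ∃ a, (w a : ℂ) = z k := by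
      intro k
      have h1 : 0 < (Finset.univ.filter fun a => (w a : ℂ) = z k).card := by
        rw [← hc, Finset.card_pos]
        exact ⟨k, by simp⟩
      obtain ⟨a, ha⟩ := Finset.card_pos.1 h1
      exact ⟨a, by simpa using ha⟩
    obtain ⟨a, ha⟩ := ex i
    obtain ⟨b, hb⟩ := ex j
    refine ⟨a, b, ?_, ?_⟩
    · rintro rfl; exact he (ha.symm.trans hb)
    · rw [ha, hb]; exact hd

/-- space of power sum sequences -/
abbrev EE' (n : ℕ) : Type := ℤ → Metric.closedBall (0 : ℂ) n

/-- torus to power sums -/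
noncomputable def piT {n : ℕ} (z : Fin n → Circle) : EE' n := fun l => ⟨pT z l, norm_pT_le z l⟩

theorem continuous_piT {n : ℕ} : Continuous (piT (n := n)) :=
  continuous_pi fun l => (continuous_pT l).subtype_mk _

/-- star subalgebra of polynomial functions -/
noncomputable def Alg (n : ℕ) : StarSubalgebra ℂ (BoundedContinuousFunction (EE' n) ℂ) where
  carrier := {g | ∃ F : R, ∀ z : Fin n → Circle, g (piT z) = MvPolynomial.eval (pT z) F}
  mul_mem' := by
    rintro a b ⟨F, hF⟩ ⟨G, hG⟩
    exact ⟨F * G, fun z => by simp [hF, hG]⟩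
  add_mem' := by
    rintro a b ⟨F, hF⟩ ⟨G, hG⟩
    exact ⟨F + G, fun z => by simp [hF, hG]⟩
  algebraMap_mem' c := ⟨MvPolynomial.C c, fun z => by simp⟩
  star_mem' := by
    rintro a ⟨F, hF⟩
    exact ⟨cj F, fun z => by rw [eval_cj, ← hF]; rfl⟩

theorem measure_eq {n : ℕ} (μ : Measure (Matrix.unitaryGroup (Fin n) ℂ)) [IsProbabilityMeasure μ]
    [μ.IsHaarMeasure] (e : Matrix.unitaryGroup (Fin n) ℂ → Fin n → Circle) (he : ∀ U, pU U = pT (e U))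
    (c : ℝ) (hc0 : 0 ≤ c) (hc : ∫ z, W z ∂(mT (Fin n)) = c) (r : ℝ) :
    ∫⁻ z in Cl n r, ENNReal.ofReal (Wr z) ∂(mT (Fin n)) = ENNReal.ofReal c * μ {U | e U ∈ Cl n r} := by
  have hpc : Continuous fun U => piT (e U) := by
    refine continuous_pi fun l => Continuous.subtype_mk ?_ _
    refine (continuous_pU l).congr fun U => ?_
    rw [he]
  let P1 := (ENNReal.ofReal c • μ.map fun U => piT (e U))
  let P2 := ((mT (Fin n)).withDensity fun z => ENNReal.ofReal (Wr z)).map piT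
  have hWm : Measurable fun z : Fin n → Circle => ENNReal.ofReal (Wr z) :=
    (continuous_Wr.measurable).ennreal_ofReal
  have : IsFiniteMeasure ((mT (Fin n)).withDensity fun z => ENNReal.ofReal (Wr z)) := by
    refine isFiniteMeasure_withDensity_ofReal ?_
    have := (integrable_cont (mT (Fin n)) _ continuous_W).re.2
    simp only [W_eq] at this
    exact this
  have hf1 : IsFiniteMeasure P1 := by
    have : IsFiniteMeasure (μ.map fun U => piT (e U)) := inferInstance
    exact Measure.smul_finite _ ENNReal.ofReal_ne_top
  have hf2 : IsFiniteMeasure P2 := inferInstanceAs (IsFiniteMeasure (Measure.map _ _))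
  have hP : P2 = P1 := by
    refine ext_of_forall_mem_subalgebra_integral_eq_of_polish (𝕜 := ℂ) (A := Alg n) ?_ ?_
    · intro x y hxy
      obtain ⟨l, hl⟩ := Function.ne_iff.1 hxy
      let f : BoundedContinuousFunction (EE' n) ℂ := BoundedContinuousFunction.mkOfCompact
        ⟨fun x => ((x l : Metric.closedBall (0 : ℂ) n) : ℂ), by fun_prop⟩
      refine ⟨f, ⟨BoundedContinuousFunction.toContinuousMapStarₐ ℂ f, ⟨f, ⟨MvPolynomial.X l, ?_⟩, rfl⟩, rfl⟩, ?_⟩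
      · intro z; simp [f, piT]
      · simpa [f, Subtype.ext_iff] using hl
    · rintro g ⟨F, hF⟩
      have hgm : Continuous g := g.continuous
      rw [integral_smul_measure, integral_map hpc.aemeasurable hgm.aestronglyMeasurable,
        integral_map continuous_piT.aemeasurable hgm.aestronglyMeasurable]
      rw [integral_withDensity_eq_integral_toReal_smul hWm (by simp)]
      have h1 := ell_eq μ e he F
      have h2 : ell2 n 1 = c := by simp [ell2, hc]
      rw [h2] at h1
      have h3 : ell2 n F = ∫ z, MvPolynomial.eval (pT z) F * W z ∂(mT (Fin n)) := rfl
      have h4 : ell1 μ F = ∫ V, MvPolynomial.eval (pU V) F ∂μ := rfl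
      rw [h3, h4] at h1
      simp only [hF, ← he]
      rw [ENNReal.toReal_ofReal hc0, Complex.real_smul, ← h1]
      refine integral_congr_ae (Eventually.of_forall fun z => ?_)
      simp only []
      rw [W_eq, ENNReal.toReal_ofReal (Wr_nonneg z), Complex.real_smul, mul_comm]
  have hcl : IsClosed (piT '' Cl n r) := (isClosed_Cl n r).isCompact.image continuous_piT |>.isClosed
  have key : ∀ z, piT z ∈ piT '' Cl n r ↔ z ∈ Cl n r := by
    intro z
    constructor
    · rintro ⟨w, hw, hwz⟩
      refine Cl_inv ?_ hw
      funext l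
      exact congrArg Subtype.val (congrFun hwz l)
    · exact fun h => ⟨z, h, rfl⟩
  have h1 := congrArg (fun P => P (piT '' Cl n r)) hP
  simp only [P1, P2, Measure.smul_apply, smul_eq_mul] at h1
  rw [Measure.map_apply continuous_piT.measurable hcl.measurableSet,
    Measure.map_apply hpc.measurable hcl.measurableSet] at h1
  have h2 : piT ⁻¹' (piT '' Cl n r) = Cl n r := by ext z; exact key z
  have h3 : (fun U => piT (e U)) ⁻¹' (piT '' Cl n r) = {U | e U ∈ Cl n r} := by ext U; exact key (e U)
  rw [h2, h3, withDensity_apply _ (isClosed_Cl n r).measurableSet] at h1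
  exact h1

end CUE



namespace CUE

theorem mp_hom {G H : Type*} [Group G] [TopologicalSpace G] [IsTopologicalGroup G] [MeasurableSpace G] [BorelSpace G]
    [Group H] [TopologicalSpace H] [IsTopologicalGroup H] [MeasurableSpace H] [BorelSpace H] [LocallyCompactSpace H]
    (μ : Measure G) (ν : Measure H) [IsProbabilityMeasure μ] [IsProbabilityMeasure ν] [μ.IsHaarMeasure]
    [ν.IsHaarMeasure] (φ : G →* H) (hφ : Continuous φ) (hs : Function.Surjective φ) :
    MeasurePreserving φ μ ν := by
  refine ⟨hφ.measurable, ?_⟩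
  have h1 := Measure.isHaarMeasure_map_of_isFiniteMeasure μ φ hφ hs
  have h2 : IsProbabilityMeasure (μ.map φ) := Measure.isProbabilityMeasure_map hφ.aemeasurable
  exact Measure.isHaarMeasure_eq_of_isProbabilityMeasure _ _

theorem integral_zpow (m : ℤ) (hm : m ≠ 0) : ∫ t : Circle, (t : ℂ) ^ m ∂mC = 0 := by
  set a : Circle := Circle.exp (π / m) with ha
  have h1 : (a : ℂ) ^ m = -1 := by
    rw [ha, Circle.coe_exp, ← Complex.exp_int_mul, ← Complex.exp_pi_mul_I]
    congr 1
    have : (m : ℂ) ≠ 0 := by exact_mod_cast hm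
    push_cast
    field_simp
  have h2 := integral_mul_left_eq_self (μ := mC) (fun t : Circle => (t : ℂ) ^ m) a
  simp only [Circle.coe_mul, mul_zpow, h1] at h2
  rw [integral_const_mul] at h2
  have h3 : (2 : ℂ) * ∫ t : Circle, (t : ℂ) ^ m ∂mC = 0 := by linear_combination -h2
  simpa using h3

theorem cont_K (n : ℕ) {X : Type*} [TopologicalSpace X] {f g : X → Circle} (hf : Continuous f) (hg : Continuous g) :
    Continuous fun x => K n (f x) (g x) := by
  unfold K
  refine continuous_finsetSum _ fun k _ => Continuous.pow ?_ _
  refine Continuous.div (by fun_prop) (by fun_prop) fun x => Circle.coe_ne_zero _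

theorem K_self (n : ℕ) (x : Circle) : K n x x = n := by
  simp [K, Circle.coe_ne_zero]

theorem K_rep (n : ℕ) (x y : Circle) : ∫ t, K n x t * K n t y ∂mC = K n x y := by
  have h1 : ∀ t : Circle, K n x t * K n t y = ∑ j : Fin n, ∑ k : Fin n,
      ((x : ℂ) ^ (j : ℕ) * ((y : ℂ) ^ (k : ℕ))⁻¹) * (t : ℂ) ^ ((k : ℤ) - (j : ℤ)) := by
    intro t
    simp only [K, Finset.sum_mul_sum]
    refine Finset.sum_congr rfl fun j _ => Finset.sum_congr rfl fun k _ => ?_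
    rw [zpow_sub₀ (Circle.coe_ne_zero t), div_pow, div_pow, zpow_natCast, zpow_natCast]
    ring
  have hc : ∀ m : ℤ, Continuous fun t : Circle => (t : ℂ) ^ m := fun m =>
    Continuous.zpow₀ (by fun_prop) m fun t => Or.inl (Circle.coe_ne_zero t)
  simp_rw [h1]
  rw [integral_finsetSum _ fun j _ => integrable_cont _ _ (by
    refine continuous_finsetSum _ fun k _ => continuous_const.mul (hc _))]
  rw [K]
  refine Finset.sum_congr rfl fun j _ => ?_
  have hcc : ∀ k ∈ (Finset.univ : Finset (Fin n)), Integrable (fun t : Circle => ((x : ℂ) ^ (j : ℕ) * ((y : ℂ) ^ (k : ℕ))⁻¹) *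
      (t : ℂ) ^ ((k : ℤ) - (j : ℤ))) mC := fun k _ =>
    integrable_cont mC _ (continuous_const.mul (hc _))
  rw [integral_finsetSum _ hcc]
  simp only [integral_const_mul]
  rw [Finset.sum_eq_single j]
  · rw [sub_self]; simp [div_eq_mul_inv, mul_pow]
  · intro k _ hk
    rw [integral_zpow, mul_zero]
    intro h; apply hk; ext; omega
  · simp

/-- matrix of the kernel -/
noncomputable def KM (n : ℕ) {ι : Type*} (u : ι → Circle) : Matrix ι ι ℂ := Matrix.of fun i j => K n (u i) (u j)

theorem cont_KMdet (n : ℕ) {ι : Type*} [Fintype ι] [DecidableEq ι] : Continuous fun u : ι → Circle => (KM n u).det :=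
  Continuous.matrix_det (continuous_matrix fun i j => cont_K n (continuous_apply i) (continuous_apply j))

theorem perm_prod {ι : Type*} [Fintype ι] [DecidableEq ι] (M : Matrix (Option ι) (Option ι) ℂ) (a : ι)
    (σ : Equiv.Perm ι) :
    ∏ i, M ((Equiv.swap none (some a) * σ.optionCongr : Equiv.Perm (Option ι)) i) i =
      (M (some a) none * M none (some (σ.symm a))) *
        ∏ i ∈ Finset.univ.erase (σ.symm a), M (some (σ i)) (some i) := by
  rw [Fintype.prod_option, ← Finset.mul_prod_erase Finset.univ _ (Finset.mem_univ (σ.symm a)), mul_assoc]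
  congr 1
  congr 1
  · simp
  · refine Finset.prod_congr rfl fun i hi => ?_
    have : σ i ≠ a := by
      rintro rfl; simp at hi
    simp [Equiv.swap_apply_of_ne_of_ne, this]

theorem integrate_out (n : ℕ) {ι : Type*} [Fintype ι] [DecidableEq ι] (u : ι → Circle) :
    ∫ x, (KM n (fun o : Option ι => o.elim x u)).det ∂mC = ((n : ℂ) - Fintype.card ι) * (KM n u).det := by
  have h1 : ∀ x : Circle, (KM n (fun o : Option ι => o.elim x u)).det =
      ∑ σ : Equiv.Perm ι, (((Equiv.Perm.sign σ : ℤ) : ℂ) * ((n : ℂ) * ∏ i, K n (u (σ i)) (u i)) +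
        ∑ a, (-((Equiv.Perm.sign σ : ℤ) : ℂ)) * ((K n (u a) x * K n x (u (σ.symm a))) *
          ∏ i ∈ Finset.univ.erase (σ.symm a), K n (u (σ i)) (u i))) := by
    intro x
    rw [Matrix.det_apply', ← Equiv.Perm.decomposeOption.symm.sum_comp, Fintype.sum_prod_type_right]
    refine Finset.sum_congr rfl fun σ _ => ?_
    rw [Fintype.sum_option]
    congr 1
    · rw [Equiv.Perm.decomposeOption_symm_sign, Fintype.prod_option]
      simp [KM, K_self]
    · refine Finset.sum_congr rfl fun a _ => ?_
      have h2 : Equiv.Perm.decomposeOption.symm (some a, σ) = Equiv.swap none (some a) * σ.optionCongr := rfl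
      rw [h2, perm_prod, Equiv.Perm.sign_mul, Equiv.Perm.sign_swap (by simp), Equiv.optionCongr_sign]
      simp [KM]
  have hc : ∀ (σ : Equiv.Perm ι) (a : ι), Continuous fun x : Circle => (-((Equiv.Perm.sign σ : ℤ) : ℂ)) * ((K n (u a) x * K n x (u (σ.symm a))) *
          ∏ i ∈ Finset.univ.erase (σ.symm a), K n (u (σ i)) (u i)) := fun σ a =>
    continuous_const.mul (((cont_K n continuous_const continuous_id).mul (cont_K n continuous_id continuous_const)).mul continuous_const)
  simp_rw [h1]
  rw [integral_finsetSum _ fun σ _ => integrable_cont _ _ (Continuous.add continuous_const (continuous_finsetSum _ fun a _ => hc σ a) :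
      Continuous fun x => (_ + _)),
    Matrix.det_apply', Finset.mul_sum]
  refine Finset.sum_congr rfl fun σ _ => ?_
  rw [integral_add (integrable_const _) (integrable_cont _ _ (continuous_finsetSum _ fun a _ => hc σ a)),
    integral_finsetSum _ fun a _ => integrable_cont _ _ (hc σ a)]
  have h3 : ∀ a, ∫ x, (-((Equiv.Perm.sign σ : ℤ) : ℂ)) * ((K n (u a) x * K n x (u (σ.symm a))) *
          ∏ i ∈ Finset.univ.erase (σ.symm a), K n (u (σ i)) (u i)) ∂mC =
      (-((Equiv.Perm.sign σ : ℤ) : ℂ)) * ∏ i, K n (u (σ i)) (u i) := by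
    intro a
    rw [integral_const_mul, integral_mul_const, K_rep, ← Finset.mul_prod_erase Finset.univ _ (Finset.mem_univ (σ.symm a))]
    simp
  simp_rw [h3]
  simp [KM]
  ring

/-- real determinant -/
noncomputable def Kd (n : ℕ) {ι : Type*} [Fintype ι] [DecidableEq ι] (u : ι → Circle) : ℝ := (KM n u).det.re

open scoped ComplexOrder in
theorem KM_psd (n : ℕ) {ι : Type*} [Fintype ι] [DecidableEq ι] (u : ι → Circle) : (KM n u).PosSemidef := by
  have : KM n u = (Matrix.of fun (i : ι) (k : Fin n) => (u i : ℂ) ^ (k : ℕ)) *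
      Matrix.conjTranspose (Matrix.of fun (i : ι) (k : Fin n) => (u i : ℂ) ^ (k : ℕ)) := by
    ext i j
    simp only [Matrix.mul_apply, Matrix.conjTranspose_apply, Matrix.of_apply, K, KM]
    refine Finset.sum_congr rfl fun k _ => ?_
    rw [star_pow, ← starRingEnd_apply, conj_coe, div_eq_mul_inv, mul_pow]
  rw [this]
  exact Matrix.posSemidef_self_mul_conjTranspose _

open scoped ComplexOrder in
theorem Kd_eq (n : ℕ) {ι : Type*} [Fintype ι] [DecidableEq ι] (u : ι → Circle) :
    0 ≤ Kd n u ∧ (KM n u).det = (Kd n u : ℂ) := by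
  have h := (KM_psd n u).det_nonneg
  rw [Complex.nonneg_iff] at h
  exact ⟨h.1, Complex.ext (by simp [Kd]) (by simp [← h.2])⟩

theorem Kd_nonneg (n : ℕ) {ι : Type*} [Fintype ι] [DecidableEq ι] (u : ι → Circle) : 0 ≤ Kd n u := (Kd_eq n u).1

theorem cont_Kd (n : ℕ) {ι : Type*} [Fintype ι] [DecidableEq ι] : Continuous fun u : ι → Circle => Kd n u :=
  Complex.continuous_re.comp (cont_KMdet n)

theorem Wr_eq {n : ℕ} (z : Fin n → Circle) : Wr z = Kd n z := by
  have := W_eq z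
  rw [W_eq_det] at this
  rw [Kd, KM, this]; simp

theorem lintegral_out (n : ℕ) {ι : Type*} [Fintype ι] [DecidableEq ι] (h : Fintype.card ι < n) (u : ι → Circle) :
    ∫⁻ x, ENNReal.ofReal (Kd n (fun o : Option ι => o.elim x u)) ∂mC =
      ((n - Fintype.card ι : ℕ) : ENNReal) * ENNReal.ofReal (Kd n u) := by
  have hcc : Continuous fun x : Circle => (fun o : Option ι => o.elim x u : Option ι → Circle) := by
    refine continuous_pi fun o => ?_
    cases o
    · exact continuous_id
    · exact continuous_const
  have hc := (cont_Kd (ι := Option ι) n).comp hcc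
  have hcC : Continuous fun x => (KM n (fun o : Option ι => o.elim x u)).det := (cont_KMdet n).comp hcc
  have hi : Integrable (fun x => Kd n (fun o : Option ι => o.elim x u)) mC := (integrable_cont mC _ hcC).re
  rw [← ofReal_integral_eq_lintegral_ofReal hi (Eventually.of_forall fun x => Kd_nonneg _ _)]
  have h1 := integrate_out n u
  simp_rw [(Kd_eq n _).2] at h1
  rw [integral_complex_ofReal] at h1
  have h2 : ∫ x, Kd n (fun o : Option ι => o.elim x u) ∂mC = ((n - Fintype.card ι : ℕ) : ℝ) * Kd n u := by
    rw [Nat.cast_sub h.le]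
    exact_mod_cast h1
  rw [h2, ENNReal.ofReal_mul (by positivity), ENNReal.ofReal_natCast]

/-- splitting off a coordinate -/
def optHom (ι : Type*) : Circle × (ι → Circle) →* (Option ι → Circle) where
  toFun p := fun o => o.elim p.1 p.2
  map_one' := by funext o; cases o <;> rfl
  map_mul' p q := by funext o; cases o <;> rfl

theorem mp_opt (ι : Type*) [Fintype ι] : MeasurePreserving (optHom ι) (mC.prod (mT ι)) (mT (Option ι)) := by
  refine mp_hom _ _ _ ?_ ?_
  · refine continuous_pi fun o => ?_
    cases o
    · exact continuous_fst
    · rename_i i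
      change Continuous fun p : Circle × (ι → Circle) => p.2 i
      fun_prop
  · intro v
    refine ⟨(v none, fun i => v (some i)), ?_⟩
    funext o; cases o <;> rfl

theorem lintegral_opt (ι : Type*) [Fintype ι] (f : (Option ι → Circle) → ENNReal) (hf : Measurable f) :
    ∫⁻ v, f v ∂(mT (Option ι)) = ∫⁻ u, ∫⁻ x, f (fun o => o.elim x u) ∂mC ∂(mT ι) := by
  rw [← (mp_opt ι).lintegral_comp hf, lintegral_prod_symm]
  · rfl
  · exact (hf.comp (mp_opt ι).measurable).aemeasurable

/-- composition homomorphism -/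
def compHom {ι κ : Type*} (f : ι → κ) : (κ → Circle) →* (ι → Circle) where
  toFun z := z ∘ f
  map_one' := rfl
  map_mul' _ _ := rfl

theorem mp_comp {ι κ : Type*} [Fintype ι] [Fintype κ] (f : ι → κ) (hf : Function.Injective f) :
    MeasurePreserving (compHom f) (mT κ) (mT ι) := by
  refine mp_hom _ _ _ ?_ ?_
  · exact continuous_pi fun i => continuous_apply (f i)
  · intro v
    exact ⟨Function.extend f v 1, by funext i; simp [compHom, hf.extend_apply]⟩

theorem lintegral_corr (n m : ℕ) : ∀ (ι : Type) [Fintype ι] [DecidableEq ι] (f : ι ↪ Fin n)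
    (g : (ι → Circle) → ENNReal) (_ : Measurable g) (_ : Fintype.card ι + m = n),
    ∫⁻ z, g (z ∘ f) * ENNReal.ofReal (Wr z) ∂(mT (Fin n)) =
      (m.factorial : ENNReal) * ∫⁻ u, g u * ENNReal.ofReal (Kd n u) ∂(mT ι) := by
  induction m with
  | zero =>
    intro ι _ _ f g hg hc
    have hb : Function.Bijective f := by
      rw [Fintype.bijective_iff_injective_and_card]
      exact ⟨f.injective, by simpa using hc⟩
    let e : ι ≃ Fin n := Equiv.ofBijective f hb
    have h1 : ∀ z : Fin n → Circle, Wr z = Kd n (compHom f z) := by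
      intro z
      rw [Wr_eq, Kd, Kd, ← Matrix.det_submatrix_equiv_self e (KM n z)]
      rfl
    simp_rw [h1]
    have hm2 : Measurable fun u => g u * ENNReal.ofReal (Kd n u) := hg.mul (cont_Kd n).measurable.ennreal_ofReal
    rw [← (mp_comp f f.injective).lintegral_comp hm2]
    simp [compHom]
  | succ m ih =>
    intro ι _ _ f g hg hc
    have hns : ¬ Function.Surjective f := by
      intro hs
      have := Fintype.card_le_of_surjective f hs
      simp at this; omega
    obtain ⟨j, hj⟩ := not_forall.1 hns
    let f' : Option ι ↪ Fin n := ⟨fun o => o.elim j f, by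
      rintro (_ | a) (_ | b) h
      · rfl
      · exact absurd ⟨b, h.symm⟩ hj
      · exact absurd ⟨a, h⟩ hj
      · exact congrArg some (f.injective h)⟩
    have hm : Measurable fun v : Option ι → Circle => g fun i => v (some i) :=
      hg.comp (measurable_pi_lambda _ fun i => measurable_pi_apply _)
    have h1 := ih (Option ι) f' (fun v => g fun i => v (some i)) hm (by simp; omega)
    have h2 : ∀ z : Fin n → Circle, (fun i => (z ∘ f') (some i)) = z ∘ f := fun z => rfl
    simp_rw [h2] at h1
    have hm2 : Measurable fun u => g u * ENNReal.ofReal (Kd n u) := hg.mul (cont_Kd n).measurable.ennreal_ofReal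
    have hm3 : Measurable fun u : Option ι → Circle => (g fun i => u (some i)) * ENNReal.ofReal (Kd n u) :=
      hm.mul (cont_Kd n).measurable.ennreal_ofReal
    rw [h1, lintegral_opt _ _ hm3]
    have h3 : ∀ u : ι → Circle, ∫⁻ x, (g fun i => u i) * ENNReal.ofReal (Kd n fun o : Option ι => o.elim x u) ∂mC
        = ((n - Fintype.card ι : ℕ) : ENNReal) * (g u * ENNReal.ofReal (Kd n u)) := by
      intro u
      rw [lintegral_const_mul, lintegral_out n (by omega) u]
      · ring
      · refine ((cont_Kd n).comp (?_ : Continuous fun x : Circle =>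
          (fun o : Option ι => o.elim x u : Option ι → Circle))).measurable.ennreal_ofReal
        refine continuous_pi fun o => ?_
        cases o
        · exact continuous_id
        · exact continuous_const
    simp only [Option.elim_some]
    simp_rw [h3]
    rw [lintegral_const_mul _ hm2, ← mul_assoc]
    congr 1
    rw [show n - Fintype.card ι = m + 1 by omega, Nat.factorial_succ]
    push_cast; ring

end CUE



namespace CUE

theorem lintegral_Wr (n : ℕ) : ∫⁻ z, ENNReal.ofReal (Wr z) ∂(mT (Fin n)) = (n.factorial : ENNReal) := by
  have h := lintegral_corr n n (Fin 0) ⟨Fin.elim0, fun a => a.elim0⟩ (fun _ => 1) measurable_const (by simp)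
  simp only [one_mul] at h
  rw [h]
  have : ∀ u : Fin 0 → Circle, Kd n u = 1 := fun u => by simp [Kd]
  simp [this]

/-- joint law of the eigenvalues -/
noncomputable def nu (n : ℕ) : Measure (Fin n → Circle) :=
  (n.factorial : ENNReal)⁻¹ • (mT (Fin n)).withDensity fun z => ENNReal.ofReal (Wr z)

theorem meas_Wr {n : ℕ} : Measurable fun z : Fin n → Circle => ENNReal.ofReal (Wr z) :=
    (continuous_Wr.measurable).ennreal_ofReal

theorem fact_ne_zero (n : ℕ) : (n.factorial : ENNReal) ≠ 0 := by
  exact_mod_cast n.factorial_ne_zero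

instance (n : ℕ) : IsProbabilityMeasure (nu n) := by
  refine ⟨?_⟩
  rw [nu, Measure.smul_apply, withDensity_apply _ MeasurableSet.univ, Measure.restrict_univ, lintegral_Wr, smul_eq_mul]
  exact ENNReal.inv_mul_cancel (fact_ne_zero n) (by simp)

theorem lintegral_nu (n : ℕ) (g : (Fin n → Circle) → ENNReal) (hg : Measurable g) :
    ∫⁻ z, g z ∂(nu n) = (n.factorial : ENNReal)⁻¹ * ∫⁻ z, g z * ENNReal.ofReal (Wr z) ∂(mT (Fin n)) := by
  rw [nu, lintegral_smul_measure, smul_eq_mul, lintegral_withDensity_eq_lintegral_mul _ meas_Wr hg]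
  congr 1
  refine lintegral_congr fun z => ?_
  simp [mul_comm]

theorem meas_comp {n : ℕ} {ι : Type} (f : ι ↪ Fin n) {g : (ι → Circle) → ENNReal} (hg : Measurable g) :
    Measurable fun z : Fin n → Circle => g (z ∘ f) :=
  hg.comp (measurable_pi_lambda _ fun i => measurable_pi_apply _)

/-- factorial moment formula -/
theorem nu_sum (n : ℕ) {ι : Type} [Fintype ι] [DecidableEq ι] (h : Fintype.card ι ≤ n)
    (g : (ι → Circle) → ENNReal) (hg : Measurable g) :
    ∫⁻ z, ∑ f : ι ↪ Fin n, g (z ∘ f) ∂(nu n) = ∫⁻ u, g u * ENNReal.ofReal (Kd n u) ∂(mT ι) := by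
  rw [lintegral_finsetSum _ fun f _ => meas_comp f hg]
  have h1 : ∀ f : ι ↪ Fin n, ∫⁻ z, g (z ∘ f) ∂(nu n) = (n.factorial : ENNReal)⁻¹ *
      (((n - Fintype.card ι).factorial : ENNReal) * ∫⁻ u, g u * ENNReal.ofReal (Kd n u) ∂(mT ι)) := by
    intro f
    rw [lintegral_nu _ _ (meas_comp f hg), lintegral_corr n (n - Fintype.card ι) ι f g hg (by omega)]
  simp_rw [h1]
  rw [Finset.sum_const, Finset.card_univ, Fintype.card_embedding_eq, Fintype.card_fin, nsmul_eq_mul,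
    ← mul_assoc, ← mul_assoc]
  rw [show ((n.descFactorial (Fintype.card ι) : ℕ) : ENNReal) * (n.factorial : ENNReal)⁻¹ *
    ((n - Fintype.card ι).factorial : ENNReal) = 1 from ?_, one_mul]
  have h2 := Nat.factorial_mul_descFactorial h
  rw [mul_right_comm, ← Nat.cast_mul, mul_comm (n.descFactorial _), h2]
  exact ENNReal.mul_inv_cancel (fact_ne_zero n) (by simp)

theorem integral_W (n : ℕ) : ∫ z, W z ∂(mT (Fin n)) = ((n.factorial : ℝ) : ℂ) := by
  simp_rw [W_eq]
  rw [integral_complex_ofReal]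
  congr 1
  rw [integral_eq_lintegral_of_nonneg_ae (Eventually.of_forall Wr_nonneg) continuous_Wr.aestronglyMeasurable,
    lintegral_Wr]
  simp

theorem meas_pre {n : ℕ} (e : Matrix.unitaryGroup (Fin n) ℂ → Fin n → Circle) (he : ∀ U, pU U = pT (e U)) (r : ℝ) :
    MeasurableSet {U | e U ∈ Cl n r} := by
  have hpc : Continuous fun U => piT (e U) := by
    refine continuous_pi fun l => Continuous.subtype_mk ?_ _
    refine (continuous_pU l).congr fun U => ?_
    rw [he]
  have hcl : IsClosed (piT '' Cl n r) := (isClosed_Cl n r).isCompact.image continuous_piT |>.isClosed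
  have h3 : (fun U => piT (e U)) ⁻¹' (piT '' Cl n r) = {U | e U ∈ Cl n r} := by
    ext U
    constructor
    · rintro ⟨w, hw, hwz⟩
      refine Cl_inv ?_ hw
      funext l
      exact congrArg Subtype.val (congrFun hwz l)
    · exact fun h => ⟨e U, h, rfl⟩
  rw [← h3]
  exact (hcl.preimage hpc).measurableSet

theorem haar_nu {n : ℕ} (μ : Measure (Matrix.unitaryGroup (Fin n) ℂ)) [IsProbabilityMeasure μ]
    [μ.IsHaarMeasure] (e : Matrix.unitaryGroup (Fin n) ℂ → Fin n → Circle) (he : ∀ U, pU U = pT (e U)) (r : ℝ) :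
    μ {U | e U ∉ Cl n r} = nu n (Cl n r)ᶜ := by
  have h1 := measure_eq μ e he n.factorial (by positivity) (integral_W n) r
  rw [ENNReal.ofReal_natCast] at h1
  have h2 : nu n (Cl n r) = μ {U | e U ∈ Cl n r} := by
    rw [nu, Measure.smul_apply, withDensity_apply _ (isClosed_Cl n r).measurableSet, h1, smul_eq_mul, ← mul_assoc,
      ENNReal.inv_mul_cancel (fact_ne_zero n) (by simp), one_mul]
  have h3 : {U | e U ∉ Cl n r} = {U | e U ∈ Cl n r}ᶜ := rfl
  rw [h3, prob_compl_eq_one_sub (meas_pre e he r), prob_compl_eq_one_sub (isClosed_Cl n r).measurableSet, h2]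

end CUE



namespace CUE

/-- matrix of powers -/
noncomputable def VM (n : ℕ) {ι : Type*} (u : ι → Circle) : Matrix ι (Fin n) ℂ :=
  Matrix.of fun i k => (u i : ℂ) ^ (k : ℕ)

theorem KM_eq (n : ℕ) {ι : Type*} [Fintype ι] (u : ι → Circle) : KM n u = VM n u * (VM n u).conjTranspose := by
  ext i j
  simp only [Matrix.mul_apply, Matrix.conjTranspose_apply, Matrix.of_apply, K, KM, VM]
  refine Finset.sum_congr rfl fun k _ => ?_
  rw [star_pow, ← starRingEnd_apply, conj_coe, div_eq_mul_inv, mul_pow]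

section forest
variable {ι : Type*} [Fintype ι] [DecidableEq ι]

/-- row-reduced matrix -/
noncomputable def HM (n : ℕ) (p : ι → ι) (u : ι → Circle) : Matrix ι (Fin n) ℂ :=
  Matrix.of fun i k => if p i = i then (u i : ℂ) ^ (k : ℕ) else (u i : ℂ) ^ (k : ℕ) - (u (p i) : ℂ) ^ (k : ℕ)

/-- row operations -/
noncomputable def BM (p : ι → ι) : Matrix ι ι ℂ :=
  Matrix.of fun i j => if i = j then 1 else if j = p i then -1 else 0

theorem det_BM (p : ι → ι) (ρ : ι → ℕ) (hp : ∀ i, p i ≠ i → ρ (p i) < ρ i) : (BM p).det = 1 := by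
  have hB : (BM p).BlockTriangular (OrderDual.toDual ∘ ρ) := by
    intro i j h
    have h : ρ i < ρ j := h
    simp only [BM, Matrix.of_apply]
    have h1 : i ≠ j := by rintro rfl; exact lt_irrefl _ h
    have h2 : j ≠ p i := by
      rintro rfl
      exact absurd (hp i (Ne.symm h1)) (by omega)
    simp [h1, h2]
  rw [hB.det]
  refine Finset.prod_eq_one fun k _ => ?_
  have : (BM p).toSquareBlock (OrderDual.toDual ∘ ρ) k = 1 := by
    ext ⟨i, hi⟩ ⟨j, hj⟩
    simp only [BM, Matrix.toSquareBlock, Matrix.toSquareBlockProp, Matrix.of_apply, Matrix.one_apply, Subtype.mk.injEq]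
    by_cases h : i = j
    · simp [h]
    · have h2 : j ≠ p i := by
        rintro rfl
        have h3 := hp i (Ne.symm h)
        have h4 : ρ i = ρ (p i) := OrderDual.toDual.injective (hi.trans hj.symm)
        omega
      simp [h, h2]
  rw [this, Matrix.det_one]

theorem BM_mul (n : ℕ) (p : ι → ι) (u : ι → Circle) : BM p * VM n u = HM n p u := by
  ext i k
  simp only [Matrix.mul_apply, BM, HM, VM, Matrix.of_apply]
  by_cases h : p i = i
  · rw [if_pos h, Finset.sum_eq_single i]
    · simp
    · intro j _ hj; simp [h, hj, Ne.symm hj]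
    · simp
  · rw [if_neg h, ← Finset.add_sum_erase _ _ (Finset.mem_univ i), Finset.sum_eq_single (p i)]
    · simp [Ne.symm h]; ring
    · intro j hj hj'
      simp [hj', Ne.symm (Finset.ne_of_mem_erase hj)]
    · intro h'; simp [h] at h'

theorem det_forest (n : ℕ) (p : ι → ι) (ρ : ι → ℕ) (hp : ∀ i, p i ≠ i → ρ (p i) < ρ i) (u : ι → Circle) :
    (KM n u).det = (HM n p u * (HM n p u).conjTranspose).det := by
  rw [← BM_mul, Matrix.conjTranspose_mul, Matrix.mul_assoc, ← Matrix.mul_assoc (VM n u), ← KM_eq, Matrix.det_mul,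
    Matrix.det_mul, Matrix.det_conjTranspose, det_BM p ρ hp]
  simp

theorem gram_entry {n : ℕ} (H : Matrix ι (Fin n) ℂ) (q : ι → ℝ) (hq : ∀ i, ∑ k, ‖H i k‖ ^ 2 ≤ q i) (i j : ι) :
    ‖(H * H.conjTranspose) i j‖ ≤ √(q i) * √(q j) := by
  rw [Matrix.mul_apply]
  refine (norm_sum_le _ _).trans ?_
  have h1 : ∀ k, ‖H i k * H.conjTranspose k j‖ = ‖H i k‖ * ‖H j k‖ := by
    intro k; rw [norm_mul, Matrix.conjTranspose_apply, norm_star]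
  simp_rw [h1]
  refine (Real.sum_mul_le_sqrt_mul_sqrt _ _ _).trans ?_
  gcongr
  · exact hq i
  · exact hq j

theorem gram_det {n : ℕ} (H : Matrix ι (Fin n) ℂ) (q : ι → ℝ) (hq : ∀ i, ∑ k, ‖H i k‖ ^ 2 ≤ q i) :
    ‖(H * H.conjTranspose).det‖ ≤ (Fintype.card ι).factorial * ∏ i, q i := by
  have hq0 : ∀ i, 0 ≤ q i := fun i => (Finset.sum_nonneg fun k _ => by positivity).trans (hq i)
  rw [Matrix.det_apply']
  refine (norm_sum_le _ _).trans ?_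
  have h1 : ∀ σ ∈ (Finset.univ : Finset (Equiv.Perm ι)), ‖((Equiv.Perm.sign σ : ℤ) : ℂ) *
      ∏ i, (H * H.conjTranspose) (σ i) i‖ ≤ ∏ i, q i := by
    intro σ _
    have hs : ‖((Equiv.Perm.sign σ : ℤ) : ℂ)‖ = 1 := by
      rcases Int.units_eq_one_or (Equiv.Perm.sign σ) with h | h <;> simp [h]
    rw [norm_mul, hs, one_mul, norm_prod]
    refine (Finset.prod_le_prod (fun i _ => norm_nonneg _) fun i _ => gram_entry H q hq (σ i) i).trans ?_
    rw [Finset.prod_mul_distrib, Equiv.prod_comp σ (fun i => √(q i)), ← Finset.prod_mul_distrib]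
    refine le_of_eq (Finset.prod_congr rfl fun i _ => Real.mul_self_sqrt (hq0 i))
  refine (Finset.sum_le_sum h1).trans ?_
  rw [Finset.sum_const, Finset.card_univ, Fintype.card_perm, nsmul_eq_mul]

theorem norm_pow_sub (x y : Circle) (k : ℕ) : ‖(x : ℂ) ^ k - (y : ℂ) ^ k‖ ≤ k * ‖(x : ℂ) - y‖ := by
  induction k with
  | zero => simp
  | succ k ih =>
    have : (x : ℂ) ^ (k + 1) - (y : ℂ) ^ (k + 1) = x * ((x : ℂ) ^ k - (y : ℂ) ^ k) + (x - y) * (y : ℂ) ^ k := by ring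
    rw [this]
    refine (norm_add_le _ _).trans ?_
    rw [norm_mul, norm_mul, norm_pow, Circle.norm_coe, Circle.norm_coe]
    push_cast
    rw [one_pow]
    linarith

theorem Kd_forest (n : ℕ) (p : ι → ι) (ρ : ι → ℕ) (hp : ∀ i, p i ≠ i → ρ (p i) < ρ i) (u : ι → Circle) :
    Kd n u ≤ (Fintype.card ι).factorial * ∏ i, (if p i = i then (n : ℝ) else n ^ 3 * ‖(u i : ℂ) - u (p i)‖ ^ 2) := by
  have h1 : Kd n u ≤ ‖(KM n u).det‖ := Complex.re_le_norm _
  refine h1.trans ?_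
  rw [det_forest n p ρ hp]
  refine gram_det _ _ fun i => ?_
  by_cases h : p i = i
  · simp only [HM, h, Matrix.of_apply, if_true, norm_pow, Circle.norm_coe, one_pow]; simp
  · simp only [HM, h, Matrix.of_apply, if_false]
    have h2 : ∀ k ∈ (Finset.univ : Finset (Fin n)), ‖(u i : ℂ) ^ (k : ℕ) - (u (p i) : ℂ) ^ (k : ℕ)‖ ^ 2 ≤
        n ^ 2 * ‖(u i : ℂ) - u (p i)‖ ^ 2 := by
      intro k _
      rw [← mul_pow]
      gcongr
      refine (norm_pow_sub _ _ _).trans ?_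
      gcongr
      exact k.2.le
    refine (Finset.sum_le_sum h2).trans ?_
    rw [Finset.sum_const, Finset.card_univ, Fintype.card_fin, nsmul_eq_mul]
    apply le_of_eq; ring

/-- parent-quotient homomorphism -/
noncomputable def phiHom (p : ι → ι) : (ι → Circle) →* (ι → Circle) where
  toFun u := fun i => if p i = i then u i else u i / u (p i)
  map_one' := by funext i; simp
  map_mul' u v := by
    funext i
    simp only [Pi.mul_apply]
    split_ifs
    · rfl
    · exact mul_div_mul_comm _ _ _ _

theorem phi_surj (p : ι → ι) (ρ : ι → ℕ) (hp : ∀ i, p i ≠ i → ρ (p i) < ρ i) :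
    Function.Surjective (phiHom p) := by
  intro v
  have key : ∀ N : ℕ, ∃ u : ι → Circle, ∀ i, ρ i < N → u i = if p i = i then v i else v i * u (p i) := by
    intro N
    induction N with
    | zero => exact ⟨1, fun i h => absurd h (by omega)⟩
    | succ N ih =>
      obtain ⟨u, hu⟩ := ih
      refine ⟨fun i => if p i = i then v i else v i * u (p i), fun i hi => ?_⟩
      by_cases h : p i = i
      · simp [h]
      · simp only [h, if_false]
        congr 1
        exact hu (p i) (by have := hp i h; omega)
  obtain ⟨u, hu⟩ := key (Finset.univ.sup ρ + 1)
  refine ⟨u, ?_⟩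
  funext i
  have := hu i (Nat.lt_succ_of_le (Finset.le_sup (Finset.mem_univ i)))
  simp only [phiHom, MonoidHom.coe_mk, OneHom.coe_mk]
  split_ifs with h
  · rw [this, if_pos h]
  · rw [this, if_neg h]; simp

/-- small arc -/
def DD (r : ℝ) : Set Circle := {v | ‖(v : ℂ) - 1‖ ≤ r}

theorem meas_DD (r : ℝ) : MeasurableSet (DD r) := by
  refine (isClosed_le ?_ continuous_const).measurableSet
  fun_prop

theorem norm_div_sub_one (x y : Circle) : ‖((x / y : Circle) : ℂ) - 1‖ = ‖(x : ℂ) - y‖ := by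
  have : ((x / y : Circle) : ℂ) - 1 = ((x : ℂ) - y) / y := by
    rw [Circle.coe_div, sub_div, div_self (Circle.coe_ne_zero y)]
  rw [this, norm_div, Circle.norm_coe, div_one]

/-- event that all points are close to their parents -/
def SS (p : ι → ι) (r : ℝ) : Set (ι → Circle) := {u | ∀ i, p i ≠ i → ‖(u i : ℂ) - u (p i)‖ ≤ r}

theorem meas_SS (p : ι → ι) (r : ℝ) : MeasurableSet (SS p r) := by
  have : SS p r = ⋂ i, ⋂ _ : p i ≠ i, {u : ι → Circle | ‖(u i : ℂ) - u (p i)‖ ≤ r} := by ext; simp [SS]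
  rw [this]
  refine MeasurableSet.iInter fun i => MeasurableSet.iInter fun _ => (isClosed_le ?_ continuous_const).measurableSet
  fun_prop

theorem mT_SS (p : ι → ι) (ρ : ι → ℕ) (hp : ∀ i, p i ≠ i → ρ (p i) < ρ i) (r : ℝ) :
    mT ι (SS p r) = ∏ i, (if p i = i then 1 else mC (DD r)) := by
  have hc : Continuous (phiHom p) := by
    refine continuous_pi fun i => ?_
    simp only [phiHom, MonoidHom.coe_mk, OneHom.coe_mk]
    split_ifs
    · exact continuous_apply i
    · exact (continuous_apply i).div' (continuous_apply (p i))
  have hmp := mp_hom (mT ι) (mT ι) (phiHom p) hc (phi_surj p ρ hp)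
  have h1 : SS p r = phiHom p ⁻¹' (Set.pi Set.univ fun i => if p i = i then Set.univ else DD r) := by
    ext u
    simp only [SS, Set.mem_ofPred_eq, Set.mem_preimage, Set.mem_pi, Set.mem_univ, true_implies]
    refine forall_congr' fun i => ?_
    by_cases h : p i = i
    · simp [h]
    · simp only [h, phiHom, MonoidHom.coe_mk, OneHom.coe_mk, if_false, DD, Set.mem_ofPred_eq, norm_div_sub_one]
      simp [h]
  rw [h1, hmp.measure_preimage]
  · rw [mT, Measure.pi_pi]
    refine Finset.prod_congr rfl fun i _ => ?_
    split_ifs <;> simp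
  · refine (MeasurableSet.univ_pi fun i => ?_).nullMeasurableSet
    split_ifs
    · exact MeasurableSet.univ
    · exact meas_DD r

theorem forest_bound (n : ℕ) (p : ι → ι) (ρ : ι → ℕ) (hp : ∀ i, p i ≠ i → ρ (p i) < ρ i) (r : ℝ) :
    ∫⁻ u, (SS p r).indicator 1 u * ENNReal.ofReal (Kd n u) ∂(mT ι) ≤
      ENNReal.ofReal ((Fintype.card ι).factorial) *
        ∏ i, (if p i = i then (n : ENNReal) else ENNReal.ofReal (n ^ 3 * r ^ 2) * mC (DD r)) := by
  have h1 : ∀ u, (SS p r).indicator 1 u * ENNReal.ofReal (Kd n u) ≤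
      (SS p r).indicator (fun _ => ENNReal.ofReal ((Fintype.card ι).factorial) *
        ∏ i, (if p i = i then (n : ENNReal) else ENNReal.ofReal (n ^ 3 * r ^ 2))) u := by
    intro u
    by_cases hu : u ∈ SS p r
    · rw [Set.indicator_of_mem hu, Set.indicator_of_mem hu, Pi.one_apply, one_mul]
      have h2 : ∏ i, (if p i = i then (n : ENNReal) else ENNReal.ofReal (n ^ 3 * r ^ 2)) =
          ENNReal.ofReal (∏ i, (if p i = i then (n : ℝ) else n ^ 3 * r ^ 2)) := by
        rw [ENNReal.ofReal_prod_of_nonneg]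
        · refine Finset.prod_congr rfl fun i _ => ?_
          split_ifs <;> simp
        · intro i _; split_ifs <;> positivity
      rw [h2, ← ENNReal.ofReal_mul (by positivity)]
      refine ENNReal.ofReal_le_ofReal ((Kd_forest n p ρ hp u).trans ?_)
      refine mul_le_mul_of_nonneg_left (Finset.prod_le_prod ?_ ?_) (by positivity)
      · intro i _; split_ifs <;> positivity
      · intro i _
        split_ifs with h
        · exact le_rfl
        · gcongr
          exact hu i h
    · rw [Set.indicator_of_notMem hu, Set.indicator_of_notMem hu, zero_mul]
  refine (lintegral_mono h1).trans ?_
  rw [lintegral_indicator_const (meas_SS p r), mT_SS p ρ hp, mul_assoc, ← Finset.prod_mul_distrib]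
  refine le_of_eq ?_
  congr 1
  refine Finset.prod_congr rfl fun i _ => ?_
  split_ifs <;> simp

end forest

theorem norm_exp_sub_one (t : ℝ) : ‖(Circle.exp t : ℂ) - 1‖ = 2 * |Real.sin (t / 2)| := by
  rw [Circle.coe_exp, mul_comm, Complex.norm_exp_I_mul_ofReal_sub_one, norm_mul]
  simp

theorem DD_iff {t τ : ℝ} (ht : t ∈ Set.Icc (-π) π) (hτ : τ ∈ Set.Icc 0 π) :
    Circle.exp t ∈ DD (2 * Real.sin (τ / 2)) ↔ |t| ≤ τ := by
  rw [DD, Set.mem_ofPred_eq, norm_exp_sub_one]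
  have h1 : |Real.sin (t / 2)| = Real.sin (|t| / 2) := by
    rcases le_total 0 t with h | h
    · rw [abs_of_nonneg h, abs_of_nonneg]
      exact Real.sin_nonneg_of_nonneg_of_le_pi (by linarith) (by linarith [ht.2, Real.pi_pos])
    · rw [abs_of_nonpos h, abs_of_nonpos, neg_div, Real.sin_neg]
      exact Real.sin_nonpos_of_nonpos_of_neg_pi_le (by linarith) (by linarith [ht.1, Real.pi_pos])
  have ht' : |t| ≤ π := abs_le.2 ht
  rw [h1, mul_le_mul_iff_right₀ (by norm_num : (0 : ℝ) < 2)]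
  rw [Real.strictMonoOn_sin.le_iff_le]
  · constructor <;> intro h <;> linarith
  · constructor <;> linarith [abs_nonneg t, Real.pi_pos]
  · constructor <;> linarith [hτ.1, hτ.2, Real.pi_pos]

/-- integrals over a small arc -/
theorem lintegral_DD (f : Circle → ENNReal) (hf : Measurable f) {τ : ℝ} (hτ : τ ∈ Set.Ico 0 π) :
    ∫⁻ v, (DD (2 * Real.sin (τ / 2))).indicator f v ∂mC =
      ENNReal.ofReal (1 / (2 * π)) * ∫⁻ t in Set.Icc (-τ) τ, f (Circle.exp t) := by
  rw [lintegral_mC _ (hf.indicator (meas_DD _))]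
  congr 1
  rw [← lintegral_indicator measurableSet_Ioc, ← lintegral_indicator measurableSet_Icc]
  refine lintegral_congr fun t => ?_
  by_cases ht : t ∈ Set.Icc (-τ) τ
  · have ht2 : t ∈ Set.Ioc (-π) π := ⟨by linarith [ht.1, hτ.2], by linarith [ht.2, hτ.2]⟩
    rw [Set.indicator_of_mem ht, Set.indicator_of_mem ht2, Set.indicator_of_mem]
    exact (DD_iff ⟨ht2.1.le, ht2.2⟩ ⟨hτ.1, hτ.2.le⟩).2 (abs_le.2 ht)
  · rw [Set.indicator_of_notMem ht]
    by_cases ht2 : t ∈ Set.Ioc (-π) π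
    · rw [Set.indicator_of_mem ht2, Set.indicator_of_notMem]
      intro h
      exact ht (abs_le.1 ((DD_iff ⟨ht2.1.le, ht2.2⟩ ⟨hτ.1, hτ.2.le⟩).1 h))
    · rw [Set.indicator_of_notMem ht2]

theorem mC_DD {τ : ℝ} (hτ : τ ∈ Set.Ico 0 π) : mC (DD (2 * Real.sin (τ / 2))) = ENNReal.ofReal (τ / π) := by
  have h := lintegral_DD 1 measurable_one hτ
  rw [lintegral_indicator_one (meas_DD _)] at h
  rw [h]
  simp only [Pi.one_apply, lintegral_const, Measure.restrict_apply MeasurableSet.univ, Set.univ_inter, Real.volume_Icc, one_mul]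
  rw [← ENNReal.ofReal_mul (by positivity)]
  congr 1
  field_simp
  ring

end CUE



namespace CUE

theorem prod_lip {ι : Type*} (s : Finset ι) (a b : ι → ℂ) (ha : ∀ i, ‖a i‖ ≤ 1) (hb : ∀ i, ‖b i‖ ≤ 1) (δ : ℝ)
    (h : ∀ i, ‖a i - b i‖ ≤ δ) : ‖∏ i ∈ s, a i - ∏ i ∈ s, b i‖ ≤ s.card * δ := by
  classical
  induction s using Finset.induction_on with
  | empty => simp
  | insert i s hi ih =>
    rw [Finset.prod_insert hi, Finset.prod_insert hi, Finset.card_insert_of_notMem hi]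
    have h1 : a i * ∏ i ∈ s, a i - b i * ∏ i ∈ s, b i = a i * (∏ i ∈ s, a i - ∏ i ∈ s, b i) + (a i - b i) * ∏ i ∈ s, b i := by
      ring
    have h2 : ‖∏ i ∈ s, b i‖ ≤ 1 := by
      rw [norm_prod]; exact Finset.prod_le_one (fun _ _ => norm_nonneg _) fun i _ => hb i
    rw [h1]
    refine (norm_add_le _ _).trans ?_
    rw [norm_mul, norm_mul]
    have h3 := mul_le_mul (ha i) ih (norm_nonneg _) zero_le_one
    have h4 := mul_le_mul (h i) h2 (norm_nonneg _) ((norm_nonneg _).trans (h i))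
    push_cast
    linarith

theorem det_lip {ι : Type*} [Fintype ι] [DecidableEq ι] (A B : Matrix ι ι ℂ) (hA : ∀ i j, ‖A i j‖ ≤ 1)
    (hB : ∀ i j, ‖B i j‖ ≤ 1) (δ : ℝ) (h : ∀ i j, ‖A i j - B i j‖ ≤ δ) :
    ‖A.det - B.det‖ ≤ (Fintype.card ι).factorial * (Fintype.card ι * δ) := by
  rw [Matrix.det_apply', Matrix.det_apply', ← Finset.sum_sub_distrib]
  refine (norm_sum_le _ _).trans ?_
  have h1 : ∀ σ ∈ (Finset.univ : Finset (Equiv.Perm ι)), ‖((Equiv.Perm.sign σ : ℤ) : ℂ) * ∏ i, A (σ i) i -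
      ((Equiv.Perm.sign σ : ℤ) : ℂ) * ∏ i, B (σ i) i‖ ≤ Fintype.card ι * δ := by
    intro σ _
    have hs : ‖((Equiv.Perm.sign σ : ℤ) : ℂ)‖ = 1 := by
      rcases Int.units_eq_one_or (Equiv.Perm.sign σ) with h | h <;> simp [h]
    rw [← mul_sub, norm_mul, hs, one_mul]
    exact prod_lip Finset.univ _ _ (fun i => hA _ _) (fun i => hB _ _) δ fun i => h _ _
  refine (Finset.sum_le_sum h1).trans ?_
  rw [Finset.sum_const, Finset.card_univ, Fintype.card_perm, nsmul_eq_mul]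

theorem cs_entry {ι κ : Type*} {n : ℕ} (H : Matrix ι (Fin n) ℂ) (G : Matrix κ (Fin n) ℂ) (i : ι) (j : κ) (p q : ℝ)
    (hp : ∑ k, ‖H i k‖ ^ 2 ≤ p) (hq : ∑ k, ‖G j k‖ ^ 2 ≤ q) : ‖(H * G.conjTranspose) i j‖ ≤ √p * √q := by
  rw [Matrix.mul_apply]
  refine (norm_sum_le _ _).trans ?_
  have h1 : ∀ k, ‖H i k * G.conjTranspose k j‖ = ‖H i k‖ * ‖G j k‖ := by
    intro k; rw [norm_mul, Matrix.conjTranspose_apply, norm_star]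
  simp_rw [h1]
  refine (Real.sum_mul_le_sqrt_mul_sqrt _ _ _).trans ?_
  gcongr

theorem gram_lip {ι : Type*} [Fintype ι] [DecidableEq ι] {n : ℕ} (H G : Matrix ι (Fin n) ℂ) (δ : ℝ) (hδ : 0 ≤ δ)
    (hH : ∀ i, ∑ k, ‖H i k‖ ^ 2 ≤ 1) (hG : ∀ i, ∑ k, ‖G i k‖ ^ 2 ≤ 1) (hD : ∀ i, ∑ k, ‖(H - G) i k‖ ^ 2 ≤ δ ^ 2) :
    ‖(H * H.conjTranspose).det - (G * G.conjTranspose).det‖ ≤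
      (Fintype.card ι).factorial * (Fintype.card ι * (2 * δ)) := by
  refine det_lip _ _ (fun i j => ?_) (fun i j => ?_) _ fun i j => ?_
  · simpa using cs_entry H H i j 1 1 (hH i) (hH j)
  · simpa using cs_entry G G i j 1 1 (hG i) (hG j)
  · have h1 : (H * H.conjTranspose) i j - (G * G.conjTranspose) i j = ((H - G) * H.conjTranspose) i j +
        (G * (H - G).conjTranspose) i j := by
      rw [← Matrix.sub_apply, ← Matrix.add_apply, Matrix.conjTranspose_sub, Matrix.sub_mul, Matrix.mul_sub]
      have h0 : H * H.conjTranspose - G * G.conjTranspose = H * H.conjTranspose - G * H.conjTranspose +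
          (G * H.conjTranspose - G * G.conjTranspose) := by abel
      rw [h0]
    rw [h1]
    refine (norm_add_le _ _).trans ?_
    have h2 := cs_entry (H - G) H i j _ 1 (hD i) (hH j)
    have h3 := cs_entry G (H - G) i j 1 _ (hG i) (hD j)
    rw [Real.sqrt_sq hδ, Real.sqrt_one] at h2 h3
    linarith

/-- normalised rows -/
noncomputable def hM (n : ℕ) {k : ℕ} (x v : Fin k → Circle) : Matrix (Fin 2 × Fin k) (Fin n) ℂ :=
  Matrix.of fun i j => (x i.2 : ℂ) ^ (j : ℕ) * (if i.1 = 0 then 1 else (∑ l ∈ Finset.range j, (v i.2 : ℂ) ^ l) / n) / (√n : ℝ)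

theorem norm_geom (v : Circle) (j : ℕ) : ‖∑ l ∈ Finset.range j, (v : ℂ) ^ l‖ ≤ j := by
  refine (norm_sum_le _ _).trans ?_
  simp [norm_pow, Circle.norm_coe]

theorem norm_geom_sub (v : Circle) (j : ℕ) : ‖∑ l ∈ Finset.range j, (v : ℂ) ^ l - j‖ ≤ j * (j * ‖(v : ℂ) - 1‖) := by
  have : (∑ l ∈ Finset.range j, (v : ℂ) ^ l) - j = ∑ l ∈ Finset.range j, ((v : ℂ) ^ l - ((1 : Circle) : ℂ) ^ l) := by simp
  rw [this]
  refine (norm_sum_le _ _).trans ?_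
  have h1 : ∀ l ∈ Finset.range j, ‖(v : ℂ) ^ l - ((1 : Circle) : ℂ) ^ l‖ ≤ j * ‖(v : ℂ) - 1‖ := by
    intro l hl
    refine (norm_pow_sub v 1 l).trans ?_
    rw [Circle.coe_one]
    gcongr
    exact (Finset.mem_range.1 hl).le
  refine (Finset.sum_le_sum h1).trans ?_
  simp

theorem hM_row (n : ℕ) {k : ℕ} (x v : Fin k → Circle) (i : Fin 2 × Fin k) : ∑ j, ‖hM n x v i j‖ ^ 2 ≤ 1 := by
  rcases Nat.eq_zero_or_pos n with rfl | hn
  · simp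
  have hn' : (0 : ℝ) < n := by exact_mod_cast hn
  have h1 : ∀ j ∈ (Finset.univ : Finset (Fin n)), ‖hM n x v i j‖ ^ 2 ≤ 1 / n := by
    intro j _
    simp only [hM, Matrix.of_apply]
    rw [norm_div, norm_mul, norm_pow, Circle.norm_coe, one_pow, one_mul, Complex.norm_real, div_pow, Real.norm_eq_abs, sq_abs,
      Real.sq_sqrt hn'.le]
    gcongr
    refine pow_le_one₀ (norm_nonneg _) ?_
    split_ifs
    · simp
    · rw [norm_div, Complex.norm_natCast]
      refine div_le_one_of_le₀ ((norm_geom _ _).trans ?_) hn'.le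
      exact_mod_cast j.2.le
  refine (Finset.sum_le_sum h1).trans ?_
  rw [Finset.sum_const, Finset.card_univ, Fintype.card_fin, nsmul_eq_mul]
  apply le_of_eq; field_simp

theorem hM_diff (n : ℕ) {k : ℕ} (x v : Fin k → Circle) (r : ℝ) (hv : ∀ a, ‖(v a : ℂ) - 1‖ ≤ r) (i : Fin 2 × Fin k) :
    ∑ j, ‖(hM n x v - hM n x 1) i j‖ ^ 2 ≤ (n * r) ^ 2 := by
  have hr : 0 ≤ r := (norm_nonneg _).trans (hv i.2)
  rcases Nat.eq_zero_or_pos n with rfl | hn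
  · simp
  have hn' : (0 : ℝ) < n := by exact_mod_cast hn
  have h1 : ∀ j ∈ (Finset.univ : Finset (Fin n)), ‖(hM n x v - hM n x 1) i j‖ ^ 2 ≤ (n * r) ^ 2 / n := by
    intro j _
    simp only [hM, Matrix.of_apply, Matrix.sub_apply]
    rw [← sub_div, ← mul_sub, norm_div, norm_mul, norm_pow, Circle.norm_coe, one_pow, one_mul, Complex.norm_real, div_pow, Real.norm_eq_abs, sq_abs,
      Real.sq_sqrt hn'.le]
    gcongr
    split_ifs
    · simp; positivity
    · rw [← sub_div, norm_div, Complex.norm_natCast, div_le_iff₀ hn']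
      have h2 := norm_geom_sub (v i.2) j
      simp only [Pi.one_apply, Circle.coe_one, one_pow, Finset.sum_const, Finset.card_range, nsmul_eq_mul, mul_one]
      refine h2.trans ?_
      have h3 : (j : ℝ) ≤ n := by exact_mod_cast j.2.le
      calc (j : ℝ) * (j * ‖(v i.2 : ℂ) - 1‖) ≤ n * (n * r) := by gcongr; exact hv _
        _ = _ := by ring
  refine (Finset.sum_le_sum h1).trans ?_
  rw [Finset.sum_const, Finset.card_univ, Fintype.card_fin, nsmul_eq_mul]
  apply le_of_eq; field_simp

/-- normalised determinant -/
noncomputable def Gd (n : ℕ) {k : ℕ} (x v : Fin k → Circle) : ℂ := (hM n x v * (hM n x v).conjTranspose).det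

theorem Gd_lip (n : ℕ) {k : ℕ} (x v : Fin k → Circle) (r : ℝ) (hr : 0 ≤ r) (hv : ∀ a, ‖(v a : ℂ) - 1‖ ≤ r) :
    |(Gd n x v).re - (Gd n x 1).re| ≤ (2 * k).factorial * (2 * k * (2 * (n * r))) := by
  have h := gram_lip (hM n x v) (hM n x 1) (n * r) (by positivity) (hM_row n x v) (hM_row n x 1) (hM_diff n x v r hv)
  rw [← Complex.sub_re]
  refine (Complex.abs_re_le_norm _).trans (h.trans ?_)
  simp

theorem Gd_bound (n : ℕ) {k : ℕ} (x v : Fin k → Circle) : (Gd n x v).re ≤ (2 * k).factorial := by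
  refine (Complex.re_le_norm _).trans ((gram_det (hM n x v) 1 (hM_row n x v)).trans ?_)
  simp

theorem abel_bound (q : ℂ) (hq : ‖q‖ = 1) (c : ℕ → ℝ) (hc : Monotone c) (hc0 : 0 ≤ c 0) (n : ℕ) :
    ‖(1 - q) * ∑ j ∈ Finset.range n, (c j : ℂ) * q ^ j + c n * q ^ n‖ ≤ c n := by
  induction n with
  | zero => simp [abs_of_nonneg hc0]
  | succ n ih =>
    rw [Finset.sum_range_succ]
    have : (1 - q) * (∑ j ∈ Finset.range n, (c j : ℂ) * q ^ j + c n * q ^ n) + c (n + 1) * q ^ (n + 1) =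
        ((1 - q) * ∑ j ∈ Finset.range n, (c j : ℂ) * q ^ j + c n * q ^ n) + ((c (n + 1) - c n : ℝ) : ℂ) * q ^ (n + 1) := by
      push_cast; ring
    rw [this]
    refine (norm_add_le _ _).trans ?_
    rw [norm_mul, norm_pow, hq, one_pow, mul_one, Complex.norm_real, Real.norm_eq_abs,
      abs_of_nonneg (sub_nonneg.2 (hc (Nat.le_succ n)))]
    linarith

theorem osc_lim (q : ℂ) (hq : ‖q‖ = 1) (hq1 : q ≠ 1) (m : ℕ) :
    Tendsto (fun n : ℕ => (∑ j ∈ Finset.range n, (j : ℂ) ^ m * q ^ j) / (n : ℂ) ^ (m + 1)) atTop (𝓝 0) := by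
  have hq2 : 0 < ‖1 - q‖ := norm_pos_iff.2 (sub_ne_zero.2 (Ne.symm hq1))
  refine squeeze_zero_norm (a := fun n : ℕ => 2 / ‖1 - q‖ * (1 / (n : ℝ))) ?_ ?_
  · intro n
    rcases Nat.eq_zero_or_pos n with rfl | hn
    · simp
    have hn' : (0 : ℝ) < n := by exact_mod_cast hn
    have h := abel_bound q hq (fun j => (j : ℝ) ^ m) (fun a b hab => by
      have : (a : ℝ) ≤ b := by exact_mod_cast hab
      dsimp only
      gcongr) (by positivity) n
    have h2 : ‖(1 - q) * ∑ j ∈ Finset.range n, (j : ℂ) ^ m * q ^ j‖ ≤ 2 * (n : ℝ) ^ m := by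
      have h3 := norm_sub_le ((1 - q) * ∑ j ∈ Finset.range n, (((j : ℝ) ^ m : ℝ) : ℂ) * q ^ j + (((n : ℝ) ^ m : ℝ) : ℂ) * q ^ n)
        ((((n : ℝ) ^ m : ℝ) : ℂ) * q ^ n)
      rw [add_sub_cancel_right, norm_mul (((n : ℝ) ^ m : ℝ) : ℂ), norm_pow q, hq, one_pow, mul_one, Complex.norm_real, Real.norm_eq_abs,
        abs_of_nonneg (by positivity : (0 : ℝ) ≤ (n : ℝ) ^ m)] at h3
      push_cast at h3 h ⊢
      linarith
    rw [norm_mul] at h2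
    rw [norm_div, norm_pow, Complex.norm_natCast, div_le_iff₀ (by positivity)]
    have h4 : 2 / ‖1 - q‖ * (1 / (n : ℝ)) * (n : ℝ) ^ (m + 1) = 2 * (n : ℝ) ^ m / ‖1 - q‖ := by
      field_simp
      ring
    rw [h4, le_div_iff₀ hq2]
    linarith
  · have := (tendsto_one_div_atTop_nhds_zero_nat (𝕜 := ℝ)).const_mul (2 / ‖1 - q‖)
    simpa using this

theorem pow_lim (m : ℕ) (hm : m ≤ 2) :
    Tendsto (fun n : ℕ => (∑ j ∈ Finset.range n, (j : ℂ) ^ m) / (n : ℂ) ^ (m + 1)) atTop (𝓝 (1 / (m + 1))) := by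
  have h0 : Tendsto (fun n : ℕ => 1 / (n : ℂ)) atTop (𝓝 0) := tendsto_one_div_atTop_nhds_zero_nat
  interval_cases m
  · refine Tendsto.congr' ?_ (tendsto_const_nhds (x := 1)) |>.trans (by simp)
    filter_upwards [eventually_gt_atTop 0] with n hn
    have : (n : ℂ) ≠ 0 := by exact_mod_cast hn.ne'
    simp [this]
  · have h : ∀ n : ℕ, ∑ j ∈ Finset.range n, (j : ℂ) ^ 1 = n * (n - 1) / 2 := by
      intro n
      induction n with
      | zero => simp
      | succ n ih => rw [Finset.sum_range_succ, ih]; push_cast; ring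
    have h1 : Tendsto (fun n : ℕ => (1 - 1 / (n : ℂ)) / 2) atTop (𝓝 ((1 - 0) / 2)) := (tendsto_const_nhds.sub h0).div_const 2
    have h2 : (1 : ℂ) / (((1 : ℕ) : ℂ) + 1) = (1 - 0) / 2 := by norm_num
    rw [h2]
    refine h1.congr' ?_
    filter_upwards [eventually_gt_atTop 0] with n hn
    have : (n : ℂ) ≠ 0 := by exact_mod_cast hn.ne'
    rw [h]; field_simp; ring
  · have h : ∀ n : ℕ, ∑ j ∈ Finset.range n, (j : ℂ) ^ 2 = n * (n - 1) * (2 * n - 1) / 6 := by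
      intro n
      induction n with
      | zero => simp
      | succ n ih => rw [Finset.sum_range_succ, ih]; push_cast; ring
    have h1 : Tendsto (fun n : ℕ => (1 - 1 / (n : ℂ)) * (2 - 1 / (n : ℂ)) / 6) atTop (𝓝 ((1 - 0) * (2 - 0) / 6)) :=
      ((tendsto_const_nhds.sub h0).mul (tendsto_const_nhds.sub h0)).div_const 6
    have h2 : (1 : ℂ) / (((2 : ℕ) : ℂ) + 1) = (1 - 0) * (2 - 0) / 6 := by norm_num
    rw [h2]
    refine h1.congr' ?_
    filter_upwards [eventually_gt_atTop 0] with n hn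
    have : (n : ℂ) ≠ 0 := by exact_mod_cast hn.ne'
    rw [h]; field_simp; ring

theorem gram_one (n : ℕ) {k : ℕ} (x : Fin k → Circle) (i j : Fin 2 × Fin k) :
    (hM n x 1 * (hM n x 1).conjTranspose) i j =
      (∑ l ∈ Finset.range n, (l : ℂ) ^ ((i.1 : ℕ) + (j.1 : ℕ)) * ((x i.2 : ℂ) / x j.2) ^ l) / (n : ℂ) ^ ((i.1 : ℕ) + (j.1 : ℕ) + 1) := by
  rw [Matrix.mul_apply, ← Fin.sum_univ_eq_sum_range (fun l => (l : ℂ) ^ ((i.1 : ℕ) + (j.1 : ℕ)) * ((x i.2 : ℂ) / x j.2) ^ l), Finset.sum_div]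
  refine Finset.sum_congr rfl fun l _ => ?_
  have hn : (n : ℂ) ≠ 0 := by
    have := l.2
    exact_mod_cast (by omega : n ≠ 0)
  have hsq : ((√n : ℝ) : ℂ) * ((√n : ℝ) : ℂ) = n := by
    rw [← Complex.ofReal_mul, Real.mul_self_sqrt (Nat.cast_nonneg n)]; simp
  have hs : ((√n : ℝ) : ℂ) ≠ 0 := by
    intro h; rw [h] at hsq; simp at hsq; exact hn (by exact_mod_cast hsq.symm)
  have key : ∀ s : Fin 2, (if s = 0 then 1 else (∑ l ∈ Finset.range l, (((1 : Fin k → Circle) i.2 : Circle) : ℂ) ^ l) / n) = (l : ℂ) ^ (s : ℕ) / n ^ (s : ℕ) := by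
    intro s; fin_cases s <;> simp
  have key2 : ∀ s : Fin 2, (if s = 0 then 1 else (∑ l ∈ Finset.range l, (((1 : Fin k → Circle) j.2 : Circle) : ℂ) ^ l) / n) = (l : ℂ) ^ (s : ℕ) / n ^ (s : ℕ) := by
    intro s; fin_cases s <;> simp
  simp only [Matrix.conjTranspose_apply, hM, Matrix.of_apply]
  rw [key, key2, ← starRingEnd_apply, map_div₀, map_mul, map_pow, conj_coe, Complex.conj_ofReal, map_div₀, map_pow, map_pow,
    Complex.conj_natCast, Complex.conj_natCast, div_pow, pow_succ, ← hsq]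
  have hx := Circle.coe_ne_zero (x j.2)
  rw [inv_pow, pow_add, pow_add]
  field_simp

theorem Gd_lim {k : ℕ} (x : Fin k → Circle) (hx : Function.Injective x) :
    Tendsto (fun n : ℕ => (Gd n x 1).re) atTop (𝓝 ((1 / 12) ^ k)) := by
  have h1 : Tendsto (fun n : ℕ => hM n x 1 * (hM n x 1).conjTranspose) atTop
      (𝓝 (Matrix.blockDiagonal fun _ : Fin k => !![(1 : ℂ), 1 / 2; 1 / 2, 1 / 3])) := by
    refine tendsto_pi_nhds.2 fun i => tendsto_pi_nhds.2 fun j => ?_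
    obtain ⟨s, a⟩ := i
    obtain ⟨t, b⟩ := j
    simp_rw [gram_one, Matrix.blockDiagonal_apply]
    by_cases hab : a = b
    · subst hab
      simp only [if_true, div_self (Circle.coe_ne_zero _), one_pow, mul_one]
      have := pow_lim ((s : ℕ) + t) (by omega)
      refine this.trans (le_of_eq ?_)
      congr 1
      fin_cases s <;> fin_cases t <;> norm_num
    · simp only [hab, if_false]
      refine osc_lim _ (by simp [Circle.norm_coe]) ?_ _
      intro h
      rw [div_eq_one_iff_eq (Circle.coe_ne_zero _)] at h
      exact hab (hx (Circle.ext h))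
  have h2 : Tendsto (fun n : ℕ => Gd n x 1) atTop
      (𝓝 ((Matrix.blockDiagonal fun _ : Fin k => !![(1 : ℂ), 1 / 2; 1 / 2, 1 / 3]).det)) :=
    ((Continuous.matrix_det continuous_id).tendsto _).comp h1
  have h3 : (Matrix.blockDiagonal fun _ : Fin k => !![(1 : ℂ), 1 / 2; 1 / 2, 1 / 3]).det = (((1 / 12) ^ k : ℝ) : ℂ) := by
    rw [Matrix.det_blockDiagonal]
    simp only [Matrix.det_fin_two_of, Finset.prod_const, Finset.card_univ, Fintype.card_fin]
    push_cast
    norm_num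
  rw [h3] at h2
  have := (Complex.continuous_re.tendsto _).comp h2
  rw [Complex.ofReal_re] at this
  exact this

end CUE



namespace CUE

theorem lintegral_prod_pow (f : Circle → ENNReal) (hf : Measurable f) (k : ℕ) :
    ∫⁻ v, ∏ a, f (v a) ∂(mT (Fin k)) = (∫⁻ x, f x ∂mC) ^ k := by
  induction k with
  | zero => simp
  | succ k ih =>
    have hmp := (measurePreserving_piFinSuccAbove (fun _ : Fin (k + 1) => mC) 0).symm
    have hm : ∀ m, Measurable fun v : Fin m → Circle => ∏ a, f (v a) := fun m =>
      Finset.measurable_prod _ fun a _ => hf.comp (measurable_pi_apply a)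
    have h1 := hmp.lintegral_comp (hm (k + 1))
    rw [mT, ← h1]
    have h2 : ∀ z : Circle × (Fin k → Circle), ∏ a, f ((MeasurableEquiv.piFinSuccAbove (fun _ : Fin (k + 1) => Circle) 0).symm z a) =
        f z.1 * ∏ a, f (z.2 a) := by
      intro z
      rw [Fin.prod_univ_succ]
      simp [MeasurableEquiv.piFinSuccAbove, Fin.insertNthEquiv]
    simp_rw [h2]
    rw [lintegral_prod_mul hf.aemeasurable (hm k).aemeasurable]
    have h3 : ∫⁻ v, ∏ a, f (v a) ∂(Measure.pi fun _ : Fin k => mC) = (∫⁻ x, f x ∂mC) ^ k := ih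
    rw [pow_succ', ← h3]

theorem ae_inj (k : ℕ) : ∀ᵐ x ∂(mT (Fin k)), Function.Injective x := by
  have h1 : ∀ a b : Fin k, a ≠ b → ∀ᵐ x ∂(mT (Fin k)), x a ≠ x b := by
    intro a b hab
    have h2 : mT (Fin k) (SS (Function.update id a b) 0) = 0 := by
      rw [mT_SS _ (fun i => if i = a then 1 else 0)]
      · refine Finset.prod_eq_zero (Finset.mem_univ a) ?_
        rw [if_neg (by simp [Ne.symm hab])]
        have := mC_DD (τ := 0) ⟨le_rfl, Real.pi_pos⟩
        simpa using this
      · intro i hi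
        by_cases h : i = a
        · subst h; simp [Ne.symm hab]
        · simp [h] at hi
    rw [ae_iff]
    refine measure_mono_null ?_ h2
    intro x hx i hi
    have hx : x a = x b := by simpa using hx
    by_cases h : i = a
    · subst h; simp [hx]
    · simp [h] at hi
  have h2 : ∀ᵐ x ∂(mT (Fin k)), ∀ a b : Fin k, a ≠ b → x a ≠ x b := by
    rw [ae_all_iff]; intro a
    rw [ae_all_iff]; intro b
    by_cases h : a = b
    · simp [h]
    · filter_upwards [h1 a b h] with x hx _ using hx
  filter_upwards [h2] with x hx a b hab
  by_contra h
  exact hx a b h hab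

theorem cont_hM (n k : ℕ) : Continuous fun z : (Fin k → Circle) × (Fin k → Circle) => hM n z.1 z.2 := by
  refine continuous_matrix fun i j => ?_
  simp only [hM, Matrix.of_apply]
  split_ifs
  · fun_prop
  · refine Continuous.div_const (Continuous.mul (by fun_prop) (Continuous.div_const (continuous_finsetSum _ fun l _ => by fun_prop) _)) _

theorem cont_Gd (n k : ℕ) : Continuous fun z : (Fin k → Circle) × (Fin k → Circle) => (Gd n z.1 z.2).re :=
  Complex.continuous_re.comp (Continuous.matrix_det ((cont_hM n k).matrix_mul (cont_hM n k).matrix_conjTranspose))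

theorem cont_Gdv (n k : ℕ) (v : Fin k → Circle) : Continuous fun x : Fin k → Circle => (Gd n x v).re := by
  have h : Continuous fun x : Fin k → Circle => hM n x v := by
    refine continuous_matrix fun i j => ?_
    simp only [hM, Matrix.of_apply]
    split_ifs <;> fun_prop
  exact Complex.continuous_re.comp (Continuous.matrix_det (h.matrix_mul h.matrix_conjTranspose))

theorem cont_Gd1 (n k : ℕ) : Continuous fun x : Fin k → Circle => (Gd n x 1).re := cont_Gdv n k 1

theorem lim_I (k : ℕ) : Tendsto (fun n : ℕ => ∫⁻ x, ENNReal.ofReal (Gd n x 1).re ∂(mT (Fin k))) atTop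
    (𝓝 (ENNReal.ofReal ((1 / 12) ^ k))) := by
  have h := tendsto_lintegral_of_dominated_convergence (μ := mT (Fin k))
    (F := fun (n : ℕ) x => ENNReal.ofReal (Gd n x 1).re) (f := fun _ => ENNReal.ofReal ((1 / 12) ^ k))
    (fun _ => ENNReal.ofReal ((2 * k).factorial)) (fun n => (cont_Gd1 n k).measurable.ennreal_ofReal)
    (fun n => Eventually.of_forall fun x => ENNReal.ofReal_le_ofReal (Gd_bound n x 1)) (by simp)
    (by
      filter_upwards [ae_inj k] with x hx
      exact (ENNReal.continuous_ofReal.tendsto _).comp (Gd_lim x hx))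
  simpa using h

/-- pairing parent map -/
def pk (k : ℕ) (i : Fin 2 × Fin k) : Fin 2 × Fin k := (0, i.2)

theorem pk_rho (k : ℕ) : ∀ i : Fin 2 × Fin k, pk k i ≠ i → ((pk k i).1 : ℕ) < (i.1 : ℕ) := by
  rintro ⟨s, a⟩ h
  fin_cases s
  · simp [pk] at h
  · simp [pk]

/-- parametrisation of pairs -/
noncomputable def Psi (k : ℕ) : (Fin k → Circle) × (Fin k → Circle) →* (Fin 2 × Fin k → Circle) where
  toFun z := fun i => if i.1 = 0 then z.1 i.2 else z.1 i.2 * z.2 i.2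
  map_one' := by funext i; simp
  map_mul' u v := by
    funext i
    simp only [Pi.mul_apply, Prod.fst_mul, Prod.snd_mul]
    split_ifs
    · rfl
    · exact mul_mul_mul_comm _ _ _ _

theorem Psi_apply (k : ℕ) (z) (i : Fin 2 × Fin k) : Psi k z i = if i.1 = 0 then z.1 i.2 else z.1 i.2 * z.2 i.2 := rfl

theorem mp_Psi (k : ℕ) : MeasurePreserving (Psi k) ((mT (Fin k)).prod (mT (Fin k))) (mT (Fin 2 × Fin k)) := by
  refine mp_hom _ _ _ ?_ ?_
  · refine continuous_pi fun i => ?_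
    simp only [Psi_apply]
    split_ifs <;> fun_prop
  · intro u
    refine ⟨(fun a => u (0, a), fun a => u (1, a) / u (0, a)), ?_⟩
    funext ⟨s, a⟩
    rw [Psi_apply]
    fin_cases s <;> simp

theorem HM_Psi (n k : ℕ) (hn : 0 < n) (x v : Fin k → Circle) : HM n (pk k) (Psi k (x, v)) =
    Matrix.diagonal (fun i : Fin 2 × Fin k => if i.1 = 0 then ((√n : ℝ) : ℂ) else ((v i.2 : ℂ) - 1) * n * ((√n : ℝ) : ℂ)) * hM n x v := by
  have hn' : (n : ℂ) ≠ 0 := by exact_mod_cast hn.ne'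
  have hs : ((√n : ℝ) : ℂ) ≠ 0 := by
    rw [Ne, Complex.ofReal_eq_zero, Real.sqrt_eq_zero (Nat.cast_nonneg _)]; exact_mod_cast hn.ne'
  ext ⟨s, a⟩ j
  rw [Matrix.diagonal_mul]
  simp only [HM, hM, Matrix.of_apply, Psi_apply, pk]
  fin_cases s
  · simp; field_simp
  · have h := mul_geom_sum (v a : ℂ) j
    simp [mul_pow]
    field_simp
    exact h.symm

theorem Kd_Psi (n k : ℕ) (hn : 0 < n) (x v : Fin k → Circle) : Kd n (Psi k (x, v)) =
    (∏ a, (n : ℝ) ^ 4 * ‖(v a : ℂ) - 1‖ ^ 2) * (Gd n x v).re := by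
  rw [Kd, det_forest n (pk k) (fun i => i.1) (pk_rho k), HM_Psi n k hn, Matrix.conjTranspose_mul, Matrix.mul_assoc,
    ← Matrix.mul_assoc (hM n x v), Matrix.det_mul, Matrix.det_mul, Matrix.det_conjTranspose, Matrix.det_diagonal, ← Gd]
  set c : ℂ := ∏ i : Fin 2 × Fin k, (if i.1 = 0 then ((√n : ℝ) : ℂ) else ((v i.2 : ℂ) - 1) * n * ((√n : ℝ) : ℂ)) with hc
  have h1 : c * (Gd n x v * star c) = ((‖c‖ ^ 2 : ℝ) : ℂ) * Gd n x v := by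
    rw [← starRingEnd_apply, mul_comm (Gd n x v), ← mul_assoc, Complex.mul_conj, Complex.normSq_eq_norm_sq]
  rw [h1, Complex.re_ofReal_mul]
  congr 1
  rw [hc, Fintype.prod_prod_type, Fin.prod_univ_two, ← Finset.prod_mul_distrib, norm_prod, ← Finset.prod_pow]
  refine Finset.prod_congr rfl fun a _ => ?_
  have hsq : ((√n : ℝ) : ℂ) * ((√n : ℝ) : ℂ) = n := by
    rw [← Complex.ofReal_mul, Real.mul_self_sqrt (Nat.cast_nonneg n)]; simp
  have h2 : (if (0 : Fin 2) = 0 then ((√n : ℝ) : ℂ) else ((v a : ℂ) - 1) * n * ((√n : ℝ) : ℂ)) *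
      (if (1 : Fin 2) = 0 then ((√n : ℝ) : ℂ) else ((v a : ℂ) - 1) * n * ((√n : ℝ) : ℂ)) = (n : ℂ) ^ 2 * ((v a : ℂ) - 1) := by
    simp only [if_true, one_ne_zero, if_false]
    linear_combination ((v a : ℂ) - 1) * n * hsq
  simp only at h2 ⊢
  rw [h2, norm_mul, norm_pow, Complex.norm_natCast]
  ring

/-- weight -/
noncomputable def ww (n : ℕ) (r : ℝ) : Circle → ENNReal :=
  (DD r).indicator fun v => ENNReal.ofReal ((n : ℝ) ^ 4 * ‖(v : ℂ) - 1‖ ^ 2)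

theorem meas_ww0 (n : ℕ) : Measurable fun v : Circle => ENNReal.ofReal ((n : ℝ) ^ 4 * ‖(v : ℂ) - 1‖ ^ 2) := by
  refine Measurable.ennreal_ofReal (Continuous.measurable ?_)
  fun_prop

theorem meas_ww (n : ℕ) (r : ℝ) : Measurable (ww n r) := (meas_ww0 n).indicator (meas_DD r)

/-- pair moments -/
noncomputable def mom (n k : ℕ) (r : ℝ) : ENNReal :=
  ∫⁻ u, (SS (pk k) r).indicator 1 u * ENNReal.ofReal (Kd n u) ∂(mT (Fin 2 × Fin k))

theorem SS_Psi (k : ℕ) (r : ℝ) (x v : Fin k → Circle) : Psi k (x, v) ∈ SS (pk k) r ↔ ∀ a, v a ∈ DD r := by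
  simp only [SS, DD, Set.mem_ofPred_eq]
  have h : ∀ a, ‖((x a * v a : Circle) : ℂ) - x a‖ = ‖(v a : ℂ) - 1‖ := by
    intro a
    rw [← norm_div_sub_one, mul_div_cancel_left]
  constructor
  · intro hh a
    have := hh (1, a) (by simp [pk])
    simpa [Psi_apply, pk, ← h] using this
  · rintro hh ⟨s, a⟩ hi
    fin_cases s
    · simp [pk] at hi
    · simpa [Psi_apply, pk, ← h] using hh a

theorem mom_eq (n k : ℕ) (hn : 0 < n) (r : ℝ) : mom n k r =
    ∫⁻ z, ENNReal.ofReal (Gd n z.1 z.2).re * ∏ a, ww n r (z.2 a) ∂((mT (Fin k)).prod (mT (Fin k))) := by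
  have hm : Measurable fun u => (SS (pk k) r).indicator 1 u * ENNReal.ofReal (Kd n u) :=
    (measurable_one.indicator (meas_SS _ r)).mul (cont_Kd n).measurable.ennreal_ofReal
  rw [mom, ← (mp_Psi k).lintegral_comp hm]
  refine lintegral_congr fun z => ?_
  obtain ⟨x, v⟩ := z
  by_cases h : ∀ a, v a ∈ DD r
  · rw [Set.indicator_of_mem ((SS_Psi k r x v).2 h), Pi.one_apply, one_mul, Kd_Psi n k hn, mul_comm]
    have h1 : ∀ a, ww n r (v a) = ENNReal.ofReal ((n : ℝ) ^ 4 * ‖(v a : ℂ) - 1‖ ^ 2) := fun a =>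
      Set.indicator_of_mem (h a) _
    simp_rw [h1]
    rw [mul_comm, ENNReal.ofReal_mul (Finset.prod_nonneg fun a _ => by positivity), mul_comm,
      ENNReal.ofReal_prod_of_nonneg fun a _ => by positivity]
  · rw [Set.indicator_of_notMem (fun hh => h ((SS_Psi k r x v).1 hh)), zero_mul]
    push Not at h
    obtain ⟨a, ha⟩ := h
    rw [Finset.prod_eq_zero (Finset.mem_univ a) (Set.indicator_of_notMem ha _), mul_zero]

theorem meas_prodww (n k : ℕ) (r : ℝ) : Measurable fun v : Fin k → Circle => ∏ a, ww n r (v a) :=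
  Finset.measurable_prod _ fun a _ => (meas_ww n r).comp (measurable_pi_apply a)

theorem mom_sandwich (n k : ℕ) (hn : 0 < n) (r : ℝ) (hr : 0 ≤ r) :
    let A := (∫⁻ v, ww n r v ∂mC) ^ k
    let I := ∫⁻ x, ENNReal.ofReal (Gd n x 1).re ∂(mT (Fin k))
    let ε := ENNReal.ofReal ((2 * k).factorial * (2 * k * (2 * (n * r))))
    mom n k r ≤ (I + ε) * A ∧ I * A ≤ mom n k r + ε * A := by
  intro A I ε
  have hG : Measurable fun x : Fin k → Circle => ENNReal.ofReal (Gd n x 1).re := (cont_Gd1 n k).measurable.ennreal_ofReal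
  have hA : ∫⁻ v, ∏ a, ww n r (v a) ∂(mT (Fin k)) = A := lintegral_prod_pow _ (meas_ww n r) k
  have hw := meas_prodww n k r
  have hfin : ∀ (c : ENNReal), ∫⁻ z : (Fin k → Circle) × (Fin k → Circle), c * ∏ a, ww n r (z.2 a) ∂((mT (Fin k)).prod (mT (Fin k))) = c * A := by
    intro c
    rw [lintegral_prod_mul (f := fun _ => c) (g := fun v : Fin k → Circle => ∏ a, ww n r (v a)) aemeasurable_const hw.aemeasurable, hA]
    simp
  have hI : ∫⁻ z : (Fin k → Circle) × (Fin k → Circle), ENNReal.ofReal (Gd n z.1 1).re * ∏ a, ww n r (z.2 a) ∂((mT (Fin k)).prod (mT (Fin k))) = I * A := by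
    rw [lintegral_prod_mul (f := fun x : Fin k → Circle => ENNReal.ofReal (Gd n x 1).re) (g := fun v : Fin k → Circle => ∏ a, ww n r (v a)) hG.aemeasurable hw.aemeasurable, hA]
  have hmw : Measurable fun z : (Fin k → Circle) × (Fin k → Circle) => ∏ a, ww n r (z.2 a) := hw.comp measurable_snd
  have hmε : Measurable fun z : (Fin k → Circle) × (Fin k → Circle) => ε * ∏ a, ww n r (z.2 a) := measurable_const.mul hmw
  have hz : ∀ z : (Fin k → Circle) × (Fin k → Circle), (∀ a, z.2 a ∈ DD r) ∨ ∏ a, ww n r (z.2 a) = 0 := by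
    intro z
    by_cases h : ∀ a, z.2 a ∈ DD r
    · exact Or.inl h
    · right
      push Not at h
      obtain ⟨a, ha⟩ := h
      exact Finset.prod_eq_zero (Finset.mem_univ a) (Set.indicator_of_notMem ha _)
  constructor
  · rw [mom_eq n k hn, add_mul, ← hI, ← hfin ε, ← lintegral_add_right _ hmε]
    refine lintegral_mono fun z => ?_
    rcases hz z with h | h
    · dsimp only
      rw [← add_mul]
      gcongr
      refine (ENNReal.ofReal_le_ofReal (q := (Gd n z.1 1).re + (2 * k).factorial * (2 * k * (2 * (n * r)))) ?_).trans ENNReal.ofReal_add_le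
      have := abs_le.1 (Gd_lip n z.1 z.2 r hr h)
      linarith [this.2]
    · simp [h]
  · rw [mom_eq n k hn, ← hI, ← hfin ε, ← lintegral_add_right _ hmε]
    refine lintegral_mono fun z => ?_
    rcases hz z with h | h
    · dsimp only
      rw [← add_mul]
      gcongr
      refine (ENNReal.ofReal_le_ofReal (q := (Gd n z.1 z.2).re + (2 * k).factorial * (2 * k * (2 * (n * r)))) ?_).trans ENNReal.ofReal_add_le
      have := abs_le.1 (Gd_lip n z.1 z.2 r hr h)
      linarith [this.1]
    · simp [h]

end CUE



namespace CUE

/-- scaled angle threshold -/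
noncomputable def tau (β : ℝ) (n : ℕ) : ℝ := β / ((n : ℝ) ^ 4 / (72 * π)) ^ ((1 : ℝ) / 3)

/-- scaled chord threshold -/
noncomputable def rr (β : ℝ) (n : ℕ) : ℝ := 2 * Real.sin (tau β n / 2)

theorem cc_cube (n : ℕ) : (((n : ℝ) ^ 4 / (72 * π)) ^ ((1 : ℝ) / 3)) ^ 3 = (n : ℝ) ^ 4 / (72 * π) := by
  rw [← Real.rpow_natCast, ← Real.rpow_mul (by positivity)]
  norm_num

theorem tau_cube (β : ℝ) {n : ℕ} (hn : 0 < n) : (n : ℝ) ^ 4 * tau β n ^ 3 = 72 * π * β ^ 3 := by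
  rw [tau, div_pow, cc_cube]
  have : (n : ℝ) ≠ 0 := by exact_mod_cast hn.ne'
  field_simp

theorem tau_nonneg {β : ℝ} (hβ : 0 < β) (n : ℕ) : 0 ≤ tau β n := by
  unfold tau; positivity

theorem tau_pos {β : ℝ} (hβ : 0 < β) {n : ℕ} (hn : 0 < n) : 0 < tau β n := by
  unfold tau; positivity

theorem ntau_lim {β : ℝ} (hβ : 0 < β) : Tendsto (fun n : ℕ => (n : ℝ) * tau β n) atTop (𝓝 0) := by
  have h1 : Tendsto (fun n : ℕ => 72 * π * β ^ 3 * (1 / (n : ℝ))) atTop (𝓝 0) := by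
    have := (tendsto_one_div_atTop_nhds_zero_nat (𝕜 := ℝ)).const_mul (72 * π * β ^ 3)
    simpa using this
  have h2 : Tendsto (fun n : ℕ => (72 * π * β ^ 3 * (1 / (n : ℝ))) ^ ((1 : ℝ) / 3)) atTop (𝓝 0) := by
    have := h1.rpow_const (p := (1 : ℝ) / 3) (Or.inr (by norm_num))
    rwa [Real.zero_rpow (by norm_num)] at this
  refine h2.congr' ?_
  filter_upwards [eventually_gt_atTop 0] with n hn
  have hn' : (n : ℝ) ≠ 0 := by exact_mod_cast hn.ne'
  have h3 : 72 * π * β ^ 3 * (1 / (n : ℝ)) = ((n : ℝ) * tau β n) ^ 3 := by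
    rw [← tau_cube β hn]; field_simp
  rw [h3, ← Real.rpow_natCast, ← Real.rpow_mul (mul_nonneg (Nat.cast_nonneg n) (tau_nonneg hβ n))]
  norm_num

theorem tau_lim {β : ℝ} (hβ : 0 < β) : Tendsto (fun n : ℕ => tau β n) atTop (𝓝 0) := by
  refine squeeze_zero' (Eventually.of_forall fun n => tau_nonneg hβ n) ?_ (ntau_lim hβ)
  filter_upwards [eventually_gt_atTop 0] with n hn
  have hn' : (1 : ℝ) ≤ n := by exact_mod_cast hn
  nlinarith [tau_nonneg hβ n]

theorem tau_ev {β : ℝ} (hβ : 0 < β) : ∀ᶠ n : ℕ in atTop, 0 < n ∧ tau β n ∈ Set.Ioo 0 1 := by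
  filter_upwards [eventually_gt_atTop 0, (tau_lim hβ).eventually_lt_const zero_lt_one] with n hn h
  exact ⟨hn, tau_pos hβ hn, h⟩

theorem rr_bd {β : ℝ} {n : ℕ} (h : tau β n ∈ Set.Ioo 0 1) : 0 ≤ rr β n ∧ rr β n ≤ tau β n := by
  constructor
  · have := Real.sin_nonneg_of_nonneg_of_le_pi (x := tau β n / 2) (by linarith [h.1]) (by linarith [h.2, Real.pi_gt_three])
    unfold rr; linarith
  · have := Real.sin_le (x := tau β n / 2) (by linarith [h.1])
    unfold rr; linarith

theorem Aeq (n : ℕ) {τ : ℝ} (hτ : τ ∈ Set.Ico 0 π) :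
    ∫⁻ v, ww n (2 * Real.sin (τ / 2)) v ∂mC = ENNReal.ofReal (2 * (n : ℝ) ^ 4 / π * (τ - Real.sin τ)) := by
  rw [ww, lintegral_DD _ (meas_ww0 n) hτ]
  have h1 : ∀ t : ℝ, (n : ℝ) ^ 4 * ‖(Circle.exp t : ℂ) - 1‖ ^ 2 = (n : ℝ) ^ 4 * (2 - 2 * Real.cos t) := by
    intro t
    rw [norm_exp_sub_one, mul_pow, sq_abs]
    have h2 : Real.cos t = 2 * Real.cos (t / 2) ^ 2 - 1 := by rw [← Real.cos_two_mul]; congr 1; ring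
    have h3 := Real.sin_sq_add_cos_sq (t / 2)
    rw [h2, ← sub_eq_zero]
    linear_combination 4 * (n : ℝ) ^ 4 * h3
  simp_rw [h1]
  have hc : Continuous fun t : ℝ => (n : ℝ) ^ 4 * (2 - 2 * Real.cos t) := by fun_prop
  rw [← ofReal_integral_eq_lintegral_ofReal (hc.integrableOn_Icc) (Eventually.of_forall fun t => by
    have := Real.cos_le_one t
    have h4 : 0 ≤ 2 - 2 * Real.cos t := by linarith
    positivity)]
  rw [← ENNReal.ofReal_mul (by positivity)]
  congr 1
  rw [integral_Icc_eq_integral_Ioc, ← intervalIntegral.integral_of_le (by linarith [hτ.1]), intervalIntegral.integral_const_mul,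
    intervalIntegral.integral_sub (by simp) (by apply Continuous.intervalIntegrable; fun_prop), intervalIntegral.integral_const_mul, integral_cos,
    intervalIntegral.integral_const, Real.sin_neg, smul_eq_mul]
  have := Real.pi_pos
  field_simp
  ring

theorem A_lim {β : ℝ} (hβ : 0 < β) : Tendsto (fun n : ℕ => ∫⁻ v, ww n (rr β n) v ∂mC) atTop (𝓝 (ENNReal.ofReal (24 * β ^ 3))) := by
  have h1 : Tendsto (fun n : ℕ => 2 * (n : ℝ) ^ 4 / π * (tau β n - Real.sin (tau β n))) atTop (𝓝 (24 * β ^ 3)) := by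
    rw [tendsto_iff_norm_sub_tendsto_zero]
    have h2 : Tendsto (fun n : ℕ => 144 * β ^ 3 * (5 / 96) * tau β n) atTop (𝓝 0) := by
      simpa using (tau_lim hβ).const_mul (144 * β ^ 3 * (5 / 96))
    refine squeeze_zero' (Eventually.of_forall fun n => norm_nonneg _) ?_ h2
    filter_upwards [tau_ev hβ] with n hn
    obtain ⟨hn, h0, h1⟩ := hn
    have hb := Real.sin_bound (x := tau β n) (by rw [abs_of_pos h0]; exact h1.le)
    rw [abs_of_pos h0] at hb
    have hcube := tau_cube β hn
    have hpi := Real.pi_pos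
    have h3 : 2 * (n : ℝ) ^ 4 / π * (tau β n - Real.sin (tau β n)) - 24 * β ^ 3 =
        -(2 * (n : ℝ) ^ 4 / π * (Real.sin (tau β n) - (tau β n - tau β n ^ 3 / 6))) := by
      have h4 : 24 * β ^ 3 = (n : ℝ) ^ 4 * tau β n ^ 3 / (3 * π) := by rw [hcube]; field_simp; norm_num
      rw [h4]; field_simp; ring
    rw [h3, norm_neg, norm_mul, Real.norm_eq_abs, Real.norm_eq_abs, abs_of_nonneg (by positivity)]
    calc _ ≤ 2 * (n : ℝ) ^ 4 / π * (tau β n ^ 4 * (5 / 96)) := by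
          gcongr
          refine hb.trans ?_
          have : tau β n ^ 5 ≤ tau β n ^ 4 := pow_le_pow_of_le_one h0.le h1.le (by norm_num)
          have h6 : 0 ≤ tau β n ^ 4 := by positivity
          linarith
      _ = 2 / π * (5 / 96) * ((n : ℝ) ^ 4 * tau β n ^ 3) * tau β n := by ring
      _ = _ := by rw [hcube]; field_simp; ring
  refine ((ENNReal.continuous_ofReal.tendsto _).comp h1).congr' ?_
  filter_upwards [tau_ev hβ] with n hn
  exact (Aeq n ⟨hn.2.1.le, by linarith [hn.2.2, Real.pi_gt_three]⟩).symm

theorem mom_lim {β : ℝ} (hβ : 0 < β) (k : ℕ) :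
    Tendsto (fun n : ℕ => mom n k (rr β n)) atTop (𝓝 (ENNReal.ofReal ((2 * β ^ 3) ^ k))) := by
  have hA := (A_lim hβ).ennrpow_const (k : ℝ)
  simp only [ENNReal.rpow_natCast] at hA
  have hI := lim_I k
  have hε : Tendsto (fun n : ℕ => ENNReal.ofReal ((2 * k).factorial * (2 * k * (2 * (n * rr β n))))) atTop (𝓝 0) := by
    have h1 : Tendsto (fun n : ℕ => (n : ℝ) * rr β n) atTop (𝓝 0) := by
      refine squeeze_zero' ?_ ?_ (ntau_lim hβ)
      · filter_upwards [tau_ev hβ] with n hn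
        have := (rr_bd hn.2).1
        positivity
      · filter_upwards [tau_ev hβ] with n hn
        have := (rr_bd hn.2).2
        gcongr
    have h2 := (((h1.const_mul 2).const_mul (2 * (k : ℝ))).const_mul ((2 * k).factorial : ℝ))
    have h3 := (ENNReal.continuous_ofReal.tendsto _).comp h2
    simp only [mul_zero, ENNReal.ofReal_zero] at h3
    exact h3
  have hlim : ENNReal.ofReal ((2 * β ^ 3) ^ k) = ENNReal.ofReal ((1 / 12) ^ k) * ENNReal.ofReal (24 * β ^ 3) ^ k := by
    rw [← ENNReal.ofReal_pow (by positivity), ← ENNReal.ofReal_mul (by positivity), ← mul_pow]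
    congr 2; ring
  have hAt : ENNReal.ofReal (24 * β ^ 3) ^ k ≠ ⊤ := ENNReal.pow_ne_top ENNReal.ofReal_ne_top
  have hIA := ENNReal.Tendsto.mul hI (Or.inr hAt) hA (Or.inr ENNReal.ofReal_ne_top)
  have hεA := ENNReal.Tendsto.mul hε (Or.inr hAt) hA (Or.inr ENNReal.zero_ne_top)
  have hup := ENNReal.Tendsto.mul (hI.add hε) (Or.inr hAt) hA (Or.inr (by simp))
  rw [add_zero] at hup
  rw [zero_mul] at hεA
  have hlow := ENNReal.Tendsto.sub hIA hεA (Or.inr ENNReal.zero_ne_top)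
  rw [tsub_zero] at hlow
  rw [hlim]
  refine tendsto_of_tendsto_of_tendsto_of_le_of_le' hlow hup ?_ ?_
  · filter_upwards [tau_ev hβ] with n hn
    rw [tsub_le_iff_right]
    exact (mom_sandwich n k hn.1 (rr β n) (rr_bd hn.2).1).2
  · filter_upwards [tau_ev hβ] with n hn
    exact (mom_sandwich n k hn.1 (rr β n) (rr_bd hn.2).1).1

theorem bad_lim {β : ℝ} (hβ : 0 < β) {ι : Type*} [Fintype ι] [DecidableEq ι] (p : ι → ι) (ρ : ι → ℕ)
    (hp : ∀ i, p i ≠ i → ρ (p i) < ρ i)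
    (hc : (Finset.univ.filter fun i => p i = i).card < (Finset.univ.filter fun i => ¬ p i = i).card) :
    Tendsto (fun n : ℕ => ∫⁻ u, (SS p (rr β n)).indicator 1 u * ENNReal.ofReal (Kd n u) ∂(mT ι)) atTop (𝓝 0) := by
  set R := (Finset.univ.filter fun i => p i = i).card with hR
  set L := (Finset.univ.filter fun i => ¬ p i = i).card with hL
  have h1 : Tendsto (fun n : ℕ => ENNReal.ofReal ((Fintype.card ι).factorial * ((72 * β ^ 3) ^ L * (1 / (n : ℝ))))) atTop (𝓝 0) := by
    have h2 := (((tendsto_one_div_atTop_nhds_zero_nat (𝕜 := ℝ)).const_mul ((72 * β ^ 3) ^ L)).const_mul ((Fintype.card ι).factorial : ℝ))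
    have h3 := (ENNReal.continuous_ofReal.tendsto _).comp h2
    simp only [mul_zero, ENNReal.ofReal_zero] at h3
    exact h3
  refine tendsto_of_tendsto_of_tendsto_of_le_of_le' tendsto_const_nhds h1 (Eventually.of_forall fun n => zero_le) ?_
  filter_upwards [tau_ev hβ] with n hn
  obtain ⟨hn, hτ⟩ := hn
  have hn' : (1 : ℝ) ≤ n := by exact_mod_cast hn
  refine (forest_bound n p ρ hp (rr β n)).trans ?_
  rw [Finset.prod_ite, Finset.prod_const, Finset.prod_const, ← hR, ← hL, ENNReal.ofReal_mul (p := ((Fintype.card ι).factorial : ℝ)) (by positivity)]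
  gcongr
  have h4 : ENNReal.ofReal ((n : ℝ) ^ 3 * rr β n ^ 2) * mC (DD (rr β n)) ≤ ENNReal.ofReal (72 * β ^ 3 / n) := by
    rw [show mC (DD (rr β n)) = ENNReal.ofReal (tau β n / π) from mC_DD ⟨hτ.1.le, by linarith [hτ.2, Real.pi_gt_three]⟩,
      ← ENNReal.ofReal_mul (by positivity)]
    refine ENNReal.ofReal_le_ofReal ?_
    have h5 := rr_bd hτ
    have h6 : rr β n ^ 2 ≤ tau β n ^ 2 := pow_le_pow_left₀ h5.1 h5.2 2
    have hpi := Real.pi_pos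
    calc (n : ℝ) ^ 3 * rr β n ^ 2 * (tau β n / π) ≤ (n : ℝ) ^ 3 * tau β n ^ 2 * (tau β n / π) := by
          have := hτ.1.le
          gcongr
      _ = ((n : ℝ) ^ 4 * tau β n ^ 3) / (π * n) := by field_simp
      _ = _ := by rw [tau_cube β hn]; field_simp
  calc (n : ENNReal) ^ R * (ENNReal.ofReal ((n : ℝ) ^ 3 * rr β n ^ 2) * mC (DD (rr β n))) ^ L ≤
      (n : ENNReal) ^ R * (ENNReal.ofReal (72 * β ^ 3 / n)) ^ L := by gcongr
    _ = ENNReal.ofReal ((n : ℝ) ^ R * (72 * β ^ 3 / n) ^ L) := by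
        rw [ENNReal.ofReal_mul (by positivity), ENNReal.ofReal_pow (by positivity), ENNReal.ofReal_pow (by positivity),
          ENNReal.ofReal_natCast]
    _ ≤ _ := by
        refine ENNReal.ofReal_le_ofReal ?_
        rw [div_pow, mul_div_assoc', mul_comm, mul_div_assoc]
        refine mul_le_mul_of_nonneg_left ?_ (by positivity)
        rw [div_le_div_iff₀ (by positivity) (by positivity), one_mul, ← pow_succ]
        exact pow_le_pow_right₀ hn' hc

end CUE



namespace CUE

section seqs
variable {X : Type*} [Fintype X] [DecidableEq X]

/-- sequences avoiding repeats and swaps -/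
def goodSeq (I : Finset X) (sw : X → X) (k : ℕ) (ψ : Fin k → X) : Prop :=
  (∀ a, ψ a ∈ I) ∧ ∀ a b, a ≠ b → ψ a ≠ ψ b ∧ ψ a ≠ sw (ψ b)

open Classical in
/-- number of good sequences -/
noncomputable def Tn (I : Finset X) (sw : X → X) (k : ℕ) : ℕ :=
  (Finset.univ.filter fun ψ : Fin k → X => goodSeq I sw k ψ).card

theorem goodSeq_cons (I : Finset X) (sw : X → X) (hsw : ∀ x, sw (sw x) = x) (k : ℕ) (x : X) (ψ : Fin k → X) :
    goodSeq I sw (k + 1) (Fin.cons x ψ) ↔ goodSeq I sw k ψ ∧ (x ∈ I ∧ ∀ b, x ≠ ψ b ∧ x ≠ sw (ψ b)) := by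
  constructor
  · rintro ⟨h1, h2⟩
    refine ⟨⟨fun a => by simpa using h1 a.succ, fun a b hab => ?_⟩, by simpa using h1 0, fun b => ?_⟩
    · simpa using h2 a.succ b.succ (by simpa using hab)
    · simpa using h2 0 b.succ (Fin.succ_ne_zero b).symm
  · rintro ⟨⟨h1, h2⟩, h3, h4⟩
    refine ⟨fun a => ?_, fun a b => ?_⟩
    · refine Fin.cases ?_ (fun a => ?_) a
      · simpa using h3
      · simpa using h1 a
    · refine Fin.cases ?_ (fun a => ?_) a <;> refine Fin.cases ?_ (fun b => ?_) b
      · simp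
      · intro _; simpa using h4 b
      · intro _
        simp only [Fin.cons_succ, Fin.cons_zero]
        refine ⟨(h4 a).1.symm, fun h => (h4 a).2 ?_⟩
        rw [h, hsw]
      · intro hab
        simpa using h2 a b (by simpa using hab)

open Classical in
theorem fiber_card (I : Finset X) (sw : X → X) (hsw : ∀ x, sw (sw x) = x) (hne : ∀ x ∈ I, sw x ≠ x)
    (hI : ∀ x ∈ I, sw x ∈ I) (k : ℕ) (ψ : Fin k → X) (hψ : goodSeq I sw k ψ) :
    (Finset.univ.filter fun x => x ∈ I ∧ ∀ b, x ≠ ψ b ∧ x ≠ sw (ψ b)).card + 2 * k = I.card := by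
  set A := Finset.univ.image ψ with hA
  set B := Finset.univ.image (fun a => sw (ψ a)) with hB
  have hinj : Function.Injective ψ := fun a b hab => by
    by_contra h; exact (hψ.2 a b h).1 hab
  have hswi : Function.Injective sw := fun x y h => by rw [← hsw x, h, hsw]
  have hAc : A.card = k := by rw [hA, Finset.card_image_of_injective _ hinj]; simp
  have hBc : B.card = k := by
    rw [hB, Finset.card_image_of_injective Finset.univ (f := fun a => sw (ψ a)) (fun a b h => hinj (hswi h))]; simp
  have hd : Disjoint A B := by
    rw [Finset.disjoint_left]
    intro x hx hx'
    simp only [hA, hB, Finset.mem_image, Finset.mem_univ, true_and] at hx hx'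
    obtain ⟨a, rfl⟩ := hx
    obtain ⟨b, hb⟩ := hx'
    by_cases hab : a = b
    · subst hab; exact hne _ (hψ.1 a) hb
    · exact (hψ.2 a b hab).2 hb.symm
  have hs : A ∪ B ⊆ I := by
    intro x hx
    simp only [hA, hB, Finset.mem_union, Finset.mem_image, Finset.mem_univ, true_and] at hx
    rcases hx with ⟨a, rfl⟩ | ⟨a, rfl⟩
    · exact hψ.1 a
    · exact hI _ (hψ.1 a)
  have hE : (Finset.univ.filter fun x => x ∈ I ∧ ∀ b, x ≠ ψ b ∧ x ≠ sw (ψ b)) = I \ (A ∪ B) := by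
    ext x
    simp only [hA, hB, Finset.mem_filter, Finset.mem_univ, true_and, Finset.mem_sdiff, Finset.mem_union, Finset.mem_image,
      not_or, not_exists]
    refine and_congr_right fun _ => ⟨fun h => ⟨fun a ha => (h a).1 ha.symm, fun a ha => (h a).2 ha.symm⟩,
      fun h b => ⟨fun hb => h.1 b hb.symm, fun hb => h.2 b hb.symm⟩⟩
  have h1 := Finset.card_sdiff_add_card_eq_card hs
  rw [Finset.card_union_of_disjoint hd, hAc, hBc] at h1
  rw [hE]
  omega

open Classical in
theorem Tn_succ (I : Finset X) (sw : X → X) (hsw : ∀ x, sw (sw x) = x) (hne : ∀ x ∈ I, sw x ≠ x)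
    (hI : ∀ x ∈ I, sw x ∈ I) (k : ℕ) : (Tn I sw (k + 1) : ℝ) = Tn I sw k * (I.card - 2 * k) := by
  have h1 : Tn I sw (k + 1) = ∑ ψ : Fin k → X, if goodSeq I sw k ψ then
      (Finset.univ.filter fun x => x ∈ I ∧ ∀ b, x ≠ ψ b ∧ x ≠ sw (ψ b)).card else 0 := by
    rw [Tn, Finset.card_filter, ← (Fin.consEquiv fun _ : Fin (k + 1) => X).sum_comp, Fintype.sum_prod_type_right]
    refine Finset.sum_congr rfl fun ψ _ => ?_
    simp only [Fin.consEquiv, Equiv.coe_fn_mk, goodSeq_cons I sw hsw]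
    split_ifs with h
    · simp only [h, true_and, Finset.card_filter]
    · simp [h]
  rw [h1, Tn, Finset.card_filter]
  push_cast
  rw [Finset.sum_mul]
  refine Finset.sum_congr rfl fun ψ _ => ?_
  split_ifs with h
  · have := fiber_card I sw hsw hne hI k ψ h
    rw [← this]; push_cast; ring
  · simp

theorem Tn_zero (I : Finset X) (sw : X → X) : Tn I sw 0 = 1 := by
  classical
  rw [Tn, Finset.filter_true_of_mem]
  · simp
  · intro ψ _
    exact ⟨fun a => a.elim0, fun a => a.elim0⟩

theorem bonf (I : Finset X) (sw : X → X) (hsw : ∀ x, sw (sw x) = x) (hne : ∀ x ∈ I, sw x ≠ x)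
    (hI : ∀ x ∈ I, sw x ∈ I) (K : ℕ) :
    |(if I.card = 0 then (1 : ℝ) else 0) - ∑ j ∈ Finset.range (K + 1), (-1 : ℝ) ^ j * (Tn I sw j / (2 ^ j * j.factorial))| ≤
      2 * (K + 1) * (Tn I sw (K + 1) / (2 ^ (K + 1) * (K + 1).factorial)) := by
  set a : ℕ → ℝ := fun j => Tn I sw j / (2 ^ j * j.factorial) with ha
  have ha0 : a 0 = 1 := by simp [ha, Tn_zero]
  have hpos : ∀ j, 0 ≤ a j := fun j => by simp only [ha]; positivity
  have hrec : ∀ j : ℕ, 2 * (a (j + 1) * (j + 1)) = a j * (I.card - 2 * j) := by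
    intro j
    simp only [ha]
    rw [Tn_succ I sw hsw hne hI, Nat.factorial_succ, pow_succ]
    push_cast
    field_simp
  change |_ - ∑ j ∈ Finset.range (K + 1), (-1 : ℝ) ^ j * a j| ≤ 2 * (K + 1) * a (K + 1)
  by_cases h : I.card = 0
  · have hz : ∀ j, a (j + 1) = 0 := by
      intro j
      induction j with
      | zero =>
        have := hrec 0
        rw [h] at this
        simp at this; simpa using this
      | succ j ih =>
        have := hrec (j + 1)
        rw [ih, zero_mul] at this
        have h3 : ((j + 1 : ℕ) : ℝ) + 1 ≠ 0 := by positivity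
        have h4 : a (j + 1 + 1) * (((j + 1 : ℕ) : ℝ) + 1) = 0 := by linarith
        exact (mul_eq_zero.1 h4).resolve_right h3
    rw [Finset.sum_range_succ', Finset.sum_eq_zero fun j _ => by rw [hz, mul_zero], if_pos h, hz, ha0]
    simp
  · rw [if_neg h, zero_sub, abs_neg]
    have hI1 : (1 : ℝ) ≤ I.card := by exact_mod_cast Nat.one_le_iff_ne_zero.2 h
    have hs : ∀ K : ℕ, (∑ j ∈ Finset.range (K + 1), (-1 : ℝ) ^ j * a j) * I.card = (-1) ^ K * (2 * (a (K + 1) * (K + 1))) := by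
      intro K
      induction K with
      | zero => rw [hrec]; simp
      | succ K ih =>
        rw [Finset.sum_range_succ, add_mul, ih, hrec (K + 1)]
        push_cast
        ring
    have h2 := congrArg abs (hs K)
    rw [abs_mul, abs_mul, abs_pow, abs_neg, abs_one, one_pow, one_mul, abs_of_nonneg (by linarith : (0 : ℝ) ≤ I.card),
      abs_of_nonneg (mul_nonneg zero_le_two (mul_nonneg (hpos _) (by positivity)))] at h2
    have h3 := abs_nonneg (∑ j ∈ Finset.range (K + 1), (-1 : ℝ) ^ j * a j)
    nlinarith

end seqs

end CUE



namespace CUE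

section graph
variable {V : Type*} [Fintype V] [DecidableEq V]

open Classical in
/-- embeddings respecting the parent map -/
noncomputable def Cs (R : V → V → Prop) {ι : Type*} [Fintype ι] [DecidableEq ι] (p : ι → ι) : Finset (ι ↪ V) :=
  Finset.univ.filter fun φ => ∀ i, p i ≠ i → R (φ i) (φ (p i))

theorem mem_Cs (R : V → V → Prop) {ι : Type*} [Fintype ι] [DecidableEq ι] (p : ι → ι) (φ : ι ↪ V) :
    φ ∈ Cs R p ↔ ∀ i, p i ≠ i → R (φ i) (φ (p i)) := by simp [Cs]

/-- isolated pairs -/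
def iso (R : V → V → Prop) (u v : V) : Prop := u ≠ v ∧ R u v ∧ ∀ w, w ≠ u → w ≠ v → ¬ R w u ∧ ¬ R w v

theorem iso_symm {R : V → V → Prop} (hR : ∀ u v, R u v → R v u) {u v : V} (h : iso R u v) : iso R v u :=
  ⟨h.1.symm, hR _ _ h.2.1, fun w h1 h2 => (h.2.2 w h2 h1).symm⟩

theorem iso_share {R : V → V → Prop} (hR : ∀ u v, R u v → R v u) {u v v' : V} (h : iso R u v) (h' : iso R u v') : v = v' := by
  by_contra hne
  exact (h.2.2 v' h'.1.symm (Ne.symm hne)).1 (hR _ _ h'.2.1)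

open Classical in
/-- set of isolated pairs -/
noncomputable def Is (R : V → V → Prop) : Finset (V × V) := Finset.univ.filter fun q => iso R q.1 q.2

theorem mem_Is (R : V → V → Prop) (q : V × V) : q ∈ Is R ↔ iso R q.1 q.2 := by simp [Is]

/-- pairs of an embedding -/
def Fp (k : ℕ) (φ : Fin 2 × Fin k ↪ V) : Fin k → V × V := fun a => (φ (0, a), φ (1, a))

theorem Fp_inj (k : ℕ) : Function.Injective (Fp (V := V) k) := by
  intro φ φ' h
  ext ⟨s, a⟩
  have := congrFun h a
  simp only [Fp, Prod.mk.injEq] at this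
  fin_cases s
  · exact this.1
  · exact this.2

theorem Tn_le (R : V → V → Prop) (hR : ∀ u v, R u v → R v u) (k : ℕ) : Tn (Is R) Prod.swap k ≤ (Cs R (pk k)).card := by
  classical
  rw [← Finset.card_image_of_injective (Cs R (pk k)) (Fp_inj k)]
  refine Finset.card_le_card ?_
  intro ψ hψ
  rw [Finset.mem_filter] at hψ
  obtain ⟨-, h1, h2⟩ := hψ
  simp only [mem_Is] at h1
  have hinj : Function.Injective (fun i : Fin 2 × Fin k => if i.1 = 0 then (ψ i.2).1 else (ψ i.2).2) := by
    rintro ⟨s, a⟩ ⟨t, b⟩ h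
    by_cases hab : a = b
    · subst hab
      have := (h1 a).1
      fin_cases s <;> fin_cases t <;> simp_all
    · exfalso
      obtain ⟨h3, h4⟩ := h2 a b hab
      have ia := h1 a
      have ib := h1 b
      fin_cases s <;> fin_cases t <;> simp at h
      · rw [h] at ia
        exact h3 (Prod.ext h (iso_share hR ia ib))
      · rw [h] at ia
        exact h4 (Prod.ext h (iso_share hR ia (iso_symm hR ib)))
      · have ia := iso_symm hR ia
        rw [h] at ia
        exact h4 (Prod.ext (iso_share hR ia ib) h)
      · have ia := iso_symm hR ia
        rw [h] at ia
        exact h3 (Prod.ext (iso_share hR ia (iso_symm hR ib)) h)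
  rw [Finset.mem_image]
  refine ⟨⟨_, hinj⟩, ?_, ?_⟩
  · rw [mem_Cs]
    rintro ⟨s, a⟩ hs
    fin_cases s
    · simp [pk] at hs
    · simpa [pk] using hR _ _ (h1 a).2.1
  · funext a
    simp [Fp]

/-- attach an extra point -/
def p1 (k : ℕ) (i : Fin 2 × Fin k) : Option (Fin 2 × Fin k) → Option (Fin 2 × Fin k)
  | none => some i
  | some j => some (pk k j)

/-- attach one pair to another -/
def p2 (k : ℕ) (i j m : Fin 2 × Fin k) : Fin 2 × Fin k := if m = j then i else if m.2 = j.2 then j else (0, m.2)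

/-- number of bad configurations -/
noncomputable def Bad (R : V → V → Prop) (k : ℕ) : ℕ :=
  ∑ i, (Cs R (p1 k i)).card + ∑ q ∈ Finset.univ.filter (fun q : (Fin 2 × Fin k) × (Fin 2 × Fin k) => q.1.2 ≠ q.2.2), (Cs R (p2 k q.1 q.2)).card

theorem le_Tn (R : V → V → Prop) (hR : ∀ u v, R u v → R v u) (k : ℕ) :
    (Cs R (pk k)).card ≤ Tn (Is R) Prod.swap k + Bad R k := by
  classical
  set G := (Cs R (pk k)).filter fun φ => ∀ a, iso R (φ (0, a)) (φ (1, a)) with hG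
  have hGc : G.card ≤ Tn (Is R) Prod.swap k := by
    rw [← Finset.card_image_of_injective G (Fp_inj k)]
    refine Finset.card_le_card ?_
    intro ψ hψ
    rw [Finset.mem_image] at hψ
    obtain ⟨φ, hφ, rfl⟩ := hψ
    rw [hG, Finset.mem_filter] at hφ
    rw [Finset.mem_filter]
    refine ⟨Finset.mem_univ _, fun a => (mem_Is R _).2 (hφ.2 a), fun a b hab => ⟨fun h => ?_, fun h => ?_⟩⟩
    · have := congrArg Prod.fst h
      simp only [Fp] at this
      have := φ.injective this
      simp [hab] at this
    · have := congrArg Prod.fst h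
      simp only [Fp, Prod.swap] at this
      have := φ.injective this
      simp at this
  have hsub : Cs R (pk k) ⊆ G ∪ ((Finset.univ.biUnion fun i => (Cs R (p1 k i)).image fun φ => Function.Embedding.some.trans φ) ∪
      (Finset.univ.filter (fun q : (Fin 2 × Fin k) × (Fin 2 × Fin k) => q.1.2 ≠ q.2.2)).biUnion fun q => Cs R (p2 k q.1 q.2)) := by
    intro φ hφ
    by_cases hg : φ ∈ G
    · exact Finset.mem_union_left _ hg
    refine Finset.mem_union_right _ ?_
    have hc := (mem_Cs R _ φ).1 hφ
    have hpair : ∀ a, R (φ (1, a)) (φ (0, a)) := fun a => by simpa [pk] using hc (1, a) (by simp [pk])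
    simp only [hG, Finset.mem_filter, hφ, true_and, not_forall] at hg
    obtain ⟨a, ha⟩ := hg
    have hw : ∃ w, ∃ s : Fin 2, w ≠ φ (0, a) ∧ w ≠ φ (1, a) ∧ R w (φ (s, a)) := by
      by_contra hcon
      push Not at hcon
      refine ha ⟨fun h => by have := φ.injective h; simp at this, hR _ _ (hpair a), fun w h1 h2 => ⟨hcon w 0 h1 h2, hcon w 1 h1 h2⟩⟩
    obtain ⟨w, s, hw0, hw1, hws⟩ := hw
    by_cases hr : w ∈ Set.range φ
    · obtain ⟨⟨t, b⟩, rfl⟩ := hr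
      have hab : a ≠ b := by
        rintro rfl
        fin_cases t <;> simp_all
      refine Finset.mem_union_right _ ?_
      rw [Finset.mem_biUnion]
      refine ⟨((s, a), (t, b)), by simp [hab], ?_⟩
      rw [mem_Cs]
      rintro ⟨s', c⟩ hm
      by_cases hcb : c = b
      · subst hcb
        by_cases hs : s' = t
        · subst hs; simpa [p2] using hws
        · have h5 : p2 k (s, a) (t, c) (s', c) = (t, c) := by simp [p2, hs]
          rw [h5]
          fin_cases s' <;> fin_cases t
          · simp at hs
          · exact hR _ _ (hpair c)
          · exact hpair c
          · simp at hs
      · have h5 : p2 k (s, a) (t, b) (s', c) = (0, c) := by simp [p2, hcb]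
        rw [h5] at hm ⊢
        fin_cases s'
        · simp at hm
        · exact hpair c
    · refine Finset.mem_union_left _ ?_
      rw [Finset.mem_biUnion]
      refine ⟨(s, a), Finset.mem_univ _, ?_⟩
      rw [Finset.mem_image]
      refine ⟨Function.Embedding.optionElim φ w hr, ?_, by ext; rfl⟩
      rw [mem_Cs]
      rintro (_ | j) hm
      · exact hws
      · refine hc j ?_
        intro h; apply hm; simp [p1, h]
  refine (Finset.card_le_card hsub).trans ((Finset.card_union_le _ _).trans (add_le_add hGc ((Finset.card_union_le _ _).trans ?_)))
  refine add_le_add (Finset.card_biUnion_le.trans (Finset.sum_le_sum fun i _ => Finset.card_image_le)) Finset.card_biUnion_le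

open Classical in
theorem bonf_graph (R : V → V → Prop) (hR : ∀ u v, R u v → R v u) (K : ℕ) :
    |(if ∀ u v, u ≠ v → ¬ R u v then (1 : ℝ) else 0) -
        ∑ j ∈ Finset.range (K + 1), (-1 : ℝ) ^ j * ((Cs R (pk j)).card / (2 ^ j * j.factorial))| ≤
      2 * (K + 1) * ((Cs R (pk (K + 1))).card / (2 ^ (K + 1) * (K + 1).factorial)) +
        ∑ j ∈ Finset.range (K + 1), (Bad R j : ℝ) + Bad R 1 := by
  have h1 := bonf (Is R) Prod.swap (fun x => Prod.swap_swap x) (fun x hx h => by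
    rw [mem_Is] at hx
    exact hx.1 (congrArg Prod.snd h)) (fun x hx => by
    rw [mem_Is] at hx ⊢
    exact iso_symm hR hx) K
  have h2 : (Tn (Is R) Prod.swap (K + 1) : ℝ) ≤ (Cs R (pk (K + 1))).card := by exact_mod_cast Tn_le R hR (K + 1)
  have h3 : |∑ j ∈ Finset.range (K + 1), (-1 : ℝ) ^ j * (Tn (Is R) Prod.swap j / (2 ^ j * j.factorial)) -
      ∑ j ∈ Finset.range (K + 1), (-1 : ℝ) ^ j * ((Cs R (pk j)).card / (2 ^ j * j.factorial))| ≤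
      ∑ j ∈ Finset.range (K + 1), (Bad R j : ℝ) := by
    rw [← Finset.sum_sub_distrib]
    refine (Finset.abs_sum_le_sum_abs _ _).trans (Finset.sum_le_sum fun j _ => ?_)
    rw [← mul_sub, abs_mul, abs_pow, abs_neg, abs_one, one_pow, one_mul, ← sub_div, abs_div]
    have h4 : (1 : ℝ) ≤ 2 ^ j * j.factorial := by
      exact_mod_cast Nat.one_le_iff_ne_zero.2 (by positivity : 2 ^ j * j.factorial ≠ 0)
    have h5 : (Tn (Is R) Prod.swap j : ℝ) ≤ (Cs R (pk j)).card := by exact_mod_cast Tn_le R hR j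
    have h6 : ((Cs R (pk j)).card : ℝ) ≤ Tn (Is R) Prod.swap j + Bad R j := by exact_mod_cast le_Tn R hR j
    rw [abs_of_pos (by linarith : (0 : ℝ) < 2 ^ j * j.factorial)]
    refine (div_le_self (abs_nonneg _) h4).trans ?_
    rw [abs_le]; constructor <;> linarith
  have h7 : |(if ∀ u v, u ≠ v → ¬ R u v then (1 : ℝ) else 0) - (if (Is R).card = 0 then (1 : ℝ) else 0)| ≤ Bad R 1 := by
    by_cases hE : ∀ u v, u ≠ v → ¬ R u v
    · have : (Is R).card = 0 := by
        rw [Finset.card_eq_zero, Finset.eq_empty_iff_forall_notMem]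
        intro q hq
        rw [mem_Is] at hq
        exact hE _ _ hq.1 hq.2.1
      rw [if_pos hE, if_pos this]; simp
    · rw [if_neg hE]
      by_cases hc : (Is R).card = 0
      · rw [if_pos hc]
        push Not at hE
        obtain ⟨u, v, huv, hr⟩ := hE
        have h8 : (Tn (Is R) Prod.swap 1 : ℝ) = 0 := by
          have := Tn_succ (Is R) Prod.swap (fun x => Prod.swap_swap x) (fun x hx h => by
            rw [mem_Is] at hx
            exact hx.1 (congrArg Prod.snd h)) (fun x hx => by
            rw [mem_Is] at hx ⊢
            exact iso_symm hR hx) 0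
          rw [hc] at this
          simpa using this
        have h8' : Tn (Is R) Prod.swap 1 = 0 := by exact_mod_cast h8
        have h9 := le_Tn R hR 1
        rw [h8', zero_add] at h9
        have h10 : 0 < (Cs R (pk 1)).card := by
          rw [Finset.card_pos]
          refine ⟨⟨fun i => if i.1 = 0 then u else v, ?_⟩, ?_⟩
          · rintro ⟨s, a⟩ ⟨t, b⟩ h
            have : a = b := Subsingleton.elim _ _
            subst this
            fin_cases s <;> fin_cases t <;> simp_all
          · rw [mem_Cs]
            rintro ⟨s, a⟩ hs
            fin_cases s
            · simp [pk] at hs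
            · exact hR _ _ hr
        have h11 : (1 : ℝ) ≤ Bad R 1 := by exact_mod_cast h10.trans_le h9
        simpa using h11
      · rw [if_neg hc]; simp
  have h12 : 2 * ((K : ℝ) + 1) * (Tn (Is R) Prod.swap (K + 1) / (2 ^ (K + 1) * (K + 1).factorial)) ≤
      2 * (K + 1) * ((Cs R (pk (K + 1))).card / (2 ^ (K + 1) * (K + 1).factorial)) := by gcongr
  rw [abs_le] at h1 h3 h7 ⊢
  constructor <;> linarith [h1.1, h1.2, h3.1, h3.2, h7.1, h7.2]

end graph

end CUE



namespace CUE

/-- closeness relation -/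
def RR (r : ℝ) {n : ℕ} (z : Fin n → Circle) (i j : Fin n) : Prop := ‖(z i : ℂ) - z j‖ ≤ r

theorem RR_symm (r : ℝ) {n : ℕ} (z : Fin n → Circle) : ∀ i j, RR r z i j → RR r z j i := by
  intro i j h; unfold RR at *; rwa [norm_sub_rev]

theorem Cs_sum (r : ℝ) {n : ℕ} (z : Fin n → Circle) {ι : Type} [Fintype ι] [DecidableEq ι] (p : ι → ι) :
    ((Cs (RR r z) p).card : ENNReal) = ∑ f : ι ↪ Fin n, (SS p r).indicator 1 (z ∘ f) := by
  classical
  rw [Cs, Finset.card_filter]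
  push_cast
  refine Finset.sum_congr rfl fun f _ => ?_
  by_cases h : ∀ i, p i ≠ i → RR r z (f i) (f (p i))
  · rw [if_pos h, Set.indicator_of_mem]
    · rfl
    · exact h
  · rw [if_neg h, Set.indicator_of_notMem]
    exact h

theorem meas_Cs (r : ℝ) (n : ℕ) {ι : Type} [Fintype ι] [DecidableEq ι] (p : ι → ι) :
    Measurable fun z : Fin n → Circle => ((Cs (RR r z) p).card : ENNReal) := by
  simp_rw [Cs_sum]
  exact Finset.measurable_sum _ fun f _ => meas_comp f (measurable_one.indicator (meas_SS p r))

theorem meas_CsR (r : ℝ) (n : ℕ) {ι : Type} [Fintype ι] [DecidableEq ι] (p : ι → ι) :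
    Measurable fun z : Fin n → Circle => ((Cs (RR r z) p).card : ℝ) := by
  have := (meas_Cs r n p).ennreal_toReal
  simpa using this

theorem integrable_Cs (r : ℝ) (n : ℕ) {ι : Type} [Fintype ι] [DecidableEq ι] (p : ι → ι) :
    Integrable (fun z : Fin n → Circle => ((Cs (RR r z) p).card : ℝ)) (nu n) := by
  refine Integrable.of_bound (C := (Fintype.card (ι ↪ Fin n) : ℝ)) (meas_CsR r n p).aestronglyMeasurable ?_
  refine Eventually.of_forall fun z => ?_
  rw [Real.norm_natCast]
  exact_mod_cast Finset.card_le_univ _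

theorem integral_Cs (r : ℝ) (n : ℕ) {ι : Type} [Fintype ι] [DecidableEq ι] (h : Fintype.card ι ≤ n) (p : ι → ι) :
    ∫ z, ((Cs (RR r z) p).card : ℝ) ∂(nu n) =
      (∫⁻ u, (SS p r).indicator 1 u * ENNReal.ofReal (Kd n u) ∂(mT ι)).toReal := by
  rw [← nu_sum n h _ (measurable_one.indicator (meas_SS p r))]
  simp_rw [← Cs_sum]
  rw [← integral_toReal (meas_Cs r n p).aemeasurable (by simp)]
  simp

theorem integrable_Bad (r : ℝ) (n k : ℕ) :
    Integrable (fun z : Fin n → Circle => (Bad (RR r z) k : ℝ)) (nu n) := by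
  simp only [Bad]
  push_cast
  exact (integrable_finsetSum _ fun i _ => integrable_Cs r n _).add (integrable_finsetSum _ fun q _ => integrable_Cs r n _)

theorem integral_Bad (r : ℝ) (n k : ℕ) :
    ∫ z, (Bad (RR r z) k : ℝ) ∂(nu n) = ∑ i, ∫ z, ((Cs (RR r z) (p1 k i)).card : ℝ) ∂(nu n) +
      ∑ q ∈ Finset.univ.filter (fun q : (Fin 2 × Fin k) × (Fin 2 × Fin k) => q.1.2 ≠ q.2.2), ∫ z, ((Cs (RR r z) (p2 k q.1 q.2)).card : ℝ) ∂(nu n) := by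
  simp only [Bad]
  push_cast
  rw [integral_add (integrable_finsetSum _ fun i _ => integrable_Cs r n _) (integrable_finsetSum _ fun q _ => integrable_Cs r n _),
    integral_finsetSum _ fun i _ => integrable_Cs r n _, integral_finsetSum _ fun i _ => integrable_Cs r n _]

theorem card_pk (k : ℕ) : (Finset.univ.filter fun i => pk k i = i).card = k ∧ (Finset.univ.filter fun i => ¬ pk k i = i).card = k := by
  have h1 : (Finset.univ.filter fun i => pk k i = i) = Finset.univ.image fun a : Fin k => ((0 : Fin 2), a) := by
    ext ⟨s, a⟩
    rw [Finset.mem_filter]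
    simp only [pk, Finset.mem_univ, true_and, Finset.mem_image, Prod.mk.injEq, and_true]
    constructor
    · rintro h; exact ⟨a, h, rfl⟩
    · rintro ⟨b, h, _⟩; exact h
  have h2 : (Finset.univ.filter fun i => pk k i = i).card = k := by
    rw [h1, Finset.card_image_of_injective _ (fun a b h => (Prod.mk.inj h).2)]; simp
  have h3 := Finset.card_filter_add_card_filter_not (s := (Finset.univ : Finset (Fin 2 × Fin k))) (fun i => pk k i = i)
  simp only [Finset.card_univ, Fintype.card_prod, Fintype.card_fin] at h3
  exact ⟨h2, by omega⟩

theorem Cs_lim {β : ℝ} (hβ : 0 < β) (k : ℕ) :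
    Tendsto (fun n : ℕ => ∫ z, ((Cs (RR (rr β n) z) (pk k)).card : ℝ) ∂(nu n)) atTop (𝓝 ((2 * β ^ 3) ^ k)) := by
  have h := (ENNReal.tendsto_toReal ENNReal.ofReal_ne_top).comp (mom_lim hβ k)
  rw [ENNReal.toReal_ofReal (by positivity)] at h
  refine h.congr' ?_
  filter_upwards [eventually_ge_atTop (2 * k)] with n hn
  rw [integral_Cs _ _ (by simpa using hn)]
  rfl

theorem Cs_bad_lim {β : ℝ} (hβ : 0 < β) {ι : Type} [Fintype ι] [DecidableEq ι] (p : ι → ι) (ρ : ι → ℕ)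
    (hp : ∀ i, p i ≠ i → ρ (p i) < ρ i)
    (hc : (Finset.univ.filter fun i => p i = i).card < (Finset.univ.filter fun i => ¬ p i = i).card) :
    Tendsto (fun n : ℕ => ∫ z, ((Cs (RR (rr β n) z) p).card : ℝ) ∂(nu n)) atTop (𝓝 0) := by
  have h := (ENNReal.tendsto_toReal ENNReal.zero_ne_top).comp (bad_lim hβ p ρ hp hc)
  rw [ENNReal.toReal_zero] at h
  refine h.congr' ?_
  filter_upwards [eventually_ge_atTop (Fintype.card ι)] with n hn
  rw [integral_Cs _ _ hn]
  rfl

theorem p1_lim {β : ℝ} (hβ : 0 < β) (k : ℕ) (i : Fin 2 × Fin k) :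
    Tendsto (fun n : ℕ => ∫ z, ((Cs (RR (rr β n) z) (p1 k i)).card : ℝ) ∂(nu n)) atTop (𝓝 0) := by
  have hroot : (Finset.univ.filter fun o => p1 k i o = o).card ≤ k := by
    have : (Finset.univ.filter fun o => p1 k i o = o) ⊆ (Finset.univ.filter fun i => pk k i = i).image some := by
      rintro (_ | j) hj
      · have h := (Finset.mem_filter.1 hj).2
        simp [p1] at h
      · have h := (Finset.mem_filter.1 hj).2
        simp only [p1, Option.some.injEq] at h
        exact Finset.mem_image_of_mem _ (Finset.mem_filter.2 ⟨Finset.mem_univ _, h⟩)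
    exact (Finset.card_le_card this).trans (Finset.card_image_le.trans (card_pk k).1.le)
  have h3 := Finset.card_filter_add_card_filter_not (s := (Finset.univ : Finset (Option (Fin 2 × Fin k)))) (fun o => p1 k i o = o)
  simp only [Finset.card_univ, Fintype.card_option, Fintype.card_prod, Fintype.card_fin] at h3
  refine Cs_bad_lim hβ _ (fun o => o.elim 2 fun j => (j.1 : ℕ)) ?_ (by omega)
  rintro (_ | j) hj
  · simp only [p1, Option.elim]; omega
  · simp only [p1, Option.elim]
    refine pk_rho k j ?_
    intro h; apply hj; simp [p1, h]

theorem p2_lim {β : ℝ} (hβ : 0 < β) (k : ℕ) (i j : Fin 2 × Fin k) (hij : i.2 ≠ j.2) :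
    Tendsto (fun n : ℕ => ∫ z, ((Cs (RR (rr β n) z) (p2 k i j)).card : ℝ) ∂(nu n)) atTop (𝓝 0) := by
  have hroot : (Finset.univ.filter fun o => p2 k i j o = o).card < k := by
    have : (Finset.univ.filter fun o => p2 k i j o = o) ⊂ (Finset.univ.filter fun i => pk k i = i) := by
      rw [Finset.ssubset_iff_of_subset]
      · refine ⟨(0, j.2), Finset.mem_filter.2 ⟨Finset.mem_univ _, by simp [pk]⟩, ?_⟩
        rw [Finset.mem_filter]
        simp only [Finset.mem_univ, true_and, p2, if_true]
        split_ifs with h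
        · intro h'; rw [h'] at hij; exact hij rfl
        · exact fun h' => h h'.symm
      · intro m hm
        rw [Finset.mem_filter] at hm ⊢
        simp only [Finset.mem_univ, true_and, p2] at hm ⊢
        split_ifs at hm with h1 h2
        · rw [hm, h1] at hij; exact absurd rfl hij
        · exact absurd hm.symm h1
        · exact hm
    exact (Finset.card_lt_card this).trans_le (card_pk k).1.le
  have h3 := Finset.card_filter_add_card_filter_not (s := (Finset.univ : Finset (Fin 2 × Fin k))) (fun o => p2 k i j o = o)
  simp only [Finset.card_univ, Fintype.card_prod, Fintype.card_fin] at h3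
  refine Cs_bad_lim hβ _ (fun m => if m = j then 2 else if m.2 = j.2 then 3 else (m.1 : ℕ)) ?_ (by omega)
  intro m hm
  have hm1 : (m.1 : ℕ) < 2 := m.1.2
  have hi1 : (i.1 : ℕ) < 2 := i.1.2
  have hi : i ≠ j := by rintro rfl; exact hij rfl
  by_cases h1 : m = j
  · simp [p2, h1, hi, hij, hi1]
  · by_cases h2 : m.2 = j.2
    · simp [p2, h1, h2]
    · have h4 : p2 k i j m = (0, m.2) := by simp [p2, h1, h2]
      rw [h4] at hm ⊢
      have h5 : ((0 : Fin 2), m.2) ≠ j := by rintro rfl; exact h2 rfl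
      simp only [h5, h1, h2, if_false]
      exact pk_rho k m hm

theorem Bad_lim {β : ℝ} (hβ : 0 < β) (k : ℕ) :
    Tendsto (fun n : ℕ => ∫ z, (Bad (RR (rr β n) z) k : ℝ) ∂(nu n)) atTop (𝓝 0) := by
  simp_rw [integral_Bad]
  have h1 : Tendsto (fun n : ℕ => ∑ i, ∫ z, ((Cs (RR (rr β n) z) (p1 k i)).card : ℝ) ∂(nu n)) atTop (𝓝 0) := by
    have := tendsto_finsetSum (Finset.univ : Finset (Fin 2 × Fin k)) fun i _ => p1_lim hβ k i
    simpa using this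
  have h2 : Tendsto (fun n : ℕ => ∑ q ∈ Finset.univ.filter (fun q : (Fin 2 × Fin k) × (Fin 2 × Fin k) => q.1.2 ≠ q.2.2),
      ∫ z, ((Cs (RR (rr β n) z) (p2 k q.1 q.2)).card : ℝ) ∂(nu n)) atTop (𝓝 0) := by
    have := tendsto_finsetSum (Finset.univ.filter (fun q : (Fin 2 × Fin k) × (Fin 2 × Fin k) => q.1.2 ≠ q.2.2))
      fun q hq => p2_lim hβ k q.1 q.2 (by simpa using hq)
    simpa using this
  simpa using h1.add h2

theorem prob_bonf (n : ℕ) (r : ℝ) (K : ℕ) :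
    |(nu n (Cl n r)ᶜ).toReal -
        ∑ j ∈ Finset.range (K + 1), (-1 : ℝ) ^ j * ((∫ z, ((Cs (RR r z) (pk j)).card : ℝ) ∂(nu n)) / (2 ^ j * j.factorial))| ≤
      2 * (K + 1) * ((∫ z, ((Cs (RR r z) (pk (K + 1))).card : ℝ) ∂(nu n)) / (2 ^ (K + 1) * (K + 1).factorial)) +
        ∑ j ∈ Finset.range (K + 1), (∫ z, (Bad (RR r z) j : ℝ) ∂(nu n)) + ∫ z, (Bad (RR r z) 1 : ℝ) ∂(nu n) := by
  classical
  have hmC : MeasurableSet (Cl n r)ᶜ := (isClosed_Cl n r).measurableSet.compl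
  have h0 : (nu n (Cl n r)ᶜ).toReal = ∫ z, (Cl n r)ᶜ.indicator 1 z ∂(nu n) := by
    rw [integral_indicator_one hmC]; rfl
  have hi0 : Integrable ((Cl n r)ᶜ.indicator (1 : (Fin n → Circle) → ℝ)) (nu n) :=
    (integrable_const (1 : ℝ)).indicator hmC
  have hi1 : ∀ j ∈ Finset.range (K + 1), Integrable (fun z : Fin n → Circle => (-1 : ℝ) ^ j * (((Cs (RR r z) (pk j)).card : ℝ) / (2 ^ j * j.factorial))) (nu n) :=
    fun j _ => ((integrable_Cs r n (pk j)).div_const _).const_mul _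
  have hi2 : Integrable (fun z : Fin n → Circle => 2 * ((K : ℝ) + 1) * (((Cs (RR r z) (pk (K + 1))).card : ℝ) / (2 ^ (K + 1) * (K + 1).factorial))) (nu n) :=
    ((integrable_Cs r n (pk (K + 1))).div_const _).const_mul _
  have hi3 : Integrable (fun z : Fin n → Circle => ∑ j ∈ Finset.range (K + 1), (Bad (RR r z) j : ℝ)) (nu n) :=
    integrable_finsetSum _ fun j _ => integrable_Bad r n j
  have hi4 : Integrable (fun z : Fin n → Circle => 2 * ((K : ℝ) + 1) * (((Cs (RR r z) (pk (K + 1))).card : ℝ) / (2 ^ (K + 1) * (K + 1).factorial)) +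
      ∑ j ∈ Finset.range (K + 1), (Bad (RR r z) j : ℝ)) (nu n) := hi2.add hi3
  have hi5 : Integrable (fun z : Fin n → Circle => ∑ j ∈ Finset.range (K + 1), (-1 : ℝ) ^ j * (((Cs (RR r z) (pk j)).card : ℝ) / (2 ^ j * j.factorial))) (nu n) :=
    integrable_finsetSum _ hi1
  have hL : (nu n (Cl n r)ᶜ).toReal -
        ∑ j ∈ Finset.range (K + 1), (-1 : ℝ) ^ j * ((∫ z, ((Cs (RR r z) (pk j)).card : ℝ) ∂(nu n)) / (2 ^ j * j.factorial)) =
      ∫ z, ((Cl n r)ᶜ.indicator 1 z - ∑ j ∈ Finset.range (K + 1), (-1 : ℝ) ^ j * (((Cs (RR r z) (pk j)).card : ℝ) / (2 ^ j * j.factorial))) ∂(nu n) := by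
    rw [integral_sub hi0 hi5, integral_finsetSum _ hi1, h0]
    simp_rw [integral_const_mul, integral_div]
  have hRt : 2 * ((K : ℝ) + 1) * ((∫ z, ((Cs (RR r z) (pk (K + 1))).card : ℝ) ∂(nu n)) / (2 ^ (K + 1) * (K + 1).factorial)) +
        ∑ j ∈ Finset.range (K + 1), (∫ z, (Bad (RR r z) j : ℝ) ∂(nu n)) + ∫ z, (Bad (RR r z) 1 : ℝ) ∂(nu n) =
      ∫ z, (2 * ((K : ℝ) + 1) * (((Cs (RR r z) (pk (K + 1))).card : ℝ) / (2 ^ (K + 1) * (K + 1).factorial)) +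
        ∑ j ∈ Finset.range (K + 1), (Bad (RR r z) j : ℝ) + (Bad (RR r z) 1 : ℝ)) ∂(nu n) := by
    rw [integral_add hi4 (integrable_Bad r n 1), integral_add hi2 hi3, integral_finsetSum _ fun j _ => integrable_Bad r n j,
      integral_const_mul, integral_div]
  rw [hL, hRt]
  refine (abs_integral_le_integral_abs).trans (integral_mono (hi0.sub hi5).abs (hi4.add (integrable_Bad r n 1)) fun z => ?_)
  have h := bonf_graph (RR r z) (RR_symm r z) K
  have hind : (Cl n r)ᶜ.indicator (1 : (Fin n → Circle) → ℝ) z = if ∀ u v, u ≠ v → ¬ RR r z u v then (1 : ℝ) else 0 := by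
    rw [Set.indicator_apply]
    refine if_congr ?_ rfl rfl
    simp [Cl, RR]
  simp only [Pi.sub_apply, Pi.add_apply]
  rw [hind]
  convert h
  rfl

theorem prob_lim {β : ℝ} (hβ : 0 < β) : Tendsto (fun n : ℕ => (nu n (Cl n (rr β n))ᶜ).toReal) atTop (𝓝 (Real.exp (-β ^ 3))) := by
  set S : ℕ → ℝ := fun K => ∑ j ∈ Finset.range (K + 1), (-1 : ℝ) ^ j * ((2 * β ^ 3) ^ j / (2 ^ j * j.factorial)) with hS
  set e : ℕ → ℝ := fun K => 2 * (K + 1) * ((2 * β ^ 3) ^ (K + 1) / (2 ^ (K + 1) * (K + 1).factorial)) with he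
  have hSl : Tendsto S atTop (𝓝 (Real.exp (-β ^ 3))) := by
    have h1 : HasSum (fun j : ℕ => (-β ^ 3) ^ j / j.factorial) (Real.exp (-β ^ 3)) := by
      rw [Real.exp_eq_exp_ℝ]
      exact NormedSpace.expSeries_div_hasSum_exp (-β ^ 3)
    have h2 := h1.tendsto_sum_nat.comp (tendsto_add_atTop_nat 1)
    refine h2.congr fun K => ?_
    refine Finset.sum_congr rfl fun j _ => ?_
    rw [mul_pow, neg_pow]
    field_simp
  have hel : Tendsto e atTop (𝓝 0) := by
    have h1 := (FloorSemiring.tendsto_pow_div_factorial_atTop (β ^ 3)).const_mul (2 * β ^ 3)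
    rw [mul_zero] at h1
    refine h1.congr fun K => ?_
    simp only [he]
    rw [Nat.factorial_succ, mul_pow]
    push_cast
    field_simp
    ring
  rw [Metric.tendsto_atTop']
  intro ε hε
  have h3 : Tendsto (fun K => e K + |S K - Real.exp (-β ^ 3)|) atTop (𝓝 0) := by
    have := hel.add (tendsto_iff_norm_sub_tendsto_zero.1 hSl)
    simpa using this
  obtain ⟨K, hK⟩ := (h3.eventually_lt_const hε).exists
  have hSn : Tendsto (fun n : ℕ => ∑ j ∈ Finset.range (K + 1), (-1 : ℝ) ^ j *
      ((∫ z, ((Cs (RR (rr β n) z) (pk j)).card : ℝ) ∂(nu n)) / (2 ^ j * j.factorial))) atTop (𝓝 (S K)) :=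
    tendsto_finsetSum _ fun j _ => ((Cs_lim hβ j).div_const _).const_mul _
  have hen : Tendsto (fun n : ℕ => 2 * ((K : ℝ) + 1) * ((∫ z, ((Cs (RR (rr β n) z) (pk (K + 1))).card : ℝ) ∂(nu n)) / (2 ^ (K + 1) * (K + 1).factorial)) +
        ∑ j ∈ Finset.range (K + 1), (∫ z, (Bad (RR (rr β n) z) j : ℝ) ∂(nu n)) + ∫ z, (Bad (RR (rr β n) z) 1 : ℝ) ∂(nu n)) atTop (𝓝 (e K)) := by
    have h4 := tendsto_finsetSum (Finset.range (K + 1)) fun j _ => Bad_lim hβ j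
    rw [Finset.sum_const_zero] at h4
    have h5 := ((((Cs_lim hβ (K + 1)).div_const (2 ^ (K + 1) * ((K + 1).factorial : ℝ))).const_mul (2 * ((K : ℝ) + 1))).add h4).add (Bad_lim hβ 1)
    rw [add_zero, add_zero] at h5
    exact h5
  have hD := hen.add ((hSn.sub_const (Real.exp (-β ^ 3))).abs)
  obtain ⟨N, hN⟩ := eventually_atTop.1 (hD.eventually_lt_const hK)
  refine ⟨N, fun n hn => ?_⟩
  have h6 := hN n hn.le
  have h7 := prob_bonf n (rr β n) K
  rw [Real.dist_eq]
  refine lt_of_le_of_lt (abs_sub_le _ (∑ j ∈ Finset.range (K + 1), (-1 : ℝ) ^ j *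
      ((∫ z, ((Cs (RR (rr β n) z) (pk j)).card : ℝ) ∂(nu n)) / (2 ^ j * j.factorial))) _) (lt_of_le_of_lt (add_le_add_left h7 _) h6)

end CUE



namespace CUE

theorem chord_iff {x y τ : ℝ} (hx : x ∈ Set.Ico (0:ℝ) (2*π)) (hy : y ∈ Set.Ico (0:ℝ) (2*π)) (hτ : τ ∈ Set.Icc (0:ℝ) π) :
    ‖(Circle.exp x : ℂ) - Circle.exp y‖ ≤ 2 * Real.sin (τ/2) ↔ min |x - y| (2*π - |x - y|) ≤ τ := by
  obtain ⟨hx0, hx1⟩ := hx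
  obtain ⟨hy0, hy1⟩ := hy
  obtain ⟨h0, h1⟩ := hτ
  have hpi := Real.pi_pos
  rw [← norm_div_sub_one, ← Circle.exp_sub, norm_exp_sub_one]
  have habs : |Real.sin ((x - y)/2)| = Real.sin (|x-y|/2) := by
    rcases abs_cases (x - y) with ⟨h, h'⟩ | ⟨h, h'⟩
    · rw [h, abs_of_nonneg (Real.sin_nonneg_of_nonneg_of_le_pi (by linarith) (by linarith))]
    · rw [h, ← abs_neg, ← Real.sin_neg, ← neg_div,
        abs_of_nonneg (Real.sin_nonneg_of_nonneg_of_le_pi (by linarith) (by linarith))]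
  have hd0 : 0 ≤ |x - y| := abs_nonneg _
  have hd1 : |x - y| < 2*π := by rw [abs_lt]; constructor <;> linarith
  rw [habs]
  generalize |x - y| = d at *
  have key : ∀ m, 0 ≤ m → m ≤ π → (2 * Real.sin (m/2) ≤ 2 * Real.sin (τ/2) ↔ m ≤ τ) := by
    intro m hm0 hm1
    rw [mul_le_mul_iff_right₀ two_pos, Real.strictMonoOn_sin.le_iff_le (by constructor <;> linarith) (by constructor <;> linarith)]
    constructor <;> intro h <;> linarith
  rcases le_total d π with h | h
  · rw [min_eq_left (by linarith)]; exact key d hd0 h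
  · rw [min_eq_right (by linarith), ← key (2*π - d) (by linarith) (by linarith)]
    rw [show (2*π - d)/2 = π - d/2 by ring, Real.sin_pi_sub]

theorem sInf_gt_iff {n : ℕ} (hn : 2 ≤ n) (f : Fin n → Fin n → ℝ) (τ : ℝ) :
    τ < sInf {d : ℝ | ∃ j k : Fin n, j < k ∧ d = f j k} ↔ ∀ j k, j < k → τ < f j k := by
  have hfin : {d : ℝ | ∃ j k : Fin n, j < k ∧ d = f j k}.Finite := by
    refine (Set.finite_range (fun q : Fin n × Fin n => f q.1 q.2)).subset ?_
    rintro d ⟨j, k, _, rfl⟩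
    exact ⟨(j, k), rfl⟩
  have hne : {d : ℝ | ∃ j k : Fin n, j < k ∧ d = f j k}.Nonempty :=
    ⟨_, ⟨0, by omega⟩, ⟨1, by omega⟩, by simp, rfl⟩
  rw [hfin.lt_csInf_iff hne]
  constructor
  · intro h j k hjk; exact h _ ⟨j, k, hjk, rfl⟩
  · rintro h d ⟨j, k, hjk, rfl⟩; exact h j k hjk

end CUE

/-- **Main Theorem, CUE version.**  Choose a matrix randomly from `CUE n` (the unitary
group `U(n)` with its Haar probability measure) and let `Z n U` be the closest spacing
between any two eigenvalues (arc-length distance on the circle between eigenvalue angles).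
Fix `β > 0`.  Then `Pr (Z n * (n^4 / (72π))^(1/3) > β) → exp (-β^3)` as `n → ∞`. -/
theorem closest_spacing_CUE
    (μ : ∀ n : ℕ, Measure (Matrix.unitaryGroup (Fin n) ℂ))
    (hμ : ∀ n, (μ n).IsHaarMeasure)
    (hμprob : ∀ n, IsProbabilityMeasure (μ n))
    -- `θ n U` lists the eigenvalue angles of `U` in `[0, 2π)`, with multiplicity:
    (θ : ∀ n : ℕ, Matrix.unitaryGroup (Fin n) ℂ → Fin n → ℝ)
    (hθmem : ∀ n U j, θ n U j ∈ Set.Ico (0 : ℝ) (2 * π))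
    (hθeig : ∀ n (U : Matrix.unitaryGroup (Fin n) ℂ),
      (Matrix.charpoly (U : Matrix (Fin n) (Fin n) ℂ)).roots
        = Multiset.map (fun j => Complex.exp ((θ n U j : ℂ) * Complex.I))
            (Finset.univ : Finset (Fin n)).val)
    -- `Z n U` is the minimal circular distance between two eigenvalue angles:
    (Z : ∀ n : ℕ, Matrix.unitaryGroup (Fin n) ℂ → ℝ)
    (hZ : ∀ n U, Z n U = sInf {d : ℝ | ∃ j k : Fin n, j < k ∧
      d = min |θ n U j - θ n U k| (2 * π - |θ n U j - θ n U k|)})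
    (β : ℝ) (hβ : 0 < β) :
    Tendsto
      (fun n : ℕ =>
        (μ n {U | Z n U * ((n : ℝ) ^ 4 / (72 * π)) ^ ((1 : ℝ) / 3) > β}).toReal)
      atTop (𝓝 (Real.exp (-β ^ 3))) := by
  refine (CUE.prob_lim hβ).congr' ?_
  filter_upwards [CUE.tau_ev hβ, eventually_ge_atTop 2] with n hn hn2
  obtain ⟨hn0, ht0, ht1⟩ := hn
  have := hμ n
  have := hμprob n
  have hnr : (0:ℝ) < n := by exact_mod_cast hn0
  have hc : 0 < ((n : ℝ) ^ 4 / (72 * π)) ^ ((1 : ℝ) / 3) := by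
    have := Real.pi_pos
    positivity
  rw [← CUE.haar_nu (μ n) (fun U j => Circle.exp (θ n U j)) ?_ (CUE.rr β n)]
  · congr 2
    ext U
    simp only [Set.mem_setOf_eq]
    rw [gt_iff_lt, ← div_lt_iff₀ hc, hZ n U,
      CUE.sInf_gt_iff hn2 (fun j k => min |θ n U j - θ n U k| (2 * π - |θ n U j - θ n U k|))]
    have key : ∀ i j, ‖(Circle.exp (θ n U i) : ℂ) - Circle.exp (θ n U j)‖ ≤ CUE.rr β n ↔
        min |θ n U i - θ n U j| (2 * π - |θ n U i - θ n U j|) ≤ CUE.tau β n := fun i j =>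
      CUE.chord_iff (hθmem n U i) (hθmem n U j) ⟨ht0.le, by linarith [Real.pi_gt_three]⟩
    have hcl : ((fun j => Circle.exp (θ n U j)) ∈ CUE.Cl n (CUE.rr β n)) ↔
      ∃ i j, i ≠ j ∧ ‖(Circle.exp (θ n U i) : ℂ) - Circle.exp (θ n U j)‖ ≤ CUE.rr β n := Iff.rfl
    rw [hcl]
    constructor
    · intro h j k hjk
      by_contra hlt
      exact h ⟨j, k, hjk.ne, (key j k).2 (not_lt.1 hlt)⟩
    · rintro h ⟨i, j, hij, hle⟩
      have hle' := (key i j).1 hle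
      rcases lt_or_gt_of_ne hij with hlt | hlt
      · exact absurd (h i j hlt) (not_lt.2 hle')
      · rw [abs_sub_comm] at hle'
        exact absurd (h j i hlt) (not_lt.2 hle')
  · intro U
    apply CUE.pU_eq_pT
    rw [hθeig n U]
    simp only [Circle.coe_exp]
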